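/- Let d ≥ 2 and let P ∈ ℂ[X_1,…,X_d] be elliptic with P(0) = 0. Let X ⊆ ℝ^d be open, w : X → ℂ continuous such that w does not vanish identically on any connected component of X, and ψ : X → X continuous and locally injective, such that C_{w,ψ} maps C_P^∞(X) into C_P^∞(X). Then C_{w,ψ} is power bounded on C_P^∞(X) (i.e., for every compact K ⊆ X there exist a compact L ⊆ X and C > 0 with sup_{x∈K}|C_{w,ψ}^m(f)(x)| ≤ C sup_{y∈L}|f(y)| for all m ∈ ℕ and f ∈ C_P^∞(X)) if and only if C_{w,ψ} is topologizable on C_P^∞(X) and the set {C_{w,ψ}^m(w) : m ∈ ℕ} is bounded in C(X), i.e., sup_{m∈ℕ} sup_{x∈K} |C_{w,ψ}^m(w)(x)| < ∞ for every compact K ⊆ X. -/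

import Mathlib

open scoped BigOperators

noncomputable section

/-- Partial derivative in the `i`-th coordinate direction. -/
def pderivE {d : ℕ} {F : Type*} [NormedAddCommGroup F] [NormedSpace ℝ F] (i : Fin d)
    (f : EuclideanSpace ℝ (Fin d) → F) : EuclideanSpace ℝ (Fin d) → F :=
  fun x => fderiv ℝ f x (EuclideanSpace.single i 1)

/-- Iterated partial derivative `∂^α f` for a multi-index `α : Fin d → ℕ`. -/
def mderivE {d : ℕ} {F : Type*} [NormedAddCommGroup F] [NormedSpace ℝ F] (α : Fin d → ℕ)
    (f : EuclideanSpace ℝ (Fin d) → F) : EuclideanSpace ℝ (Fin d) → F :=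
  (List.finRange d).foldr (fun i g => (pderivE i)^[α i] g) f

/-- The constant coefficient linear partial differential operator `P(∂)`. -/
def PDop {d : ℕ} (P : MvPolynomial (Fin d) ℂ) (f : EuclideanSpace ℝ (Fin d) → ℂ) :
    EuclideanSpace ℝ (Fin d) → ℂ :=
  fun x => ∑ α ∈ P.support, P.coeff α * mderivE (fun i => α i) f x

/-- `P` is elliptic: the principal part `P_m` has no nontrivial real zero. -/
def IsElliptic {d : ℕ} (P : MvPolynomial (Fin d) ℂ) : Prop :=
  ∀ ξ : Fin d → ℝ, ξ ≠ 0 →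
    MvPolynomial.eval (fun i => (ξ i : ℂ))
      (MvPolynomial.homogeneousComponent P.totalDegree P) ≠ 0

/-- Membership in `C_P^∞(X) = {f ∈ C^∞(X) : P(∂)f = 0 on X}`. -/
def MemCP {d : ℕ} (P : MvPolynomial (Fin d) ℂ) (X : Set (EuclideanSpace ℝ (Fin d)))
    (f : EuclideanSpace ℝ (Fin d) → ℂ) : Prop :=
  ContDiffOn ℝ (⊤ : ℕ∞) f X ∧ ∀ x ∈ X, PDop P f x = 0

namespace EK
open MvPolynomial

abbrev EE (d : ℕ) := EuclideanSpace ℝ (Fin d)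

def cproj {d : ℕ} (i : Fin d) : EE d →L[ℝ] ℂ :=
  Complex.ofRealCLM.comp (EuclideanSpace.proj i)

lemma cproj_apply {d : ℕ} (i : Fin d) (x : EE d) : cproj i x = ((x i : ℝ) : ℂ) := rfl

structure IsJet {d : ℕ} (U : Set (EE d)) (J : MvPolynomial (Fin d) ℂ → EE d → ℂ) : Prop where
  deriv : ∀ s, ∀ x ∈ U, HasFDerivAt (J s) (∑ i, J (s * X i) x • cproj i) x
  add : ∀ s s', ∀ x ∈ U, J (s + s') x = J s x + J s' x
  smul : ∀ c s, ∀ x ∈ U, J (C c * s) x = c * J s x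

lemma IsJet.sum_eq {d : ℕ} {U : Set (EE d)} {J : MvPolynomial (Fin d) ℂ → EE d → ℂ}
    (h : IsJet U J) {ι : Type*} (S : Finset ι) (f : ι → MvPolynomial (Fin d) ℂ) (x : EE d)
    (hx : x ∈ U) : J (∑ i ∈ S, f i) x = ∑ i ∈ S, J (f i) x := by
  classical
  induction S using Finset.induction_on with
  | empty =>
    have := h.smul 0 0 x hx
    simpa using this
  | insert a S ha ih => rw [Finset.sum_insert ha, Finset.sum_insert ha, h.add _ _ x hx, ih]

lemma IsJet.contDiffOn_nat {d : ℕ} {U : Set (EE d)} {J : MvPolynomial (Fin d) ℂ → EE d → ℂ}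
    (h : IsJet U J) (hU : IsOpen U) (n : ℕ) : ∀ s, ContDiffOn ℝ n (J s) U := by
  induction n with
  | zero =>
    intro s
    simp only [Nat.cast_zero, contDiffOn_zero]
    exact fun x hx => (h.deriv s x hx).continuousAt.continuousWithinAt
  | succ n ih =>
    intro s
    push_cast
    rw [contDiffOn_succ_iff_fderiv_of_isOpen hU]
    refine ⟨fun x hx => (h.deriv s x hx).differentiableAt.differentiableWithinAt, ?_, ?_⟩
    · intro h; simp at h
    · have : ContDiffOn ℝ n (fun x => ∑ i, J (s * X i) x • cproj i) U :=
        ContDiffOn.sum fun i _ => (ih (s * X i)).smul contDiffOn_const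
      exact this.congr fun x hx => (h.deriv s x hx).fderiv

lemma IsJet.contDiffOn {d : ℕ} {U : Set (EE d)} {J : MvPolynomial (Fin d) ℂ → EE d → ℂ}
    (h : IsJet U J) (hU : IsOpen U) (s) : ContDiffOn ℝ (⊤ : ℕ∞) (J s) U :=
  contDiffOn_infty.2 fun n => h.contDiffOn_nat hU n s

lemma IsJet.pderiv {d : ℕ} {U : Set (EE d)} {J : MvPolynomial (Fin d) ℂ → EE d → ℂ}
    (h : IsJet U J) (hU : IsOpen U) (s) (f : EE d → ℂ) (hf : Set.EqOn f (J s) U) (i : Fin d) :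
    Set.EqOn (pderivE i f) (J (s * X i)) U := by
  intro x hx
  have h1 : HasFDerivAt f (∑ i, J (s * X i) x • cproj i) x :=
    (h.deriv s x hx).congr_of_eventuallyEq (hf.eventuallyEq_of_mem (hU.mem_nhds hx))
  unfold pderivE
  rw [h1.fderiv]
  simp only [sum_apply, smul_apply, cproj_apply]
  rw [Finset.sum_eq_single i]
  · simp
  · intro j _ hj
    simp [hj]
  · simp

lemma IsJet.pderiv_iter {d : ℕ} {U : Set (EE d)} {J : MvPolynomial (Fin d) ℂ → EE d → ℂ}
    (h : IsJet U J) (hU : IsOpen U) (i : Fin d) (k : ℕ) : ∀ (s) (f : EE d → ℂ),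
    Set.EqOn f (J s) U →
    Set.EqOn ((pderivE i)^[k] f) (J (s * X i ^ k)) U := by
  induction k with
  | zero => intro s f hf; simpa using hf
  | succ k ih =>
    intro s f hf
    rw [Function.iterate_succ_apply]
    have := ih _ _ (h.pderiv hU s f hf i)
    rwa [mul_assoc, ← pow_succ'] at this

lemma IsJet.mderiv {d : ℕ} {U : Set (EE d)} {J : MvPolynomial (Fin d) ℂ → EE d → ℂ}
    (h : IsJet U J) (hU : IsOpen U) (s) (α : Fin d →₀ ℕ) :
    Set.EqOn (mderivE (fun i => α i) (J s)) (J (s * monomial α 1)) U := by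
  have key : ∀ l : List (Fin d), Set.EqOn
      (l.foldr (fun i g => (pderivE i)^[α i] g) (J s)) (J (s * (l.map fun i => X i ^ α i).prod)) U := by
    intro l
    induction l with
    | nil => intro x _; simp
    | cons a l ih =>
      have := h.pderiv_iter hU a (α a) _ _ ih
      simp only [List.foldr_cons, List.map_cons, List.prod_cons]
      rwa [mul_assoc, mul_comm _ (X a ^ α a)] at this
  have h2 := key (List.finRange d)
  rw [← Fin.prod_univ_def] at h2
  have h3 : (∏ i, X i ^ α i : MvPolynomial (Fin d) ℂ) = monomial α 1 := by
    rw [monomial_eq, Finsupp.prod_fintype] <;> simp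
  rw [h3] at h2
  exact h2

lemma IsJet.PDop {d : ℕ} {U : Set (EE d)} {J : MvPolynomial (Fin d) ℂ → EE d → ℂ}
    (h : IsJet U J) (hU : IsOpen U) (P s : MvPolynomial (Fin d) ℂ) (x) (hx : x ∈ U) :
    PDop P (J s) x = J (s * P) x := by
  unfold _root_.PDop
  have h1 : s * P = ∑ α ∈ P.support, C (P.coeff α) * (s * monomial α 1) := by
    conv_lhs => rw [P.as_sum, Finset.mul_sum]
    refine Finset.sum_congr rfl fun α _ => ?_
    rw [mul_left_comm, C_mul_monomial, mul_one]
  rw [h1, h.sum_eq _ _ x hx]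
  refine Finset.sum_congr rfl fun α _ => ?_
  rw [h.smul _ _ x hx, h.mderiv hU s α hx]

lemma IsJet.memCP {d : ℕ} {U : Set (EE d)} {J : MvPolynomial (Fin d) ℂ → EE d → ℂ}
    (h : IsJet U J) (hU : IsOpen U) (P s : MvPolynomial (Fin d) ℂ)
    (h0 : ∀ x ∈ U, J (s * P) x = 0) : MemCP P U (J s) :=
  ⟨h.contDiffOn hU s, fun x hx => by rw [h.PDop hU P s x hx, h0 x hx]⟩

lemma IsJet.mono {d : ℕ} {U V : Set (EE d)} {J : MvPolynomial (Fin d) ℂ → EE d → ℂ}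
    (h : IsJet U J) (hV : V ⊆ U) : IsJet V J :=
  ⟨fun s x hx => h.deriv s x (hV hx), fun s s' x hx => h.add s s' x (hV hx),
    fun c s x hx => h.smul c s x (hV hx)⟩

lemma IsJet.translate {d : ℕ} {U V : Set (EE d)} {J : MvPolynomial (Fin d) ℂ → EE d → ℂ}
    (h : IsJet U J) (p : EE d) (hV : ∀ x ∈ V, x - p ∈ U) : IsJet V (fun s x => J s (x - p)) := by
  refine ⟨fun s x hx => ?_, fun s s' x hx => h.add s s' _ (hV x hx),
    fun c s x hx => h.smul c s _ (hV x hx)⟩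
  have := h.deriv s _ (hV x hx)
  have h2 := this.comp x ((hasFDerivAt_id x).sub_const p)
  rw [ContinuousLinearMap.comp_id] at h2
  exact h2

/-- the bilinear pairing -/
def dotp {d : ℕ} (z : Fin d → ℂ) (x : EE d) : ℂ := ∑ i, z i * ((x i : ℝ) : ℂ)

def dotL {d : ℕ} (z : Fin d → ℂ) : EE d →L[ℝ] ℂ := ∑ i, z i • cproj i

lemma dotL_apply {d : ℕ} (z : Fin d → ℂ) (x : EE d) : dotL z x = dotp z x := by
  simp [dotL, dotp, cproj_apply]

lemma dotp_add {d : ℕ} (z : Fin d → ℂ) (x y : EE d) : dotp z (x + y) = dotp z x + dotp z y := by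
  simp only [← dotL_apply, map_add]

lemma hasFDerivAt_cexp_dotp {d : ℕ} (z : Fin d → ℂ) (x : EE d) :
    HasFDerivAt (fun x => Complex.exp (dotp z x)) (Complex.exp (dotp z x) • dotL z) x := by
  have h1 : HasFDerivAt (fun x => dotp z x) (dotL z) x := by
    have := (dotL z).hasFDerivAt (x := x)
    refine this.congr_of_eventuallyEq (Filter.Eventually.of_forall fun y => (dotL_apply z y).symm)
  exact h1.cexp

lemma isJet_exp {d : ℕ} (z : Fin d → ℂ) (U : Set (EE d)) :
    IsJet U (fun s x => eval z s * Complex.exp (dotp z x)) := by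
  refine ⟨fun s x _ => ?_, fun s s' x _ => by simp [add_mul], fun c s x _ => by simp [mul_assoc]⟩
  have := (hasFDerivAt_cexp_dotp z x).const_mul (eval z s)
  refine this.congr_fderiv ?_
  simp only [dotL, Finset.smul_sum]
  refine Finset.sum_congr rfl fun i _ => ?_
  simp only [smul_smul, eval_mul, eval_X]
  ring_nf

end EK

namespace EK
open MvPolynomial

def Dp {d : ℕ} (f : (Fin d → ℂ) → ℂ) (n : ℕ) : Prop :=
  ∃ C : ℝ, 0 ≤ C ∧ ∀ a b : Fin d → ℂ, ‖f (a + b)‖ ≤ C * (‖a‖ + (1 + ‖b‖)) ^ n ∧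
    ‖f (a + b) - f a‖ * (‖a‖ + (1 + ‖b‖)) ≤ C * (1 + ‖b‖) * (‖a‖ + (1 + ‖b‖)) ^ n

lemma Dp.const {d : ℕ} (c : ℂ) : Dp (fun _ : Fin d → ℂ => c) 0 :=
  ⟨‖c‖, norm_nonneg _, fun a b => ⟨by simp, by simp; positivity⟩⟩

lemma Dp.coord {d : ℕ} (i : Fin d) : Dp (fun z : Fin d → ℂ => z i) 1 := by
  refine ⟨1, zero_le_one, fun a b => ⟨?_, ?_⟩⟩
  · have h1 := norm_le_pi_norm (a + b) i
    have h2 := norm_add_le a b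
    simp only [one_mul, pow_one]; linarith
  · have h1 := norm_le_pi_norm b i
    have h2 := norm_nonneg a
    have h3 := norm_nonneg b
    simp only [Pi.add_apply, add_sub_cancel_left, one_mul, pow_one]
    apply mul_le_mul_of_nonneg_right _ (by positivity)
    linarith

lemma Dp.mul {d : ℕ} {f g : (Fin d → ℂ) → ℂ} {n k : ℕ} (hf : Dp f n) (hg : Dp g k) :
    Dp (fun z => f z * g z) (n + k) := by
  obtain ⟨C, hC, hf⟩ := hf
  obtain ⟨D, hD, hg⟩ := hg
  refine ⟨2 * (C * D), by positivity, fun a b => ?_⟩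
  obtain ⟨f1, f2⟩ := hf a b
  obtain ⟨g1, g2⟩ := hg a b
  have f0 : ‖f a‖ ≤ C * (‖a‖ + (1 + ‖b‖)) ^ n := by
    have := (hf a 0).1
    simp only [add_zero, norm_zero] at this
    refine this.trans ?_
    have := norm_nonneg b
    gcongr
    linarith
  set B := ‖a‖ + (1 + ‖b‖) with hB
  have hBpos : 0 ≤ B := by positivity
  have hT : 0 ≤ 1 + ‖b‖ := by positivity
  constructor
  · rw [norm_mul, pow_add]
    calc ‖f (a + b)‖ * ‖g (a + b)‖ ≤ (C * B ^ n) * (D * B ^ k) := by gcongr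
      _ ≤ 2 * (C * D) * (B ^ n * B ^ k) := by
        have : 0 ≤ C * D * (B ^ n * B ^ k) := by positivity
        nlinarith
  · have e : f (a + b) * g (a + b) - f a * g a
        = (f (a + b) - f a) * g (a + b) + f a * (g (a + b) - g a) := by ring
    rw [e]
    calc ‖(f (a + b) - f a) * g (a + b) + f a * (g (a + b) - g a)‖ * B
        ≤ (‖f (a + b) - f a‖ * ‖g (a + b)‖ + ‖f a‖ * ‖g (a + b) - g a‖) * B := by
          gcongr
          refine (norm_add_le _ _).trans ?_
          rw [norm_mul, norm_mul]
      _ = (‖f (a + b) - f a‖ * B) * ‖g (a + b)‖ + ‖f a‖ * (‖g (a + b) - g a‖ * B) := by ring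
      _ ≤ (C * (1 + ‖b‖) * B ^ n) * (D * B ^ k) + (C * B ^ n) * (D * (1 + ‖b‖) * B ^ k) := by
          gcongr
      _ = _ := by rw [pow_add]; ring

lemma Dp.pow {d : ℕ} {f : (Fin d → ℂ) → ℂ} {n : ℕ} (hf : Dp f n) (k : ℕ) :
    Dp (fun z => f z ^ k) (n * k) := by
  induction k with
  | zero => simpa using Dp.const 1
  | succ k ih => simpa [pow_succ, mul_add] using ih.mul hf

lemma Dp.prod {d : ℕ} (α : Fin d →₀ ℕ) (S : Finset (Fin d)) :
    Dp (fun z => ∏ i ∈ S, z i ^ α i) (∑ i ∈ S, α i) := by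
  classical
  induction S using Finset.induction_on with
  | empty => simpa using Dp.const 1
  | insert a S ha ih =>
    simp only [Finset.prod_insert ha, Finset.sum_insert ha]
    have := ((Dp.coord a).pow (α a)).mul ih
    simpa using this

lemma eval_monomial_prod {d : ℕ} (α : Fin d →₀ ℕ) (z : Fin d → ℂ) :
    eval z (monomial α (1 : ℂ)) = ∏ i, z i ^ α i := by
  rw [eval_monomial, one_mul, Finsupp.prod_fintype]; simp

lemma Dp.monomial {d : ℕ} (α : Fin d →₀ ℕ) :
    Dp (fun z : Fin d → ℂ => eval z (MvPolynomial.monomial α (1 : ℂ))) α.degree := by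
  have := Dp.prod α Finset.univ
  simp only [eval_monomial_prod]
  rwa [Finsupp.degree_eq_sum]

lemma degree_le_totalDegree {d : ℕ} (P : MvPolynomial (Fin d) ℂ) (α) (h : α ∈ P.support) :
    α.degree ≤ P.totalDegree := by
  have := le_totalDegree h
  rwa [Finsupp.degree_apply]

lemma eval_eq_sum_mon {d : ℕ} (P : MvPolynomial (Fin d) ℂ) (z : Fin d → ℂ) :
    eval z P = ∑ α ∈ P.support, P.coeff α * eval z (MvPolynomial.monomial α (1 : ℂ)) := by
  conv_lhs => rw [P.as_sum, map_sum]
  refine Finset.sum_congr rfl fun α _ => ?_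
  rw [eval_monomial, eval_monomial, one_mul]

lemma eval_bound {d : ℕ} (P : MvPolynomial (Fin d) ℂ) (n : ℕ) (hn : P.totalDegree ≤ n) :
    ∃ C : ℝ, 0 < C ∧ ∀ z : Fin d → ℂ, ‖eval z P‖ ≤ C * (1 + ‖z‖) ^ n := by
  choose C hC hC2 using fun α : Fin d →₀ ℕ => Dp.monomial α
  refine ⟨1 + ∑ α ∈ P.support, ‖P.coeff α‖ * C α, ?_, fun z => ?_⟩
  · have : 0 ≤ ∑ α ∈ P.support, ‖P.coeff α‖ * C α :=
      Finset.sum_nonneg fun α _ => mul_nonneg (norm_nonneg _) (hC α)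
    linarith
  · rw [eval_eq_sum_mon]
    refine (norm_sum_le _ _).trans ?_
    rw [add_mul, Finset.sum_mul]
    have h0 : 0 ≤ 1 * (1 + ‖z‖) ^ n := by positivity
    refine le_trans ?_ (le_add_of_nonneg_left h0)
    refine Finset.sum_le_sum fun α hα => ?_
    rw [norm_mul, mul_assoc]
    have h1 := (hC2 α 0 z).1
    simp only [zero_add, norm_zero] at h1
    gcongr
    refine h1.trans ?_
    have := hC α
    gcongr
    · linarith [norm_nonneg z]
    · exact (degree_le_totalDegree P α hα).trans hn

def pm {d : ℕ} (P : MvPolynomial (Fin d) ℂ) : MvPolynomial (Fin d) ℂ :=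
  homogeneousComponent P.totalDegree P

lemma pm_homog {d : ℕ} (P : MvPolynomial (Fin d) ℂ) : (pm P).IsHomogeneous P.totalDegree :=
  homogeneousComponent_isHomogeneous _ _

lemma pm_smul {d : ℕ} (P : MvPolynomial (Fin d) ℂ) (c : ℂ) (z : Fin d → ℂ) :
    eval (c • z) (pm P) = c ^ P.totalDegree * eval z (pm P) := by
  rw [eval_eq_sum_mon, eval_eq_sum_mon, Finset.mul_sum]
  refine Finset.sum_congr rfl fun α hα => ?_
  rw [eval_monomial_prod, eval_monomial_prod]
  have := (pm_homog P) (mem_support_iff.1 hα)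
  simp only [Pi.smul_apply, smul_eq_mul, mul_pow, Finset.prod_mul_distrib]
  rw [Finset.prod_pow_eq_pow_sum]
  have h2 : ∑ i, α i = P.totalDegree := by
    rw [← this, Finsupp.weight_apply, Finsupp.sum_fintype] <;> simp
  rw [h2]; ring

lemma diff_bound {d : ℕ} (P : MvPolynomial (Fin d) ℂ) :
    ∃ C : ℝ, 0 < C ∧ ∀ a b : Fin d → ℂ,
      ‖eval (a + b) P - eval a (pm P)‖ * (‖a‖ + (1 + ‖b‖)) ≤
        C * (1 + ‖b‖) * (‖a‖ + (1 + ‖b‖)) ^ P.totalDegree := by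
  choose C hC hC2 using fun α : Fin d →₀ ℕ => Dp.monomial α
  refine ⟨1 + ∑ α ∈ P.support, ‖P.coeff α‖ * C α, ?_, fun a b => ?_⟩
  · have : 0 ≤ ∑ α ∈ P.support, ‖P.coeff α‖ * C α :=
      Finset.sum_nonneg fun α _ => mul_nonneg (norm_nonneg _) (hC α)
    linarith
  · set m := P.totalDegree
    have e : eval (a + b) P - eval a (pm P) = ∑ α ∈ P.support,
        P.coeff α * (eval (a + b) (MvPolynomial.monomial α (1 : ℂ)) -
          if α.degree = m then eval a (MvPolynomial.monomial α (1 : ℂ)) else 0) := by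
      simp only [mul_sub, Finset.sum_sub_distrib]
      rw [← eval_eq_sum_mon]
      congr 1
      rw [pm, homogeneousComponent_apply, map_sum, Finset.sum_filter]
      refine Finset.sum_congr rfl fun α _ => ?_
      split_ifs
      · rw [eval_monomial, eval_monomial, one_mul]
      · simp
    rw [e]
    have hb := norm_nonneg b
    have ha := norm_nonneg a
    set B := ‖a‖ + (1 + ‖b‖) with hB
    have hB1 : 1 ≤ B := by linarith
    have hTB : 1 + ‖b‖ ≤ B := by linarith
    calc _ ≤ (∑ α ∈ P.support, ‖P.coeff α * (eval (a + b) (MvPolynomial.monomial α (1 : ℂ)) -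
          if α.degree = m then eval a (MvPolynomial.monomial α (1 : ℂ)) else 0)‖) * B := by
            gcongr; exact norm_sum_le _ _
      _ = ∑ α ∈ P.support, ‖P.coeff α‖ * (‖(eval (a + b) (MvPolynomial.monomial α (1 : ℂ)) -
          if α.degree = m then eval a (MvPolynomial.monomial α (1 : ℂ)) else 0)‖ * B) := by
            rw [Finset.sum_mul]
            refine Finset.sum_congr rfl fun α _ => by rw [norm_mul, mul_assoc]
      _ ≤ ∑ α ∈ P.support, ‖P.coeff α‖ * (C α * (1 + ‖b‖) * B ^ m) := by
            refine Finset.sum_le_sum fun α hα => ?_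
            refine mul_le_mul_of_nonneg_left ?_ (norm_nonneg _)
            have hC0 := hC α
            obtain ⟨h1, h2⟩ := hC2 α a b
            have hdeg := degree_le_totalDegree P α hα
            split_ifs with h
            · rw [h] at h2; exact h2
            · rw [sub_zero]
              have hlt : α.degree + 1 ≤ m := lt_of_le_of_ne hdeg h
              calc _ ≤ C α * B ^ α.degree * B := by gcongr
                _ = C α * 1 * B ^ (α.degree + 1) := by ring
                _ ≤ C α * (1 + ‖b‖) * B ^ m := by
                  gcongr
                  linarith
      _ = (∑ α ∈ P.support, ‖P.coeff α‖ * C α) * ((1 + ‖b‖) * B ^ m) := by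
            rw [Finset.sum_mul]
            refine Finset.sum_congr rfl fun α _ => by ring
      _ ≤ _ := by
            have : 0 ≤ (1 + ‖b‖) * B ^ m := by positivity
            nlinarith

def PB {d : ℕ} (P : MvPolynomial (Fin d) ℂ) : MvPolynomial (Fin d) ℂ :=
  aeval (fun i => - X i) (map (starRingEnd ℂ) P)

lemma eval_PB {d : ℕ} (P : MvPolynomial (Fin d) ℂ) (z : Fin d → ℂ) :
    eval z (PB P) = (starRingEnd ℂ) (eval (fun i => - (starRingEnd ℂ) (z i)) P) := by
  rw [PB]
  induction P using MvPolynomial.induction_on with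
  | C a => simp
  | add p q hp hq => simp only [map_add, hp, hq]
  | mul_X p i hp => simp only [map_mul, hp, map_X, aeval_X, eval_X, map_neg]; simp

/-- the frequency 2 pi i xi + eta -/
def re2 {d : ℕ} (x : EE d) : Fin d → ℂ := fun i => ((x i : ℝ) : ℂ)

def zz {d : ℕ} (ξ η : EE d) : Fin d → ℂ := (2 * Real.pi * Complex.I : ℂ) • re2 ξ + re2 η

def qq {d : ℕ} (P : MvPolynomial (Fin d) ℂ) : MvPolynomial (Fin d) ℂ := P * PB P

lemma norm_re2_le {d : ℕ} (x : EE d) : ‖re2 x‖ ≤ ‖x‖ := by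
  rw [pi_norm_le_iff_of_nonneg (norm_nonneg _)]
  intro i
  simp only [re2, Complex.norm_real]
  exact PiLp.norm_apply_le x i

lemma norm_le_re2 {d : ℕ} (x : EE d) : ‖x‖ ≤ d * ‖re2 x‖ := by
  have h := EuclideanSpace.basisFun (Fin d) ℝ
  calc ‖x‖ = ‖∑ i, (x i) • EuclideanSpace.single i (1 : ℝ)‖ := by
        congr 1
        ext j
        simp [Finset.sum_apply, Pi.single_apply]
    _ ≤ ∑ i : Fin d, ‖(x i) • EuclideanSpace.single i (1 : ℝ)‖ := norm_sum_le _ _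
    _ ≤ ∑ i : Fin d, ‖re2 x‖ := by
        refine Finset.sum_le_sum fun i _ => ?_
        rw [norm_smul]
        have := norm_le_pi_norm (re2 x) i
        simp only [re2, Complex.norm_real] at this
        simpa using this
    _ = _ := by simp

lemma norm_2pi : ‖(2 * Real.pi * Complex.I : ℂ)‖ = 2 * Real.pi := by
  simp [abs_of_pos Real.pi_pos]

lemma PB_zz {d : ℕ} (P : MvPolynomial (Fin d) ℂ) (ξ η : EE d) :
    eval (zz ξ η) (PB P) = (starRingEnd ℂ)
      (eval ((2 * Real.pi * Complex.I : ℂ) • re2 ξ + - re2 η) P) := by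
  rw [eval_PB]
  have h : (fun i => - (starRingEnd ℂ) (zz ξ η i)) =
      (2 * Real.pi * Complex.I : ℂ) • re2 ξ + - re2 η := by
    funext i
    have h2 : (starRingEnd ℂ) (2 : ℂ) = 2 := map_ofNat _ 2
    simp [zz, re2, h2]
    ring
  rw [h]

lemma elliptic_lower {d : ℕ} (hd : 2 ≤ d) (P : MvPolynomial (Fin d) ℂ) (hell : IsElliptic P) :
    ∃ c : ℝ, 0 < c ∧ ∀ ξ : EE d, c * ‖ξ‖ ^ P.totalDegree ≤ ‖eval (re2 ξ) (pm P)‖ := by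
  have hne : (Metric.sphere (0 : EE d) 1).Nonempty :=
    ⟨EuclideanSpace.single ⟨0, by omega⟩ 1, by simp⟩
  · have hcont : Continuous fun ξ : EE d => ‖eval (re2 ξ) (pm P)‖ := by
      refine ((MvPolynomial.continuous_eval (pm P)).comp ?_).norm
      refine continuous_pi fun i => ?_
      exact Complex.continuous_ofReal.comp (EuclideanSpace.proj (𝕜 := ℝ) i).continuous
    obtain ⟨ξ0, h0, hmin⟩ := (isCompact_sphere (0 : EE d) 1).exists_isMinOn hne hcont.continuousOn
    refine ⟨‖eval (re2 ξ0) (pm P)‖, ?_, fun ξ => ?_⟩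
    · rw [norm_pos_iff]
      refine hell (fun i => ξ0 i) ?_
      intro h
      have : ξ0 = 0 := by ext i; exact congrFun h i
      simp [this] at h0
    · by_cases hξ : ξ = 0
      · subst hξ
        by_cases hm : P.totalDegree = 0
        · have e1 : re2 (0 : EE d) = (0 : ℂ) • re2 ξ0 := by ext i; simp [re2]
          rw [e1, pm_smul, hm]; simp
        · simp [hm]
      · have hn : ‖ξ‖ ≠ 0 := norm_ne_zero_iff.2 hξ
        have e : re2 ξ = (‖ξ‖ : ℂ) • re2 ((‖ξ‖⁻¹ : ℝ) • ξ) := by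
          ext i
          simp only [re2, Pi.smul_apply, smul_eq_mul, PiLp.smul_apply]
          push_cast
          rw [mul_inv_cancel_left₀]
          exact_mod_cast hn
        rw [e, pm_smul, norm_mul, norm_pow, Complex.norm_real, norm_norm, mul_comm]
        gcongr
        apply hmin
        simp [norm_smul, hn]

end EK

namespace EK
open MvPolynomial

lemma norm_a_le {d : ℕ} (ξ : EE d) : ‖(2 * Real.pi * Complex.I : ℂ) • re2 ξ‖ ≤ 2 * Real.pi * ‖ξ‖ := by
  rw [norm_smul, norm_2pi]
  have := norm_re2_le ξ
  have := Real.pi_pos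
  gcongr

lemma norm_zz_le {d : ℕ} (ξ η : EE d) : ‖zz ξ η‖ ≤ 2 * Real.pi * ‖ξ‖ + ‖η‖ :=
  (norm_add_le _ _).trans (add_le_add (norm_a_le ξ) (norm_re2_le η))

lemma F1_aux (M r r' : ℂ) : ‖M‖ ^ 2 - (‖M‖ * ‖r'‖ + ‖r‖ * ‖M‖ + ‖r‖ * ‖r'‖) ≤
    ((M + r) * ((starRingEnd ℂ) M + (starRingEnd ℂ) r')).re := by
  have e : (M + r) * ((starRingEnd ℂ) M + (starRingEnd ℂ) r') =
     M * (starRingEnd ℂ) M + (M * (starRingEnd ℂ) r' + r * (starRingEnd ℂ) M + r * (starRingEnd ℂ) r') := by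
    ring
  rw [e, Complex.add_re, Complex.mul_conj, Complex.ofReal_re, Complex.normSq_eq_norm_sq]
  have h1 : ‖(M * (starRingEnd ℂ) r' + r * (starRingEnd ℂ) M + r * (starRingEnd ℂ) r')‖ ≤
     ‖M‖ * ‖r'‖ + ‖r‖ * ‖M‖ + ‖r‖ * ‖r'‖ := by
    refine (norm_add₃_le).trans ?_
    simp
  have h2 := Complex.abs_re_le_norm (M * (starRingEnd ℂ) r' + r * (starRingEnd ℂ) M + r * (starRingEnd ℂ) r')
  have h3 := neg_abs_le (M * (starRingEnd ℂ) r' + r * (starRingEnd ℂ) M + r * (starRingEnd ℂ) r').re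
  linarith

lemma F1 {d : ℕ} (hd : 2 ≤ d) (P : MvPolynomial (Fin d) ℂ) (hell : IsElliptic P) :
    ∃ c C : ℝ, 0 < c ∧ 0 < C ∧ ∀ ξ η : EE d,
      c * ‖ξ‖ ^ (2 * P.totalDegree) - C * (1 + ‖η‖) ^ (2 * P.totalDegree) ≤
        (eval (zz ξ η) (qq P)).re := by
  obtain ⟨c0, hc0, hlow⟩ := elliptic_lower hd P hell
  obtain ⟨C, hC, hdiff⟩ := diff_bound P
  obtain ⟨C1, hC1, hup⟩ := eval_bound (pm P) P.totalDegree (pm_homog P).totalDegree_le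
  set m := P.totalDegree
  set D := 2 * C1 * C + C ^ 2 with hD
  have hDpos : 0 < D := by positivity
  have hpi := Real.pi_pos
  have hpi3 := Real.pi_gt_three
  set K := 1 + D * 4 ^ m * (2 * Real.pi) ^ (2 * m) * 2 / c0 ^ 2 with hK
  have hK1 : 1 ≤ K := by
    have : 0 ≤ D * 4 ^ m * (2 * Real.pi) ^ (2 * m) * 2 / c0 ^ 2 := by positivity
    linarith
  refine ⟨c0 ^ 2 / 2, D * (K + 1) ^ (2 * m), by positivity, by positivity, fun ξ η => ?_⟩
  set a := (2 * Real.pi * Complex.I : ℂ) • re2 ξ with ha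
  set b := re2 η with hb
  have hbη : ‖b‖ ≤ ‖η‖ := norm_re2_le η
  set T := 1 + ‖b‖ with hT
  have hT1 : 1 ≤ T := by have := norm_nonneg b; linarith
  set B := ‖a‖ + T with hB
  have hna := norm_nonneg a
  have hB1 : 1 ≤ B := by linarith
  have hTB : T ≤ B := by linarith
  set M := eval a (pm P) with hM
  set r := eval (a + b) P - M with hr
  set r' := eval (a + -b) P - M with hr'
  have hrB : ‖r‖ * B ≤ C * T * B ^ m := hdiff a b
  have hr'B : ‖r'‖ * B ≤ C * T * B ^ m := by
    have := hdiff a (-b)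
    rw [norm_neg] at this
    exact this
  have hMB : ‖M‖ ≤ C1 * B ^ m := by
    refine (hup a).trans ?_
    gcongr
    linarith
  have hr'2 : ‖r'‖ ≤ C * B ^ m := by
    have h1 : ‖r'‖ * B ≤ (C * B ^ m) * B := by
      refine hr'B.trans ?_
      have : 0 ≤ C * B ^ m := by positivity
      nlinarith
    exact le_of_mul_le_mul_right h1 (by linarith)
  have hMlow : c0 * ‖ξ‖ ^ m ≤ ‖M‖ := by
    rw [hM, ha, pm_smul, norm_mul, norm_pow, norm_2pi]
    have h1 := hlow ξ
    have h2 : 1 ≤ (2 * Real.pi) ^ m := one_le_pow₀ (by linarith)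
    have h3 : 0 ≤ ‖eval (re2 ξ) (pm P)‖ := norm_nonneg _
    nlinarith
  have hMsq : c0 ^ 2 * ‖ξ‖ ^ (2 * m) ≤ ‖M‖ ^ 2 := by
    have : (c0 * ‖ξ‖ ^ m) ^ 2 ≤ ‖M‖ ^ 2 := by gcongr
    calc _ = (c0 * ‖ξ‖ ^ m) ^ 2 := by ring
      _ ≤ _ := this
  set err := ‖M‖ * ‖r'‖ + ‖r‖ * ‖M‖ + ‖r‖ * ‖r'‖ with herr
  have hre : ‖M‖ ^ 2 - err ≤ (eval (zz ξ η) (qq P)).re := by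
    have h := F1_aux M r r'
    have e : eval (zz ξ η) (qq P) = (M + r) * ((starRingEnd ℂ) M + (starRingEnd ℂ) r') := by
      rw [qq, eval_mul, PB_zz, ← map_add]
      congr 1
      · simp [hr, zz]; rfl
      · simp [hr']; rfl
    rw [e]; exact h
  have herrB : err * B ≤ D * T * B ^ (2 * m) := by
    calc err * B = ‖M‖ * (‖r'‖ * B) + (‖r‖ * B) * ‖M‖ + (‖r‖ * B) * ‖r'‖ := by rw [herr]; ring
      _ ≤ (C1 * B ^ m) * (C * T * B ^ m) + (C * T * B ^ m) * (C1 * B ^ m)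
          + (C * T * B ^ m) * (C * B ^ m) := by gcongr
      _ = D * T * B ^ (2 * m) := by rw [hD]; ring
  by_cases hcase : K * T ≤ ‖a‖
  · have h1 : B ≤ 2 * ‖a‖ := by nlinarith
    have h2 : K * T ≤ B := by linarith
    have h3 : err * K ≤ D * B ^ (2 * m) := by
      have : (err * K) * B ≤ (D * B ^ (2 * m)) * B := by
        calc (err * K) * B = (err * B) * K := by ring
          _ ≤ (D * T * B ^ (2 * m)) * K := by gcongr
          _ = (D * B ^ (2 * m)) * (K * T) := by ring
          _ ≤ _ := by gcongr
      exact le_of_mul_le_mul_right this (by linarith)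
    have h4 : B ^ (2 * m) ≤ 4 ^ m * (2 * Real.pi) ^ (2 * m) * ‖ξ‖ ^ (2 * m) := by
      have : ‖a‖ ≤ 2 * Real.pi * ‖ξ‖ := norm_a_le ξ
      calc B ^ (2 * m) ≤ (2 * (2 * Real.pi * ‖ξ‖)) ^ (2 * m) := by gcongr; linarith
        _ = _ := by rw [mul_pow, mul_pow _ ‖ξ‖, pow_mul 2 2 m]; norm_num; ring
    have h5 : err * K ≤ (c0 ^ 2 / 2 * ‖ξ‖ ^ (2 * m)) * K := by
      calc err * K ≤ D * (4 ^ m * (2 * Real.pi) ^ (2 * m) * ‖ξ‖ ^ (2 * m)) := by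
            refine h3.trans ?_; gcongr
        _ = (c0 ^ 2 / 2 * ‖ξ‖ ^ (2 * m)) * (D * 4 ^ m * (2 * Real.pi) ^ (2 * m) * 2 / c0 ^ 2) := by
            field_simp
        _ ≤ _ := by
            gcongr
            linarith
    have h6 := le_of_mul_le_mul_right h5 (by linarith)
    have h7 : 0 ≤ D * (K + 1) ^ (2 * m) * (1 + ‖η‖) ^ (2 * m) := by positivity
    linarith
  · push Not at hcase
    have h1 : B ≤ (K + 1) * T := by linarith
    have h2 : err ≤ D * B ^ (2 * m) := by
      have : err * B ≤ (D * B ^ (2 * m)) * B := by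
        refine herrB.trans ?_
        calc D * T * B ^ (2 * m) = (D * B ^ (2 * m)) * T := by ring
          _ ≤ _ := by gcongr
      exact le_of_mul_le_mul_right this (by linarith)
    have h3 : D * B ^ (2 * m) ≤ D * (K + 1) ^ (2 * m) * (1 + ‖η‖) ^ (2 * m) := by
      rw [mul_assoc, ← mul_pow]
      gcongr
      refine h1.trans ?_
      gcongr
      linarith
    have h4 : 0 ≤ c0 ^ 2 * ‖ξ‖ ^ (2 * m) := by positivity
    linarith

end EK

namespace EK
open MvPolynomial

lemma absorb (n : ℕ) (ε : ℝ) (hε : 0 < ε) : ∃ C : ℝ, 0 < C ∧ ∀ y : ℝ, 0 ≤ y →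
    (1 + y) ^ n ≤ C * Real.exp (ε * y) := by
  refine ⟨n.factorial / ε ^ n * Real.exp ε, by positivity, fun y hy => ?_⟩
  have h := Real.pow_div_factorial_le_exp (ε * (1 + y)) (by positivity) n
  rw [mul_add, Real.exp_add, mul_one] at h
  have hf : (0 : ℝ) < n.factorial := by positivity
  have e : (1 + y) ^ n = n.factorial / ε ^ n * ((ε + ε * y) ^ n / n.factorial) := by
    have : ε + ε * y = ε * (1 + y) := by ring
    rw [this, mul_pow]
    field_simp
  rw [e, mul_assoc]
  gcongr

lemma absorb_poly {d : ℕ} (s : MvPolynomial (Fin d) ℂ) (ε : ℝ) (hε : 0 < ε) :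
    ∃ C : ℝ, 0 < C ∧ ∀ z : Fin d → ℂ, ‖eval z s‖ ≤ C * Real.exp (ε * ‖z‖) := by
  obtain ⟨C, hC, h⟩ := eval_bound s _ le_rfl
  obtain ⟨C', hC', h'⟩ := absorb s.totalDegree ε hε
  refine ⟨C * C', by positivity, fun z => (h z).trans ?_⟩
  rw [mul_assoc]
  gcongr
  exact h' _ (norm_nonneg _)

lemma lin_sub_pow (m : ℕ) (hm : 1 ≤ m) (a N : ℝ) (ha : 0 < a) :
    ∃ C : ℝ, ∀ y : ℝ, 0 ≤ y → N * y - a * y ^ (2 * m) ≤ C := by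
  refine ⟨N ^ 2 / (4 * a) + a, fun y hy => ?_⟩
  have h1 : y ^ 2 - 1 ≤ y ^ (2 * m) := by
    rcases le_total y 1 with h | h
    · have : 0 ≤ y ^ (2 * m) := by positivity
      nlinarith
    · have : y ^ 2 ≤ y ^ (2 * m) := pow_le_pow_right₀ h (by omega)
      linarith
  have h2 : a * (y ^ 2 - 1) ≤ a * y ^ (2 * m) := by gcongr
  have h3 : N * y - a * y ^ 2 ≤ N ^ 2 / (4 * a) := by
    rw [le_div_iff₀ (by positivity)]
    nlinarith [sq_nonneg (N - 2 * a * y)]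
  linarith

lemma dotp_zz_re {d : ℕ} (ξ η x : EE d) : (dotp (zz ξ η) x).re = ∑ i, η i * x i := by
  simp only [dotp, Complex.re_sum]
  refine Finset.sum_congr rfl fun i _ => ?_
  simp [zz, re2]

lemma dotp_zz_re_inner {d : ℕ} (ξ η x : EE d) : (dotp (zz ξ η) x).re = inner ℝ η x := by
  rw [dotp_zz_re, PiLp.inner_apply]
  refine Finset.sum_congr rfl fun i _ => ?_
  simp [mul_comm]

lemma dotp_zz_re_self {d : ℕ} (ξ x : EE d) (l : ℝ) :
    (dotp (zz ξ (-(l / ‖x‖) • x)) x).re = - (l * ‖x‖) := by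
  rw [dotp_zz_re_inner, inner_smul_left, real_inner_self_eq_norm_sq]
  by_cases h : ‖x‖ = 0
  · simp [h]
  · simp; field_simp

lemma norm_eta {d : ℕ} (x : EE d) (l : ℝ) (hl : 0 ≤ l) : ‖-(l / ‖x‖) • x‖ ≤ l := by
  rw [norm_smul, norm_neg, norm_div, norm_norm, Real.norm_of_nonneg hl]
  by_cases h : ‖x‖ = 0
  · simp [h, hl]
  · field_simp; rfl

lemma B1 {d : ℕ} (hd : 2 ≤ d) (P : MvPolynomial (Fin d) ℂ) (hell : IsElliptic P)
    (hm : 1 ≤ P.totalDegree) (s : MvPolynomial (Fin d) ℂ) (t0 B N : ℝ) (ht0 : 0 < t0) (hB : 0 ≤ B)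
    (hN : 0 ≤ N) :
    ∃ C : ℝ, 0 < C ∧ ∀ t : ℝ, t0 ≤ t → t ≤ 2 → ∀ ξ η : EE d, ‖η‖ ≤ B →
      ‖eval (zz ξ η) s‖ * Real.exp (-t * (eval (zz ξ η) (qq P)).re + N * ‖zz ξ η‖) ≤
        C * Real.exp (-‖ξ‖) := by
  obtain ⟨c, C, hc, hC, hF⟩ := F1 hd P hell
  obtain ⟨C1, hC1, hs⟩ := absorb_poly s 1 one_pos
  set m := P.totalDegree
  have hpi := Real.pi_pos
  obtain ⟨C2, hC2⟩ := lin_sub_pow m hm (t0 * c) ((N + 1) * (2 * Real.pi) + 1) (by positivity)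
  refine ⟨C1 * Real.exp (C2 + 2 * C * (1 + B) ^ (2 * m) + (N + 1) * B), by positivity,
    fun t ht ht2 ξ η hη => ?_⟩
  set z := zz ξ η
  have hz : ‖z‖ ≤ 2 * Real.pi * ‖ξ‖ + B := (norm_zz_le ξ η).trans (by linarith)
  calc _ ≤ (C1 * Real.exp (1 * ‖z‖)) * Real.exp (-t * (eval z (qq P)).re + N * ‖z‖) := by
        gcongr; exact hs z
    _ = C1 * Real.exp (-t * (eval z (qq P)).re + (N + 1) * ‖z‖) := by
        rw [mul_assoc, ← Real.exp_add]; ring_nf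
    _ ≤ C1 * Real.exp (C2 + 2 * C * (1 + B) ^ (2 * m) + (N + 1) * B - ‖ξ‖) := by
        refine mul_le_mul_of_nonneg_left (Real.exp_le_exp.2 ?_) (by positivity)
        have h1 := hF ξ η
        have h2 := hC2 ‖ξ‖ (norm_nonneg _)
        have h3 : t * (c * ‖ξ‖ ^ (2 * m) - C * (1 + ‖η‖) ^ (2 * m)) ≤ t * (eval z (qq P)).re := by
          have : 0 ≤ t := by linarith
          gcongr
        have h4 : t * (C * (1 + ‖η‖) ^ (2 * m)) ≤ 2 * (C * (1 + B) ^ (2 * m)) := by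
          gcongr
        have h5 : t0 * (c * ‖ξ‖ ^ (2 * m)) ≤ t * (c * ‖ξ‖ ^ (2 * m)) := by gcongr
        have h6 : (N + 1) * ‖z‖ ≤ (N + 1) * (2 * Real.pi * ‖ξ‖ + B) := by gcongr
        linarith
    _ = _ := by rw [sub_eq_add_neg, Real.exp_add]; ring

lemma B2 {d : ℕ} (hd : 2 ≤ d) (P : MvPolynomial (Fin d) ℂ) (hell : IsElliptic P)
    (hm : 1 ≤ P.totalDegree) (r0 : ℝ) (hr0 : 0 < r0) :
    ∃ κ δ : ℝ, 0 < κ ∧ κ ≤ 1 ∧ 0 < δ ∧ ∀ s : MvPolynomial (Fin d) ℂ, ∃ C : ℝ, 0 < C ∧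
      ∀ t τ : ℝ, 0 < t → t ≤ 1 → 1 ≤ τ → t * τ ^ (2 * P.totalDegree - 1) = 1 →
      ∀ ξ x : EE d, r0 ≤ ‖x‖ → ∀ z, z = zz ξ (-(κ * τ / ‖x‖) • x) →
      ‖eval z s‖ * Real.exp (-t * (eval z (qq P)).re + (dotp z x).re + δ * ‖z‖) ≤
        C * (Real.exp (-δ * ‖ξ‖) * Real.exp (-δ * τ)) := by
  obtain ⟨c, C, hc, hC, hF⟩ := F1 hd P hell
  set m := P.totalDegree
  have hpi := Real.pi_pos
  have hpi4 := Real.pi_lt_d2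
  set κ := min 1 (r0 / (2 * C * 4 ^ m)) with hκ
  have hκ0 : 0 < κ := lt_min one_pos (by positivity)
  have hκ1 : κ ≤ 1 := min_le_left _ _
  have hκ2 : κ * (2 * C * 4 ^ m) ≤ r0 := by
    rw [← le_div_iff₀ (by positivity)]; exact min_le_right _ _
  set δ := min (c / 14) (κ * r0 / 34) with hδ
  have hδ0 : 0 < δ := lt_min (by positivity) (by positivity)
  have hδ1 : 14 * δ ≤ c := by have : δ ≤ c / 14 := min_le_left _ _; linarith
  have hδ2 : 34 * δ ≤ κ * r0 := by have : δ ≤ κ * r0 / 34 := min_le_right _ _; linarith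
  refine ⟨κ, δ, hκ0, hκ1, hδ0, fun s => ?_⟩
  obtain ⟨C1, hC1, hs⟩ := absorb_poly s δ hδ0
  refine ⟨C1 * Real.exp (C * 4 ^ m), by positivity, fun t τ ht ht1 hτ htτ ξ x hx z hz => ?_⟩
  set η := -(κ * τ / ‖x‖) • x with hη
  have hηn : ‖η‖ ≤ κ * τ := norm_eta x _ (by positivity)
  have hzn : ‖z‖ ≤ 2 * Real.pi * ‖ξ‖ + κ * τ := by
    rw [hz]; exact (norm_zz_le ξ η).trans (by linarith)
  have hre : (dotp z x).re = - (κ * τ * ‖x‖) := by rw [hz]; exact dotp_zz_re_self ξ x _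
  have htt : t * τ ^ (2 * m) = τ := by
    have : 2 * m = (2 * m - 1) + 1 := by omega
    rw [this, pow_succ, ← mul_assoc, htτ, one_mul]
  have hX : ‖ξ‖ - τ ≤ t * ‖ξ‖ ^ (2 * m) := by
    rcases le_total ‖ξ‖ τ with h | h
    · have : 0 ≤ t * ‖ξ‖ ^ (2 * m) := by positivity
      linarith
    · have : ‖ξ‖ ≤ t * ‖ξ‖ ^ (2 * m) := by
        have e : 2 * m = (2 * m - 1) + 1 := by omega
        have h2 : t * τ ^ (2 * m - 1) ≤ t * ‖ξ‖ ^ (2 * m - 1) := by gcongr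
        rw [htτ] at h2
        rw [e, pow_succ, ← mul_assoc]
        have := norm_nonneg ξ
        nlinarith
      linarith
  calc _ ≤ (C1 * Real.exp (δ * ‖z‖)) *
        Real.exp (-t * (eval z (qq P)).re + (dotp z x).re + δ * ‖z‖) := by
        gcongr; exact hs z
    _ = C1 * Real.exp (-t * (eval z (qq P)).re + (dotp z x).re + 2 * δ * ‖z‖) := by
        rw [mul_assoc, ← Real.exp_add]; ring_nf
    _ ≤ C1 * Real.exp (C * 4 ^ m + (-δ * ‖ξ‖ + -δ * τ)) := by
        refine mul_le_mul_of_nonneg_left (Real.exp_le_exp.2 ?_) (by positivity)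
        have h1 := hF ξ η
        rw [← hz] at h1
        have h3 : t * (c * ‖ξ‖ ^ (2 * m) - C * (1 + ‖η‖) ^ (2 * m)) ≤ t * (eval z (qq P)).re := by
          gcongr
        have h4 : t * (1 + ‖η‖) ^ (2 * m) ≤ 4 ^ m * (1 + κ ^ 2 * τ) := by
          calc t * (1 + ‖η‖) ^ (2 * m) ≤ t * (1 + κ * τ) ^ (2 * m) := by gcongr
            _ ≤ t * (2 ^ (2 * m - 1) * (1 ^ (2 * m) + (κ * τ) ^ (2 * m))) := by
                gcongr; exact add_pow_le zero_le_one (by positivity) _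
            _ ≤ t * (4 ^ m * (1 ^ (2 * m) + (κ * τ) ^ (2 * m))) := by
                gcongr
                calc (2 : ℝ) ^ (2 * m - 1) ≤ 2 ^ (2 * m) := pow_le_pow_right₀ one_le_two (by omega)
                  _ = 4 ^ m := by rw [pow_mul]; norm_num
            _ = 4 ^ m * (t + κ ^ (2 * m) * (t * τ ^ (2 * m))) := by rw [mul_pow, one_pow]; ring
            _ ≤ _ := by
                rw [htt]
                gcongr ?_ * (?_ + ?_ * ?_)
                exact pow_le_pow_of_le_one hκ0.le hκ1 (by omega)
        have h5 : C * (t * (1 + ‖η‖) ^ (2 * m)) ≤ C * (4 ^ m * (1 + κ ^ 2 * τ)) := by gcongr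
        have h6 : κ * τ * (κ * (2 * C * 4 ^ m)) ≤ κ * τ * r0 := by gcongr
        have h7 : κ * τ * r0 ≤ κ * τ * ‖x‖ := by gcongr
        have h8 : 14 * δ * (t * ‖ξ‖ ^ (2 * m)) ≤ c * (t * ‖ξ‖ ^ (2 * m)) := by gcongr
        have h9 : 14 * δ * (‖ξ‖ - τ) ≤ 14 * δ * (t * ‖ξ‖ ^ (2 * m)) := by gcongr
        have h10 : 2 * δ * ‖z‖ ≤ 2 * δ * (2 * Real.pi * ‖ξ‖ + κ * τ) := by gcongr
        have h11 : 34 * δ * τ ≤ κ * r0 * τ := by gcongr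
        have h12 : 2 * δ * (2 * Real.pi * ‖ξ‖) ≤ 2 * δ * (2 * 3.15 * ‖ξ‖) := by gcongr
        have h13 : 2 * δ * (κ * τ) ≤ 2 * δ * (1 * τ) := by gcongr
        have h14 : 0 ≤ δ * ‖ξ‖ := by positivity
        rw [hre]
        linarith
    _ = _ := by rw [Real.exp_add, Real.exp_add]; ring

lemma B3 {d : ℕ} (hd : 2 ≤ d) (P : MvPolynomial (Fin d) ℂ) (hell : IsElliptic P)
    (hm : 1 ≤ P.totalDegree) (s : MvPolynomial (Fin d) ℂ) (n : ℕ) (hs : s.totalDegree ≤ n) :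
    ∃ C : ℝ, 0 < C ∧
      ∀ t ρ : ℝ, 0 < t → 0 < ρ → ρ ≤ 1 → ρ ^ (2 * P.totalDegree) = t →
      ∀ ξ x : EE d, ∀ z, z = zz ξ (-(ρ⁻¹ / ‖x‖) • x) →
      ‖eval z s‖ * Real.exp (-t * (eval z (qq P)).re + (dotp z x).re) ≤
        C * (ρ⁻¹ ^ n * Real.exp (-(ρ * ‖ξ‖)) * Real.exp (-(ρ⁻¹ * ‖x‖))) := by
  obtain ⟨c, C, hc, hC, hF⟩ := F1 hd P hell
  obtain ⟨C1, hC1, hsb⟩ := eval_bound s n hs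
  set m := P.totalDegree
  have hpi := Real.pi_pos
  obtain ⟨C2, hC2, hab⟩ := absorb n 1 one_pos
  obtain ⟨C3, hC3⟩ := lin_sub_pow m hm c (2 * Real.pi + 1) hc
  refine ⟨C1 * C2 * Real.exp (C3 + C * 4 ^ m + 1), by positivity,
    fun t ρ ht hρ hρ1 hρt ξ x z hz => ?_⟩
  set η := -(ρ⁻¹ / ‖x‖) • x with hη
  have hηn : ‖η‖ ≤ ρ⁻¹ := norm_eta x _ (by positivity)
  have hzn : ‖z‖ ≤ 2 * Real.pi * ‖ξ‖ + ρ⁻¹ := by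
    rw [hz]; exact (norm_zz_le ξ η).trans (by linarith)
  have hre : (dotp z x).re = - (ρ⁻¹ * ‖x‖) := by rw [hz]; exact dotp_zz_re_self ξ x _
  have hs1 : ‖eval z s‖ ≤ C1 * (ρ⁻¹ ^ n * (C2 * Real.exp (2 * Real.pi * (ρ * ‖ξ‖) + 1))) := by
    refine (hsb z).trans ?_
    gcongr
    have h1 : 1 + ‖z‖ ≤ ρ⁻¹ * (1 + (2 * Real.pi * (ρ * ‖ξ‖) + 1)) := by
      have : 1 ≤ ρ⁻¹ := (one_le_inv₀ hρ).2 hρ1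
      have e : ρ⁻¹ * (1 + (2 * Real.pi * (ρ * ‖ξ‖) + 1)) = ρ⁻¹ + 2 * Real.pi * ‖ξ‖ + ρ⁻¹ := by
        field_simp; ring
      rw [e]; linarith
    calc (1 + ‖z‖) ^ n ≤ (ρ⁻¹ * (1 + (2 * Real.pi * (ρ * ‖ξ‖) + 1))) ^ n := by gcongr
      _ = ρ⁻¹ ^ n * (1 + (2 * Real.pi * (ρ * ‖ξ‖) + 1)) ^ n := mul_pow _ _ _
      _ ≤ _ := by
        gcongr
        have := hab (2 * Real.pi * (ρ * ‖ξ‖) + 1) (by positivity)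
        rwa [one_mul] at this
  calc _ ≤ (C1 * (ρ⁻¹ ^ n * (C2 * Real.exp (2 * Real.pi * (ρ * ‖ξ‖) + 1)))) *
        Real.exp (-t * (eval z (qq P)).re + (dotp z x).re) := by
        gcongr
    _ = C1 * C2 * ρ⁻¹ ^ n * Real.exp (2 * Real.pi * (ρ * ‖ξ‖) + 1 +
          (-t * (eval z (qq P)).re + (dotp z x).re)) := by
        rw [Real.exp_add (_ + 1)]; ring
    _ ≤ C1 * C2 * ρ⁻¹ ^ n * Real.exp ((C3 + C * 4 ^ m + 1) + (-(ρ * ‖ξ‖) + -(ρ⁻¹ * ‖x‖))) := by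
        refine mul_le_mul_of_nonneg_left (Real.exp_le_exp.2 ?_) (by positivity)
        have h1 := hF ξ η
        rw [← hz] at h1
        have h3 : t * (c * ‖ξ‖ ^ (2 * m) - C * (1 + ‖η‖) ^ (2 * m)) ≤ t * (eval z (qq P)).re := by
          gcongr
        have h4 : t * (1 + ‖η‖) ^ (2 * m) ≤ 4 ^ m := by
          calc t * (1 + ‖η‖) ^ (2 * m) ≤ t * (1 + ρ⁻¹) ^ (2 * m) := by gcongr
            _ = (ρ + 1) ^ (2 * m) := by
                rw [← hρt, ← mul_pow, mul_add, mul_inv_cancel₀ hρ.ne', mul_one]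
            _ ≤ (1 + 1) ^ (2 * m) := by gcongr
            _ = 4 ^ m := by rw [pow_mul]; norm_num
        have h5 : C * (t * (1 + ‖η‖) ^ (2 * m)) ≤ C * 4 ^ m := by gcongr
        have h6 := hC3 (ρ * ‖ξ‖) (by positivity)
        rw [mul_pow, hρt] at h6
        rw [hre]
        linarith
    _ = _ := by rw [Real.exp_add (C3 + C * 4 ^ m + 1), Real.exp_add (-(ρ * ‖ξ‖))]; ring

end EK

namespace EK
open MvPolynomial MeasureTheory

lemma norm_dotp_le {d : ℕ} (z : Fin d → ℂ) (v : EE d) : ‖dotp z v‖ ≤ ‖z‖ * (d * ‖v‖) := by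
  refine (norm_sum_le _ _).trans ?_
  calc ∑ i : Fin d, ‖z i * ((v i : ℝ) : ℂ)‖ ≤ ∑ i : Fin d, ‖z‖ * ‖v‖ := by
        refine Finset.sum_le_sum fun i _ => ?_
        rw [norm_mul, Complex.norm_real]
        gcongr
        · exact norm_le_pi_norm z i
        · exact PiLp.norm_apply_le v i
    _ = _ := by simp; ring

lemma norm_dotL_le {d : ℕ} (z : Fin d → ℂ) : ‖dotL z‖ ≤ ‖z‖ * d := by
  refine ContinuousLinearMap.opNorm_le_bound _ (by positivity) fun v => ?_
  rw [dotL_apply, mul_assoc]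
  exact norm_dotp_le z v

def ell {d : ℕ} (v : EE d) : MvPolynomial (Fin d) ℂ := ∑ i, C ((v i : ℝ) : ℂ) * X i

lemma eval_ell {d : ℕ} (v : EE d) (z : Fin d → ℂ) : eval z (ell v) = dotp z v := by
  simp [ell, dotp, mul_comm]

lemma continuous_dotp {d : ℕ} (x : EE d) : Continuous fun z : Fin d → ℂ => dotp z x := by
  unfold dotp; fun_prop

section
variable {Ω : Type*} [MeasurableSpace Ω] {d : ℕ}

def II (μ : Measure Ω) (a : Ω → ℂ) (z : Ω → Fin d → ℂ) (s : MvPolynomial (Fin d) ℂ) (x : EE d) : ℂ :=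
  ∫ ω, a ω * eval (z ω) s * Complex.exp (dotp (z ω) x) ∂μ

def GN (a : Ω → ℂ) (z : Ω → Fin d → ℂ) (δ : ℝ) (s : MvPolynomial (Fin d) ℂ) (x : EE d) (ω : Ω) : ℝ :=
  ‖a ω‖ * ‖eval (z ω) s‖ * Real.exp ((dotp (z ω) x).re + δ * ‖z ω‖)

variable {μ : Measure Ω} {a : Ω → ℂ} {z : Ω → Fin d → ℂ}

lemma II_meas (ha : AEStronglyMeasurable a μ) (hz : AEStronglyMeasurable z μ)
    (s : MvPolynomial (Fin d) ℂ) (x : EE d) :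
    AEStronglyMeasurable (fun ω => a ω * eval (z ω) s * Complex.exp (dotp (z ω) x)) μ := by
  refine (ha.mul ?_).mul ?_
  · exact (MvPolynomial.continuous_eval s).comp_aestronglyMeasurable hz
  · exact (Complex.continuous_exp.comp (continuous_dotp x)).comp_aestronglyMeasurable hz

lemma II_term_norm (s : MvPolynomial (Fin d) ℂ) (x : EE d) (ω : Ω) :
    ‖a ω * eval (z ω) s * Complex.exp (dotp (z ω) x)‖ =
      ‖a ω‖ * ‖eval (z ω) s‖ * Real.exp (dotp (z ω) x).re := by
  rw [norm_mul, norm_mul, Complex.norm_exp]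

lemma term_pow_le {δ : ℝ} (hδ : 0 < δ) (s : MvPolynomial (Fin d) ℂ) (x v : EE d) (k : ℕ) (ω : Ω) :
    ‖a ω * eval (z ω) (s * ell v ^ k) * Complex.exp (dotp (z ω) x) / k.factorial‖ ≤
      (d * ‖v‖ / δ) ^ k * GN a z δ s x ω := by
  rw [norm_div, II_term_norm, eval_mul, eval_pow, eval_ell, norm_mul, norm_pow, GN, Real.exp_add]
  have h1 := Real.pow_div_factorial_le_exp (δ * ‖z ω‖) (by positivity) k
  have h2 : ‖dotp (z ω) v‖ ^ k ≤ (d * ‖v‖ / δ) ^ k * (δ * ‖z ω‖) ^ k := by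
    rw [← mul_pow]
    gcongr
    refine (norm_dotp_le _ _).trans (le_of_eq ?_)
    field_simp
  simp only [Complex.norm_natCast]
  calc _ = ‖a ω‖ * ‖eval (z ω) s‖ * Real.exp (dotp (z ω) x).re * (‖dotp (z ω) v‖ ^ k / k.factorial) := by
        ring
    _ ≤ ‖a ω‖ * ‖eval (z ω) s‖ * Real.exp (dotp (z ω) x).re *
        ((d * ‖v‖ / δ) ^ k * (δ * ‖z ω‖) ^ k / k.factorial) := by gcongr
    _ = ‖a ω‖ * ‖eval (z ω) s‖ * Real.exp (dotp (z ω) x).re *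
        ((d * ‖v‖ / δ) ^ k * ((δ * ‖z ω‖) ^ k / k.factorial)) := by ring
    _ ≤ ‖a ω‖ * ‖eval (z ω) s‖ * Real.exp (dotp (z ω) x).re *
        ((d * ‖v‖ / δ) ^ k * Real.exp (δ * ‖z ω‖)) := by gcongr
    _ = _ := by ring

lemma A3 {δ : ℝ} (hδ : 0 < δ) (s : MvPolynomial (Fin d) ℂ) (x v : EE d)
    (hG : Integrable (GN a z δ s x) μ) (k : ℕ) :
    ‖II μ a z (s * ell v ^ k) x / k.factorial‖ ≤ (d * ‖v‖ / δ) ^ k * ∫ ω, GN a z δ s x ω ∂μ := by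
  rw [II, ← integral_div, ← integral_const_mul]
  exact norm_integral_le_of_norm_le (hG.const_mul _)
    (Filter.Eventually.of_forall fun ω => term_pow_le hδ s x v k ω)

lemma A2 (ha : AEStronglyMeasurable a μ) (hz : AEStronglyMeasurable z μ)
    {δ : ℝ} (hδ : 0 < δ) (s : MvPolynomial (Fin d) ℂ) (x v : EE d)
    (hG : Integrable (GN a z δ s x) μ) (hv : d * ‖v‖ < δ) :
    HasSum (fun k : ℕ => II μ a z (s * ell v ^ k) x / k.factorial) (II μ a z s (x + v)) := by
  have hintg : ∀ k : ℕ, Integrable (fun ω =>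
      a ω * eval (z ω) (s * ell v ^ k) * Complex.exp (dotp (z ω) x) / k.factorial) μ := fun k =>
    (hG.const_mul _).mono' (by
      simp only [div_eq_mul_inv]
      exact (II_meas ha hz _ x).mul_const _)
      (Filter.Eventually.of_forall fun ω => term_pow_le hδ s x v k ω)
  have hr : d * ‖v‖ / δ < 1 := (div_lt_one hδ).2 hv
  have hsum : Summable fun k : ℕ => ∫ ω, ‖a ω * eval (z ω) (s * ell v ^ k) *
      Complex.exp (dotp (z ω) x) / k.factorial‖ ∂μ := by
    refine Summable.of_nonneg_of_le (fun k => integral_nonneg fun ω => norm_nonneg _) (fun k => ?_)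
      ((summable_geometric_of_lt_one (by positivity) hr).mul_right (∫ ω, GN a z δ s x ω ∂μ))
    rw [← integral_const_mul]
    exact integral_mono (hintg k).norm (hG.const_mul _) fun ω => term_pow_le hδ s x v k ω
  have := hasSum_integral_of_summable_integral_norm hintg hsum
  have e1 : ∀ k : ℕ, II μ a z (s * ell v ^ k) x / k.factorial = ∫ ω, a ω * eval (z ω) (s * ell v ^ k) *
      Complex.exp (dotp (z ω) x) / k.factorial ∂μ := by
    intro k
    rw [II, ← integral_div]
  have e2 : II μ a z s (x + v) = ∫ ω, ∑' k : ℕ, a ω * eval (z ω) (s * ell v ^ k) *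
      Complex.exp (dotp (z ω) x) / k.factorial ∂μ := by
    unfold II
    congr 1
    funext ω
    have h1 := NormedSpace.exp_series_hasSum_exp' (𝕂 := ℂ) (dotp (z ω) v)
    rw [← Complex.exp_eq_exp_ℂ] at h1
    have h2 := h1.mul_left (a ω * eval (z ω) s * Complex.exp (dotp (z ω) x))
    rw [dotp_add, Complex.exp_add, ← mul_assoc, ← h2.tsum_eq]
    congr 1
    funext k
    rw [eval_mul, eval_pow, eval_ell, smul_eq_mul]
    field_simp
  simp only [e1, e2]
  exact this

lemma A0 (ha : AEStronglyMeasurable a μ) (hz : AEStronglyMeasurable z μ)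
    {δ : ℝ} (hδ : 0 ≤ δ) (s : MvPolynomial (Fin d) ℂ) (x : EE d)
    (hG : Integrable (GN a z δ s x) μ) :
    Integrable (fun ω => a ω * eval (z ω) s * Complex.exp (dotp (z ω) x)) μ := by
  refine hG.mono' (II_meas ha hz s x) (Filter.Eventually.of_forall fun ω => ?_)
  rw [II_term_norm, GN]
  gcongr
  have : 0 ≤ δ * ‖z ω‖ := by positivity
  linarith

lemma A0_norm {δ : ℝ} (hδ : 0 < δ) (s : MvPolynomial (Fin d) ℂ) (x : EE d)
    (hG : Integrable (GN a z δ s x) μ) : ‖II μ a z s x‖ ≤ ∫ ω, GN a z δ s x ω ∂μ := by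
  have := A3 hδ s x 0 hG 0
  simpa using this

lemma A1 (ha : AEStronglyMeasurable a μ) (hz : AEStronglyMeasurable z μ)
    {δ : ℝ} (hδ : 0 < δ) (s : MvPolynomial (Fin d) ℂ) (x : EE d)
    (hG : ∀ s, Integrable (GN a z δ s x) μ) :
    HasFDerivAt (II μ a z s) (∑ i, II μ a z (s * X i) x • cproj i) x := by
  set ε := δ / (2 * (d + 1)) with hε
  have hε0 : 0 < ε := by positivity
  have key := hasFDerivAt_integral_of_dominated_of_fderiv_le (𝕜 := ℝ) (μ := μ)
    (F := fun y ω => a ω * eval (z ω) s * Complex.exp (dotp (z ω) y))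
    (F' := fun y ω => (a ω * eval (z ω) s) • (Complex.exp (dotp (z ω) y) • dotL (z ω)))
    (x₀ := x) (bound := fun ω => (2 * d / δ) * GN a z δ s x ω)
    (Metric.ball_mem_nhds x hε0)
    (Filter.Eventually.of_forall fun y => II_meas ha hz s y)
    (A0 ha hz hδ.le s x (hG s)) ?_ ?_ ((hG s).const_mul _) ?_
  · refine key.congr_fderiv ?_
    have e : ∀ ω, (a ω * eval (z ω) s) • (Complex.exp (dotp (z ω) x) • dotL (z ω)) =
        ∑ i, (a ω * eval (z ω) (s * X i) * Complex.exp (dotp (z ω) x)) • cproj i := by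
      intro ω
      simp only [dotL, Finset.smul_sum, smul_smul, eval_mul, eval_X]
      refine Finset.sum_congr rfl fun i _ => ?_
      congr 1; ring
    simp_rw [e]
    rw [integral_finsetSum]
    · refine Finset.sum_congr rfl fun i _ => ?_
      rw [integral_smul_const]; rfl
    · intro i _
      exact (A0 ha hz hδ.le _ x (hG (s * X i))).smul_const _
  · have h1 : AEStronglyMeasurable (fun ω => a ω * eval (z ω) s) μ :=
      ha.mul ((MvPolynomial.continuous_eval s).comp_aestronglyMeasurable hz)
    have h2 : AEStronglyMeasurable (fun ω => Complex.exp (dotp (z ω) x)) μ :=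
      (Complex.continuous_exp.comp (continuous_dotp x)).comp_aestronglyMeasurable hz
    have h3 : AEStronglyMeasurable (fun ω => dotL (z ω)) μ := by
      have : Continuous fun z : Fin d → ℂ => dotL z := by unfold dotL; fun_prop
      exact this.comp_aestronglyMeasurable hz
    exact h1.smul (h2.smul h3)
  · refine Filter.Eventually.of_forall fun ω y hy => ?_
    rw [norm_smul, norm_smul, norm_mul, Complex.norm_exp, GN]
    have hy2 : ‖y - x‖ ≤ ε := by rw [← dist_eq_norm]; exact (Metric.mem_ball.1 hy).le
    have h1 : (dotp (z ω) y).re ≤ (dotp (z ω) x).re + δ / 2 * ‖z ω‖ := by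
      have e : dotp (z ω) y = dotp (z ω) x + dotp (z ω) (y - x) := by rw [← dotp_add]; simp
      rw [e, Complex.add_re]
      have h2 := (Complex.re_le_norm (dotp (z ω) (y - x))).trans (norm_dotp_le _ _)
      have h3 : (d : ℝ) * ‖y - x‖ ≤ δ / 2 := by
        calc (d : ℝ) * ‖y - x‖ ≤ (d + 1) * ε := by gcongr; linarith
          _ = δ / 2 := by rw [hε]; field_simp
      have h4 : ‖z ω‖ * (d * ‖y - x‖) ≤ ‖z ω‖ * (δ / 2) := by gcongr
      linarith
    have h5 : ‖dotL (z ω)‖ ≤ (2 * d / δ) * Real.exp (δ / 2 * ‖z ω‖) := by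
      refine (norm_dotL_le _).trans ?_
      have h6 := Real.add_one_le_exp (δ / 2 * ‖z ω‖)
      calc ‖z ω‖ * d = (2 * d / δ) * (δ / 2 * ‖z ω‖) := by field_simp
        _ ≤ _ := by gcongr; linarith
    calc _ ≤ ‖a ω‖ * ‖eval (z ω) s‖ * (Real.exp ((dotp (z ω) x).re + δ / 2 * ‖z ω‖) *
          ((2 * d / δ) * Real.exp (δ / 2 * ‖z ω‖))) := by gcongr
      _ = (2 * d / δ) * (‖a ω‖ * ‖eval (z ω) s‖ * (Real.exp ((dotp (z ω) x).re + δ / 2 * ‖z ω‖) *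
          Real.exp (δ / 2 * ‖z ω‖))) := by ring
      _ = _ := by rw [← Real.exp_add]; ring_nf
  · refine Filter.Eventually.of_forall fun ω y hy => ?_
    exact (hasFDerivAt_cexp_dotp (z ω) y).const_mul _

end

end EK

namespace EK
open MvPolynomial MeasureTheory

lemma integrable_exp_norm {d : ℕ} (a : ℝ) (ha : 0 < a) :
    Integrable (fun ξ : EE d => Real.exp (-(a * ‖ξ‖))) := by
  obtain ⟨C, hC, h⟩ := absorb (d + 1) a ha
  have h1 : Integrable (fun ξ : EE d => (1 + ‖ξ‖) ^ (-((d + 1 : ℕ) : ℝ))) :=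
    integrable_one_add_norm (by simp)
  refine (h1.const_mul C).mono' (Continuous.aestronglyMeasurable (by fun_prop))
    (Filter.Eventually.of_forall fun ξ => ?_)
  rw [Real.norm_of_nonneg (Real.exp_pos _).le, Real.exp_neg, Real.rpow_neg (by positivity),
    Real.rpow_natCast, ← div_eq_mul_inv, inv_eq_one_div, div_le_div_iff₀ (Real.exp_pos _) (by positivity),
    one_mul]
  exact h ‖ξ‖ (norm_nonneg _)

def AA {d : ℕ} (P : MvPolynomial (Fin d) ℂ) (t : ℝ) (s : MvPolynomial (Fin d) ℂ) (z : Fin d → ℂ)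
    (x : EE d) : ℂ := eval z s * Complex.exp (-(t : ℂ) * eval z (qq P) + dotp z x)

def hk {d : ℕ} (P : MvPolynomial (Fin d) ℂ) (t : ℝ) (s : MvPolynomial (Fin d) ℂ) (x : EE d) : ℂ :=
  ∫ ξ, AA P t s (zz ξ 0) x

lemma norm_AA {d : ℕ} (P : MvPolynomial (Fin d) ℂ) (t : ℝ) (s : MvPolynomial (Fin d) ℂ)
    (z : Fin d → ℂ) (x : EE d) : ‖AA P t s z x‖ =
      ‖eval z s‖ * Real.exp (-t * (eval z (qq P)).re + (dotp z x).re) := by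
  rw [AA, norm_mul, Complex.norm_exp]
  simp

lemma continuous_zz {d : ℕ} : Continuous fun p : EE d × EE d => zz p.1 p.2 := by
  refine continuous_pi fun i => ?_
  simp only [zz, re2, Pi.add_apply, Pi.smul_apply]
  fun_prop

lemma cont_zz {d : ℕ} {Ω : Type*} [TopologicalSpace Ω] {f g : Ω → EE d} (hf : Continuous f)
    (hg : Continuous g) : Continuous fun ω => zz (f ω) (g ω) :=
  continuous_zz.comp (hf.prodMk hg)

lemma cont_AA {d : ℕ} (P s : MvPolynomial (Fin d) ℂ) {Ω : Type*} [TopologicalSpace Ω] {f : Ω → ℝ}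
    {g : Ω → Fin d → ℂ} {h : Ω → EE d} (hf : Continuous f) (hg : Continuous g) (hh : Continuous h) :
    Continuous fun ω => AA P (f ω) s (g ω) (h ω) := by
  have h1 : Continuous fun ω => eval (g ω) s := (MvPolynomial.continuous_eval s).comp hg
  have h2 : Continuous fun ω => eval (g ω) (qq P) := (MvPolynomial.continuous_eval (qq P)).comp hg
  have h3 : Continuous fun ω => dotp (g ω) (h ω) := by
    unfold dotp; fun_prop
  have h4 : Continuous fun ω => -((f ω : ℝ) : ℂ) := by fun_prop
  exact h1.mul ((h4.mul h2).add h3).cexp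

lemma AA_bound {d : ℕ} (hd : 2 ≤ d) (P : MvPolynomial (Fin d) ℂ) (hell : IsElliptic P)
    (hm : 1 ≤ P.totalDegree) (s : MvPolynomial (Fin d) ℂ) (t0 B R : ℝ) (ht0 : 0 < t0) (hB : 0 ≤ B)
    (hR : 0 ≤ R) :
    ∃ C : ℝ, 0 < C ∧ ∀ t : ℝ, t0 ≤ t → t ≤ 2 → ∀ ξ η x : EE d, ‖η‖ ≤ B → ‖x‖ ≤ R →
      ‖AA P t s (zz ξ η) x‖ ≤ C * Real.exp (-‖ξ‖) := by
  obtain ⟨C, hC, h⟩ := B1 hd P hell hm s t0 B (d * R) ht0 hB (by positivity)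
  refine ⟨C, hC, fun t h0 h2 ξ η x hη hx => le_trans ?_ (h t h0 h2 ξ η hη)⟩
  rw [norm_AA]
  gcongr
  refine (Complex.re_le_norm _).trans ((norm_dotp_le _ _).trans ?_)
  rw [mul_comm]
  gcongr

lemma integrable_exp_neg_norm {d : ℕ} : Integrable (fun ξ : EE d => Real.exp (-‖ξ‖)) := by
  simpa using integrable_exp_norm (d := d) 1 one_pos

lemma AA_integrable {d : ℕ} (hd : 2 ≤ d) (P : MvPolynomial (Fin d) ℂ) (hell : IsElliptic P)
    (hm : 1 ≤ P.totalDegree) (s : MvPolynomial (Fin d) ℂ) (t : ℝ) (ht : 0 < t) (ht2 : t ≤ 2)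
    (η x : EE d) : Integrable fun ξ => AA P t s (zz ξ η) x := by
  obtain ⟨C, hC, h⟩ := AA_bound hd P hell hm s t ‖η‖ ‖x‖ ht (norm_nonneg _) (norm_nonneg _)
  refine (integrable_exp_neg_norm.const_mul C).mono' ?_
    (Filter.Eventually.of_forall fun ξ => h t le_rfl ht2 ξ η x le_rfl le_rfl)
  refine Continuous.aestronglyMeasurable ?_
  exact cont_AA P s continuous_const (cont_zz continuous_id continuous_const) continuous_const

/-- directional derivative of polynomials -/
def Db {d : ℕ} (b : Fin d → ℂ) (s : MvPolynomial (Fin d) ℂ) : MvPolynomial (Fin d) ℂ :=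
  ∑ i, C (b i) * pderiv i s

lemma Db_hasDerivAt {d : ℕ} (b z0 : Fin d → ℂ) (s : MvPolynomial (Fin d) ℂ) (w : ℂ) :
    HasDerivAt (fun w : ℂ => eval (z0 + w • b) s) (eval (z0 + w • b) (Db b s)) w := by
  induction s using MvPolynomial.induction_on with
  | C a => simpa [Db] using hasDerivAt_const w a
  | add p q hp hq =>
    have e : Db b (p + q) = Db b p + Db b q := by
      simp [Db, mul_add, Finset.sum_add_distrib]
    rw [e]
    simp only [eval_add]
    exact hp.add hq
  | mul_X p i hp =>
    have e : Db b (p * X i) = Db b p * X i + p * C (b i) := by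
      simp only [Db, Derivation.leibniz, smul_eq_mul, mul_add, Finset.sum_add_distrib, Finset.sum_mul]
      rw [add_comm]
      congr 1
      · refine Finset.sum_congr rfl fun j _ => by ring
      · rw [Finset.sum_eq_single i]
        · simp; ring
        · intro j _ hj
          simp [pderiv_X, Pi.single_apply, hj.symm]
        · simp
    rw [e]
    have h2 : HasDerivAt (fun w : ℂ => eval (z0 + w • b) (X i : MvPolynomial (Fin d) ℂ)) (b i) w := by
      simp only [eval_X, Pi.add_apply, Pi.smul_apply, smul_eq_mul]
      simpa using ((hasDerivAt_id w).mul_const (b i)).const_add (z0 i)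
    have h3 := hp.mul h2
    simp only [eval_add, eval_mul, eval_C]
    exact h3

lemma dotp_line {d : ℕ} (z0 b : Fin d → ℂ) (w : ℂ) (x : EE d) :
    dotp (z0 + w • b) x = dotp z0 x + w * dotp b x := by
  simp [dotp, Finset.mul_sum, add_mul, Finset.sum_add_distrib, mul_assoc]

def sAA {d : ℕ} (P : MvPolynomial (Fin d) ℂ) (t : ℝ) (b : Fin d → ℂ) (x : EE d)
    (s : MvPolynomial (Fin d) ℂ) : MvPolynomial (Fin d) ℂ :=
  Db b s + s * (- (C (t : ℂ) * Db b (qq P)) + C (dotp b x))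

lemma AA_hasDerivAt {d : ℕ} (P s : MvPolynomial (Fin d) ℂ) (t : ℝ) (z0 b : Fin d → ℂ) (x : EE d)
    (w : ℂ) :
    HasDerivAt (fun w : ℂ => AA P t s (z0 + w • b) x) (AA P t (sAA P t b x s) (z0 + w • b) x) w := by
  unfold AA
  have h1 := Db_hasDerivAt b z0 s w
  have h2 := (Db_hasDerivAt b z0 (qq P) w).const_mul (-(t : ℂ))
  have h3 : HasDerivAt (fun w : ℂ => dotp (z0 + w • b) x) (dotp b x) w := by
    simp only [dotp_line]
    simpa using ((hasDerivAt_id w).mul_const (dotp b x)).const_add (dotp z0 x)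
  have h4 := h1.mul (h2.add h3).cexp
  refine h4.congr_deriv ?_
  simp only [sAA, eval_add, eval_mul, eval_neg, eval_C]
  simp only [Pi.add_apply]
  ring

lemma zz_line {d : ℕ} (ξ η : EE d) (w : ℂ) :
    (2 * Real.pi * Complex.I : ℂ) • re2 ξ + w • re2 η =
      zz (ξ + (w.im / (2 * Real.pi)) • η) (w.re • η) := by
  funext i
  simp only [zz, re2, Pi.add_apply, Pi.smul_apply, smul_eq_mul, PiLp.add_apply, PiLp.smul_apply]
  conv_lhs => rw [← Complex.re_add_im w]
  push_cast
  have : (Real.pi : ℂ) ≠ 0 := by exact_mod_cast Real.pi_ne_zero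
  field_simp
  ring

lemma hk_shift {d : ℕ} (hd : 2 ≤ d) (P : MvPolynomial (Fin d) ℂ) (hell : IsElliptic P)
    (hm : 1 ≤ P.totalDegree) (s : MvPolynomial (Fin d) ℂ) (t : ℝ) (ht : 0 < t) (ht2 : t ≤ 2)
    (η x : EE d) : ∫ ξ, AA P t s (zz ξ η) x = hk P t s x := by
  set b := re2 η with hb
  set F : MvPolynomial (Fin d) ℂ → ℂ → EE d → ℂ :=
    fun s w ξ => AA P t s ((2 * Real.pi * Complex.I : ℂ) • re2 ξ + w • b) x with hF
  have hFb : ∀ s (w0 : ℂ), ∃ C : ℝ, ∀ w ∈ Metric.ball w0 1, ∀ ξ, ‖F s w ξ‖ ≤ C * Real.exp (-‖ξ‖) := by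
    intro s w0
    obtain ⟨C, hC, h⟩ := AA_bound hd P hell hm s t ((‖w0‖ + 1) * ‖η‖) ‖x‖ ht (by positivity)
      (norm_nonneg _)
    refine ⟨C * Real.exp ((‖w0‖ + 1) * ‖η‖), fun w hw ξ => ?_⟩
    have hw1 : ‖w‖ ≤ ‖w0‖ + 1 := by
      have h1 : ‖w - w0‖ < 1 := by rw [← dist_eq_norm]; exact Metric.mem_ball.1 hw
      have h2 := norm_add_le (w - w0) w0
      rw [sub_add_cancel] at h2
      linarith
    have hre := (Complex.abs_re_le_norm w).trans hw1
    have him := (Complex.abs_im_le_norm w).trans hw1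
    simp only [hF, hb, zz_line]
    refine (h t le_rfl ht2 _ _ x ?_ le_rfl).trans ?_
    · rw [norm_smul, Real.norm_eq_abs]; gcongr
    · rw [mul_assoc, ← Real.exp_add]
      gcongr
      have h3 : ‖(w.im / (2 * Real.pi)) • η‖ ≤ (‖w0‖ + 1) * ‖η‖ := by
        rw [norm_smul, norm_div, Real.norm_eq_abs]
        gcongr
        have : 1 ≤ ‖2 * Real.pi‖ := by
          rw [Real.norm_of_nonneg (by positivity)]; linarith [Real.pi_gt_three]
        exact (div_le_self (abs_nonneg _) this).trans him
      have h4 := norm_sub_le (ξ + (w.im / (2 * Real.pi)) • η) ((w.im / (2 * Real.pi)) • η)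
      rw [add_sub_cancel_right] at h4
      linarith
  have hcont : ∀ s w, Continuous (F s w) := by
    intro s w
    refine cont_AA P s continuous_const (Continuous.add ?_ continuous_const) continuous_const
    refine continuous_pi fun i => ?_
    simp only [re2, Pi.smul_apply]
    fun_prop
  have hintg : ∀ s w, Integrable (F s w) := by
    intro s w
    obtain ⟨C, h⟩ := hFb s w
    exact (integrable_exp_neg_norm.const_mul C).mono' (hcont s w).aestronglyMeasurable
      (Filter.Eventually.of_forall fun ξ => h w (Metric.mem_ball_self one_pos) ξ)
  set K : ℂ → ℂ := fun w => ∫ ξ, F s w ξ with hK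
  have hder : ∀ w, HasDerivAt K (∫ ξ, F (sAA P t b x s) w ξ) w := by
    intro w
    obtain ⟨C, h⟩ := hFb (sAA P t b x s) w
    refine (hasDerivAt_integral_of_dominated_loc_of_deriv_le (𝕜 := ℂ) (μ := volume) (F := F s)
      (F' := F (sAA P t b x s)) (x₀ := w) (bound := fun ξ => C * Real.exp (-‖ξ‖))
      (Metric.ball_mem_nhds w one_pos)
      (Filter.Eventually.of_forall fun w => (hcont s w).aestronglyMeasurable) (hintg s w)
      (hcont _ w).aestronglyMeasurable
      (Filter.Eventually.of_forall fun ξ w' hw' => h w' hw' ξ) (integrable_exp_neg_norm.const_mul C)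
      (Filter.Eventually.of_forall fun ξ w' _ => ?_)).2
    exact AA_hasDerivAt P s t _ b x w'
  have hinv : ∀ (w : ℂ) (c : ℝ), K (w + (c : ℂ) * Complex.I) = K w := by
    intro w c
    simp only [hK, hF, hb, zz_line]
    have e : ∀ ξ : EE d, ξ + ((w + (c : ℂ) * Complex.I).im / (2 * Real.pi)) • η =
        (ξ + (c / (2 * Real.pi)) • η) + (w.im / (2 * Real.pi)) • η := by
      intro ξ
      have : (w + (c : ℂ) * Complex.I).im = c + w.im := by simp [add_comm]
      rw [this, add_div, add_smul, add_assoc]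
    have e2 : (w + (c : ℂ) * Complex.I).re = w.re := by simp
    simp_rw [e, e2]
    exact integral_add_right_eq_self
      (fun ξ => AA P t s (zz (ξ + (w.im / (2 * Real.pi)) • η) (w.re • η)) x) ((c / (2 * Real.pi)) • η)
  have hzero : ∀ w, ∫ ξ, F (sAA P t b x s) w ξ = 0 := by
    intro w
    have h1 : HasDerivAt (fun c : ℝ => w + (c : ℂ) * Complex.I) Complex.I 0 := by
      have := ((Complex.ofRealCLM.hasDerivAt (x := (0 : ℝ))).mul_const Complex.I).const_add w
      simpa using this
    have h2 : HasDerivAt K (∫ ξ, F (sAA P t b x s) w ξ) (w + ((0 : ℝ) : ℂ) * Complex.I) := by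
      simpa using hder w
    have h3 := h2.scomp (0 : ℝ) h1
    have h4 : (K ∘ fun c : ℝ => w + (c : ℂ) * Complex.I) = fun _ => K w := by
      funext c; exact hinv w c
    rw [h4] at h3
    have h5 := h3.unique (hasDerivAt_const (0 : ℝ) (K w))
    simpa using h5
  have hconst : K 1 = K 0 := by
    refine is_const_of_deriv_eq_zero (fun w => (hder w).differentiableAt) (fun w => ?_) 1 0
    rw [(hder w).deriv, hzero]
  simp only [hK, hF] at hconst
  have e1 : ∀ ξ : EE d, (2 * Real.pi * Complex.I : ℂ) • re2 ξ + (1 : ℂ) • b = zz ξ η := by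
    intro ξ; rw [one_smul]; rfl
  have e0 : ∀ ξ : EE d, (2 * Real.pi * Complex.I : ℂ) • re2 ξ + (0 : ℂ) • b = zz ξ 0 := by
    intro ξ; funext i; simp [zz, re2]
  simp_rw [e1, e0] at hconst
  exact hconst

lemma hk_hasDerivAt {d : ℕ} (hd : 2 ≤ d) (P : MvPolynomial (Fin d) ℂ) (hell : IsElliptic P)
    (hm : 1 ≤ P.totalDegree) (s : MvPolynomial (Fin d) ℂ) (t : ℝ) (ht : 0 < t) (ht2 : t < 2)
    (x : EE d) : HasDerivAt (fun t => hk P t s x) (- hk P t (s * qq P) x) t := by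
  obtain ⟨C, hC, h⟩ := AA_bound hd P hell hm (s * qq P) (t / 2) 0 ‖x‖ (by positivity) le_rfl
    (norm_nonneg _)
  have hcont : ∀ s t, Continuous fun ξ => AA P t s (zz ξ 0) x := by
    intro s t
    exact cont_AA P s continuous_const (cont_zz continuous_id continuous_const) continuous_const
  have := (hasDerivAt_integral_of_dominated_loc_of_deriv_le (𝕜 := ℝ) (μ := volume)
      (F := fun t ξ => AA P t s (zz ξ 0) x)
      (F' := fun t ξ => - AA P t (s * qq P) (zz ξ 0) x) (x₀ := t)
      (bound := fun ξ => C * Real.exp (-‖ξ‖))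
      (s := Set.Ioo (t / 2) 2) (Ioo_mem_nhds (by linarith) ht2)
      (Filter.Eventually.of_forall fun t => (hcont s t).aestronglyMeasurable)
      (AA_integrable hd P hell hm s t ht ht2.le 0 x)
      (hcont _ t).neg.aestronglyMeasurable
      (Filter.Eventually.of_forall fun ξ t' ht' => ?_) (integrable_exp_neg_norm.const_mul C)
      (Filter.Eventually.of_forall fun ξ t' _ => ?_)).2
  · rw [integral_neg] at this
    exact this
  · rw [norm_neg]
    exact h t' ht'.1.le ht'.2.le ξ 0 x (by simp) le_rfl
  · unfold AA
    have h1 : HasDerivAt (fun t : ℝ => (t : ℂ)) 1 t' := Complex.ofRealCLM.hasDerivAt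
    have h2 := ((h1.neg.mul_const (eval (zz ξ 0) (qq P))).add_const (dotp (zz ξ 0) x)).cexp.const_mul
      (eval (zz ξ 0) s)
    refine h2.congr_deriv ?_
    simp only [eval_mul]
    simp only [Pi.neg_apply]
    ring

end EK

namespace EK
open MvPolynomial MeasureTheory

section
variable {Ω : Type*} [MeasurableSpace Ω] {d : ℕ}

lemma A0v {μ : Measure Ω} {a : Ω → ℂ} {z : Ω → Fin d → ℂ}
    (ha : AEStronglyMeasurable a μ) (hz : AEStronglyMeasurable z μ)
    {δ : ℝ} (s : MvPolynomial (Fin d) ℂ) (x v : EE d)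
    (hG : Integrable (GN a z δ s x) μ) (hv : d * ‖v‖ ≤ δ) :
    Integrable (fun ω => a ω * eval (z ω) s * Complex.exp (dotp (z ω) (x + v))) μ := by
  refine hG.mono' (II_meas ha hz s (x + v)) (Filter.Eventually.of_forall fun ω => ?_)
  rw [II_term_norm, GN, dotp_add, Complex.add_re]
  gcongr
  refine (Complex.re_le_norm _).trans ((norm_dotp_le _ _).trans ?_)
  rw [mul_comm]
  gcongr

def RepOn (μ : Measure Ω) (S : Set (EE d)) (J : MvPolynomial (Fin d) ℂ → EE d → ℂ) (δ : ℝ)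
    (Cs : MvPolynomial (Fin d) ℂ → ℝ) : Prop :=
  ∀ x0 ∈ S, ∃ (a : Ω → ℂ) (z : Ω → Fin d → ℂ), AEStronglyMeasurable a μ ∧ AEStronglyMeasurable z μ ∧
    (∀ s, Integrable (GN a z δ s x0) μ ∧ ∫ ω, GN a z δ s x0 ω ∂μ ≤ Cs s) ∧
    ∀ s v, d * ‖v‖ < δ → J s (x0 + v) = II μ a z s (x0 + v)

def AnEst (S : Set (EE d)) (J : MvPolynomial (Fin d) ℂ → EE d → ℂ) (δ : ℝ)
    (Cs : MvPolynomial (Fin d) ℂ → ℝ) : Prop :=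
  ∀ s, ∀ x0 ∈ S, (∀ v, d * ‖v‖ < δ →
      HasSum (fun k : ℕ => J (s * ell v ^ k) x0 / k.factorial) (J s (x0 + v))) ∧
    ∀ v, ∀ k : ℕ, ‖J (s * ell v ^ k) x0 / k.factorial‖ ≤ (d * ‖v‖ / δ) ^ k * Cs s

lemma RepOn.at0 {μ : Measure Ω} {S : Set (EE d)} {J : MvPolynomial (Fin d) ℂ → EE d → ℂ} {δ : ℝ}
    (hδ : 0 < δ) {a : Ω → ℂ} {z : Ω → Fin d → ℂ} {x0 : EE d}
    (hJ : ∀ s v, d * ‖v‖ < δ → J s (x0 + v) = II μ a z s (x0 + v)) (s) :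
    J s x0 = II μ a z s x0 := by
  have := hJ s 0 (by simpa using hδ)
  simpa using this

lemma RepOn.anEst {μ : Measure Ω} {S : Set (EE d)} {J : MvPolynomial (Fin d) ℂ → EE d → ℂ} {δ : ℝ}
    (hδ : 0 < δ) {Cs} (h : RepOn μ S J δ Cs) : AnEst S J δ Cs := by
  intro s x0 hx0
  obtain ⟨a, z, ha, hz, hG, hJ⟩ := h x0 hx0
  have h0 := RepOn.at0 (S := S) hδ hJ
  refine ⟨fun v hv => ?_, fun v k => ?_⟩
  · simp only [h0, hJ s v hv]
    exact A2 ha hz hδ s x0 v (hG s).1 hv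
  · rw [h0]
    refine (A3 hδ s x0 v (hG s).1 k).trans ?_
    gcongr
    exact (hG s).2

lemma RepOn.deriv {μ : Measure Ω} {S : Set (EE d)} {J : MvPolynomial (Fin d) ℂ → EE d → ℂ} {δ : ℝ}
    (hδ : 0 < δ) {Cs} (h : RepOn μ S J δ Cs) (s) (x) (hx : x ∈ S) :
    HasFDerivAt (J s) (∑ i, J (s * X i) x • cproj i) x := by
  obtain ⟨a, z, ha, hz, hG, hJ⟩ := h x hx
  have h0 := RepOn.at0 (S := S) hδ hJ
  simp only [h0]
  refine (A1 ha hz hδ s x fun s => (hG s).1).congr_of_eventuallyEq ?_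
  have hr : 0 < δ / (d + 1) := by positivity
  filter_upwards [Metric.ball_mem_nhds x hr] with y hy
  have := hJ s (y - x) ?_
  · simpa using this
  · have hy2 : ‖y - x‖ < δ / (d + 1) := by rw [← dist_eq_norm]; exact hy
    rw [lt_div_iff₀ (by positivity)] at hy2
    have := norm_nonneg (y - x)
    linarith

lemma RepOn.add {μ : Measure Ω} {S : Set (EE d)} {J : MvPolynomial (Fin d) ℂ → EE d → ℂ} {δ : ℝ}
    (hδ : 0 < δ) {Cs} (h : RepOn μ S J δ Cs) (s s') (x) (hx : x ∈ S) :
    J (s + s') x = J s x + J s' x := by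
  obtain ⟨a, z, ha, hz, hG, hJ⟩ := h x hx
  have h0 := RepOn.at0 (S := S) hδ hJ
  simp only [h0, II]
  rw [← integral_add (A0 ha hz hδ.le s x (hG s).1) (A0 ha hz hδ.le s' x (hG s').1)]
  congr 1
  funext ω
  simp only [eval_add]; ring

lemma RepOn.smul {μ : Measure Ω} {S : Set (EE d)} {J : MvPolynomial (Fin d) ℂ → EE d → ℂ} {δ : ℝ}
    (hδ : 0 < δ) {Cs} (h : RepOn μ S J δ Cs) (c s) (x) (hx : x ∈ S) :
    J (C c * s) x = c * J s x := by
  obtain ⟨a, z, ha, hz, hG, hJ⟩ := h x hx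
  have h0 := RepOn.at0 (S := S) hδ hJ
  simp only [h0, II]
  rw [← integral_const_mul]
  congr 1
  funext ω
  simp only [eval_mul, eval_C]; ring

end

lemma AnEst.bound {d : ℕ} {S : Set (EE d)} {J : MvPolynomial (Fin d) ℂ → EE d → ℂ} {δ : ℝ}
    {Cs} (h : AnEst S J δ Cs) (s) (x) (hx : x ∈ S) : ‖J s x‖ ≤ Cs s := by
  simpa using (h s x hx).2 0 0

lemma AnEst.nonneg {d : ℕ} {S : Set (EE d)} {J : MvPolynomial (Fin d) ℂ → EE d → ℂ} {δ : ℝ}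
    {Cs} (h : AnEst S J δ Cs) (s) (x) (hx : x ∈ S) : 0 ≤ Cs s :=
  (norm_nonneg _).trans (h.bound s x hx)

lemma AnEst.add {d : ℕ} {S : Set (EE d)} {J J' : MvPolynomial (Fin d) ℂ → EE d → ℂ} {δ δ' : ℝ}
    (hδ : 0 < δ) (hδ' : 0 < δ')
    {Cs Cs'} (h : AnEst S J δ Cs) (h' : AnEst S J' δ' Cs') (c : ℂ) :
    AnEst S (fun s x => J s x + c * J' s x) (min δ δ') (fun s => Cs s + ‖c‖ * Cs' s) := by
  intro s x0 hx0
  have hm : 0 < min δ δ' := lt_min hδ hδ'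
  refine ⟨fun v hv => ?_, fun v k => ?_⟩
  · have h1 := (h s x0 hx0).1 v (hv.trans_le (min_le_left _ _))
    have h2 := (h' s x0 hx0).1 v (hv.trans_le (min_le_right _ _))
    have := h1.add (h2.mul_left c)
    refine this.congr_fun ?_
    intro k
    ring
  · have h1 := (h s x0 hx0).2 v k
    have h2 := (h' s x0 hx0).2 v k
    have n1 := h.nonneg s x0 hx0
    have n2 := h'.nonneg s x0 hx0
    have e : (J (s * ell v ^ k) x0 + c * J' (s * ell v ^ k) x0) / k.factorial =
      J (s * ell v ^ k) x0 / k.factorial + c * (J' (s * ell v ^ k) x0 / k.factorial) := by ring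
    rw [e]
    refine (norm_add_le _ _).trans ?_
    rw [norm_mul, mul_add]
    refine add_le_add (h1.trans ?_) ?_
    · gcongr
      exact min_le_left _ _
    · rw [mul_left_comm]
      gcongr
      refine h2.trans ?_
      gcongr
      exact min_le_right _ _

def tau (m : ℕ) (t : ℝ) : ℝ := t ^ (-(1 / ((2 * m - 1 : ℕ) : ℝ)))

lemma tau_one_le {m : ℕ} {t : ℝ} (ht : 0 < t) (ht1 : t ≤ 1) : 1 ≤ tau m t := by
  refine Real.one_le_rpow_of_pos_of_le_one_of_nonpos ht ht1 ?_
  simp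

lemma tau_mul {m : ℕ} (hm : 1 ≤ m) {t : ℝ} (ht : 0 < t) : t * tau m t ^ (2 * m - 1) = 1 := by
  have h : ((2 * m - 1 : ℕ) : ℝ) ≠ 0 := by
    have : 2 * m - 1 ≠ 0 := by omega
    exact_mod_cast this
  rw [tau, ← Real.rpow_natCast, ← Real.rpow_mul ht.le]
  have : -(1 / ((2 * m - 1 : ℕ) : ℝ)) * ((2 * m - 1 : ℕ) : ℝ) = -1 := by field_simp
  rw [this, Real.rpow_neg_one, mul_inv_cancel₀ ht.ne']

lemma measurable_tau (m : ℕ) : Measurable (tau m) := by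
  unfold tau; fun_prop

def mu1 (d : ℕ) (b : ℝ) : Measure (ℝ × EE d) := (volume.restrict (Set.Ioc 0 b)).prod volume

instance (d : ℕ) (b : ℝ) : SFinite (mu1 d b) := by unfold mu1; infer_instance

def zU {d : ℕ} (m : ℕ) (κ : ℝ) (x0 : EE d) (p : ℝ × EE d) : Fin d → ℂ :=
  zz p.2 (-(κ * tau m p.1 / ‖x0‖) • x0)

def aU {d : ℕ} (P : MvPolynomial (Fin d) ℂ) (κ : ℝ) (x0 : EE d) (p : ℝ × EE d) : ℂ :=
  eval (zU P.totalDegree κ x0 p) (PB P) *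
    Complex.exp (-(p.1 : ℂ) * eval (zU P.totalDegree κ x0 p) (qq P))

def uu {d : ℕ} (P : MvPolynomial (Fin d) ℂ) (s : MvPolynomial (Fin d) ℂ) (x : EE d) : ℂ :=
  ∫ t in Set.Ioc (0 : ℝ) 1, hk P t (PB P * s) x

lemma meas_zU {d : ℕ} (m : ℕ) (κ : ℝ) (x0 : EE d) : Measurable (zU m κ x0) := by
  have h1 : Measurable fun p : ℝ × EE d => (p.2, (-(κ * tau m p.1 / ‖x0‖) • x0)) := by
    have := measurable_tau m
    fun_prop
  exact continuous_zz.measurable.comp h1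

lemma meas_aU {d : ℕ} (P : MvPolynomial (Fin d) ℂ) (κ : ℝ) (x0 : EE d) : Measurable (aU P κ x0) := by
  have h := meas_zU P.totalDegree κ x0
  have h1 : Measurable fun p => eval (zU P.totalDegree κ x0 p) (PB P) :=
    (MvPolynomial.continuous_eval (PB P)).measurable.comp h
  have h2 : Measurable fun p => eval (zU P.totalDegree κ x0 p) (qq P) :=
    (MvPolynomial.continuous_eval (qq P)).measurable.comp h
  have h3 : Measurable fun p : ℝ × EE d => (-(p.1 : ℂ)) := by fun_prop
  exact h1.mul (Complex.measurable_exp.comp (h3.mul h2))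

lemma mu1_ae {d : ℕ} (b : ℝ) : ∀ᵐ p ∂(mu1 d b), p.1 ∈ Set.Ioc 0 b :=
  Measure.quasiMeasurePreserving_fst.ae (ae_restrict_mem measurableSet_Ioc)

lemma mu1_int {d : ℕ} (b δ : ℝ) (hδ : 0 < δ) :
    Integrable (fun p : ℝ × EE d => Real.exp (-(δ * ‖p.2‖))) (mu1 d b) :=
  (integrable_exp_norm δ hδ).comp_snd (volume.restrict (Set.Ioc 0 b))

lemma aU_eq {d : ℕ} (P s : MvPolynomial (Fin d) ℂ) (κ : ℝ) (x0 x : EE d) (p : ℝ × EE d) :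
    aU P κ x0 p * eval (zU P.totalDegree κ x0 p) s * Complex.exp (dotp (zU P.totalDegree κ x0 p) x) =
      AA P p.1 (PB P * s) (zU P.totalDegree κ x0 p) x := by
  rw [aU, AA, Complex.exp_add, eval_mul]; ring

lemma uu_rep {d : ℕ} (hd : 2 ≤ d) (P : MvPolynomial (Fin d) ℂ) (hell : IsElliptic P)
    (hm : 1 ≤ P.totalDegree) (r0 : ℝ) (hr0 : 0 < r0) :
    ∃ δ > 0, ∃ Cs, RepOn (mu1 d 1) {x | r0 ≤ ‖x‖} (uu P) δ Cs := by
  obtain ⟨κ, δ, hκ, hκ1, hδ, hB⟩ := B2 hd P hell hm r0 hr0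
  choose C hC hB using hB
  refine ⟨δ, hδ, fun s => ∫ p, C (PB P * s) * Real.exp (-(δ * ‖p.2‖)) ∂(mu1 d 1), fun x0 hx0 => ?_⟩
  have hle : ∀ s, ∀ᵐ p ∂(mu1 d 1), GN (aU P κ x0) (zU P.totalDegree κ x0) δ s x0 p ≤
      C (PB P * s) * Real.exp (-(δ * ‖p.2‖)) := by
    intro s
    filter_upwards [mu1_ae (d := d) 1] with p hp
    have h1 := hB (PB P * s) p.1 (tau P.totalDegree p.1) hp.1 hp.2 (tau_one_le hp.1 hp.2)
      (tau_mul hm hp.1) p.2 x0 hx0 (zU P.totalDegree κ x0 p) rfl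
    have e : GN (aU P κ x0) (zU P.totalDegree κ x0) δ s x0 p =
       ‖eval (zU P.totalDegree κ x0 p) (PB P * s)‖ * Real.exp (-p.1 * (eval (zU P.totalDegree κ x0 p) (qq P)).re
        + (dotp (zU P.totalDegree κ x0 p) x0).re + δ * ‖zU P.totalDegree κ x0 p‖) := by
      rw [GN, aU, norm_mul, Complex.norm_exp, eval_mul, norm_mul, add_assoc, Real.exp_add (-p.1 * _)]
      simp only [Complex.mul_re, Complex.neg_re, Complex.ofReal_re, Complex.neg_im, Complex.ofReal_im,
        neg_zero, zero_mul, sub_zero]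
      ring
    rw [e]
    refine h1.trans ?_
    have h2 := tau_one_le (m := P.totalDegree) hp.1 hp.2
    have h3 : Real.exp (-δ * tau P.totalDegree p.1) ≤ 1 := by
      rw [Real.exp_le_one_iff]; nlinarith
    have := hC (PB P * s)
    gcongr
    calc _ ≤ Real.exp (-δ * ‖p.2‖) * 1 := by gcongr
      _ = _ := by rw [mul_one, neg_mul]
  have hmz := (meas_zU P.totalDegree κ x0).aestronglyMeasurable (μ := mu1 d 1)
  have hma := (meas_aU P κ x0).aestronglyMeasurable (μ := mu1 d 1)
  have hmG : ∀ s, AEStronglyMeasurable (GN (aU P κ x0) (zU P.totalDegree κ x0) δ s x0) (mu1 d 1) := by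
    intro s
    unfold GN
    have h1 := hma.norm
    have h2 := ((MvPolynomial.continuous_eval s).comp_aestronglyMeasurable hmz).norm
    have h3 := (continuous_dotp x0).comp_aestronglyMeasurable hmz
    have h4 := Complex.continuous_re.comp_aestronglyMeasurable h3
    have h5 := hmz.norm.const_mul δ
    exact (h1.mul h2).mul (Real.continuous_exp.comp_aestronglyMeasurable (h4.add h5))
  have hGi : ∀ s, Integrable (GN (aU P κ x0) (zU P.totalDegree κ x0) δ s x0) (mu1 d 1) := by
    intro s
    refine ((mu1_int 1 δ hδ).const_mul (C (PB P * s))).mono' (hmG s) ?_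
    filter_upwards [hle s] with p hp
    rw [Real.norm_of_nonneg (by unfold GN; positivity)]
    exact hp
  refine ⟨aU P κ x0, zU P.totalDegree κ x0, hma, hmz, fun s => ⟨hGi s, ?_⟩, fun s v hv => ?_⟩
  · exact integral_mono_ae (hGi s) ((mu1_int 1 δ hδ).const_mul _) (hle s)
  · have hintg := A0v hma hmz s x0 v (hGi s) hv.le
    simp only [aU_eq] at hintg
    have e1 : II (mu1 d 1) (aU P κ x0) (zU P.totalDegree κ x0) s (x0 + v) =
        ∫ p, AA P p.1 (PB P * s) (zU P.totalDegree κ x0 p) (x0 + v)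
          ∂((volume.restrict (Set.Ioc (0 : ℝ) 1)).prod volume) := by
      unfold II
      simp only [aU_eq]
      rfl
    have e2 : ∫ p, AA P p.1 (PB P * s) (zU P.totalDegree κ x0 p) (x0 + v)
          ∂((volume.restrict (Set.Ioc (0 : ℝ) 1)).prod volume) =
        ∫ t in Set.Ioc (0 : ℝ) 1, ∫ ξ, AA P t (PB P * s) (zU P.totalDegree κ x0 (t, ξ)) (x0 + v) :=
      integral_prod _ hintg
    have e3 : ∀ t ∈ Set.Ioc (0 : ℝ) 1, hk P t (PB P * s) (x0 + v) =
        ∫ ξ, AA P t (PB P * s) (zU P.totalDegree κ x0 (t, ξ)) (x0 + v) := fun t ht =>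
      (hk_shift hd P hell hm (PB P * s) t ht.1 (by linarith [ht.2])
        (-(κ * tau P.totalDegree t / ‖x0‖) • x0) (x0 + v)).symm
    rw [e1, e2]
    exact setIntegral_congr_fun measurableSet_Ioc e3

end EK

namespace EK
open MvPolynomial MeasureTheory

def e1c {d : ℕ} (i0 : Fin d) : Fin d → ℂ := re2 (EuclideanSpace.single i0 (1 : ℝ))

lemma norm_e1c {d : ℕ} (i0 : Fin d) : ‖e1c i0‖ = 1 := by
  apply le_antisymm
  · refine (norm_re2_le _).trans ?_
    simp
  · have := norm_le_pi_norm (e1c i0) i0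
    simpa [e1c, re2] using this

lemma G1 {d : ℕ} (hd : 2 ≤ d) (P : MvPolynomial (Fin d) ℂ) (hell : IsElliptic P) (i0 : Fin d) :
    ∃ ρ c : ℝ, 0 < ρ ∧ 0 < c ∧ ∀ (ξ : EE d) (w : ℂ), ‖w‖ = ρ * (1 + ‖ξ‖) →
      c ≤ ‖eval (zz ξ 0 + w • e1c i0) P‖ := by
  obtain ⟨c1, hc1, hlow⟩ := elliptic_lower hd P hell
  obtain ⟨C, hC, hdiff⟩ := diff_bound P
  set m := P.totalDegree with hm
  set K : ℝ := 1 + 2 * C * 2 ^ m / c1 with hK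
  have hK1 : 1 ≤ K := by
    have : 0 ≤ 2 * C * 2 ^ m / c1 := by positivity
    linarith
  have hpi := Real.pi_gt_three
  refine ⟨2 * Real.pi * K, c1 / 2, by positivity, by positivity, fun ξ w hw => ?_⟩
  have h1 := hdiff (w • e1c i0) (zz ξ 0)
  have hA : ‖w • e1c i0‖ = ‖w‖ := by rw [norm_smul, norm_e1c, mul_one]
  rw [hA, add_comm (w • e1c i0)] at h1
  have hT : 1 + ‖zz ξ 0‖ ≤ 2 * Real.pi * (1 + ‖ξ‖) := by
    have := norm_zz_le ξ 0
    rw [norm_zero] at this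
    nlinarith
  set T := 1 + ‖zz ξ 0‖ with hTd
  have hT1 : 1 ≤ T := by have := norm_nonneg (zz ξ 0); linarith
  set A := ‖w‖ with hAd
  have hKT : K * T ≤ A := by
    rw [hw]; nlinarith
  have hTA : T ≤ A := by nlinarith
  have hA1 : 1 ≤ A := by linarith
  have h2 : ‖eval (zz ξ 0 + w • e1c i0) P - eval (w • e1c i0) (pm P)‖ ≤ c1 / 2 * A ^ m := by
    have h3 : ‖eval (zz ξ 0 + w • e1c i0) P - eval (w • e1c i0) (pm P)‖ * (A + T) ≤
        (C / K * (A + T) ^ m) * (A + T) := by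
      refine h1.trans ?_
      have : T ≤ (A + T) / K := by
        rw [le_div_iff₀ (by linarith)]; nlinarith
      calc C * T * (A + T) ^ m ≤ C * ((A + T) / K) * (A + T) ^ m := by gcongr
        _ = _ := by ring
    have h4 := le_of_mul_le_mul_right h3 (by linarith)
    refine h4.trans ?_
    calc C / K * (A + T) ^ m ≤ C / K * (2 * A) ^ m := by
          gcongr; linarith
      _ = (C * 2 ^ m / K) * A ^ m := by rw [mul_pow]; ring
      _ ≤ _ := by
          refine mul_le_mul_of_nonneg_right ?_ (by positivity)
          rw [div_le_iff₀ (by linarith), hK]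
          have : c1 / 2 * (1 + 2 * C * 2 ^ m / c1) = c1 / 2 + C * 2 ^ m := by field_simp
          rw [this]; linarith
  have h5 : c1 * A ^ m ≤ ‖eval (w • e1c i0) (pm P)‖ := by
    rw [pm_smul, norm_mul, norm_pow, mul_comm]
    have := hlow (EuclideanSpace.single i0 1)
    simp only [PiLp.norm_single, norm_one, one_pow, mul_one] at this
    gcongr
    exact this
  have h6 := norm_sub_norm_le (eval (w • e1c i0) (pm P)) (eval (zz ξ 0 + w • e1c i0) P)
  rw [norm_sub_rev] at h6
  have h7 : 1 ≤ A ^ m := one_le_pow₀ hA1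
  nlinarith

def zG {d : ℕ} (ρ : ℝ) (i0 : Fin d) (p : ℝ × EE d) : Fin d → ℂ :=
  zz p.2 0 + circleMap 0 (ρ * (1 + ‖p.2‖)) p.1 • e1c i0

def aG {d : ℕ} (P : MvPolynomial (Fin d) ℂ) (ρ : ℝ) (i0 : Fin d) (p : ℝ × EE d) : ℂ :=
  Complex.exp (-eval (zz p.2 0) (qq P)) * (eval (zG ρ i0 p) P)⁻¹

def gg {d : ℕ} (P : MvPolynomial (Fin d) ℂ) (ρ : ℝ) (i0 : Fin d) (s : MvPolynomial (Fin d) ℂ)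
    (x : EE d) : ℂ := II (mu1 d (2 * Real.pi)) (aG P ρ i0) (zG ρ i0) s x

lemma cont_zG {d : ℕ} (ρ : ℝ) (i0 : Fin d) : Continuous (zG (d := d) ρ i0) := by
  have h1 : Continuous fun p : ℝ × EE d => zz p.2 0 := cont_zz continuous_snd continuous_const
  have h2 : Continuous fun p : ℝ × EE d => circleMap 0 (ρ * (1 + ‖p.2‖)) p.1 := by
    unfold circleMap; fun_prop
  exact h1.add (h2.smul continuous_const)

lemma meas_aG {d : ℕ} (P : MvPolynomial (Fin d) ℂ) (ρ : ℝ) (i0 : Fin d) : Measurable (aG P ρ i0) := by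
  have h1 : Continuous fun p : ℝ × EE d => zz p.2 0 := cont_zz continuous_snd continuous_const
  have h2 : Continuous fun p : ℝ × EE d => Complex.exp (-eval (zz p.2 0) (qq P)) :=
    ((MvPolynomial.continuous_eval (qq P)).comp h1).neg.cexp
  have h3 : Continuous fun p : ℝ × EE d => eval (zG ρ i0 p) P :=
    (MvPolynomial.continuous_eval P).comp (cont_zG ρ i0)
  exact h2.measurable.mul h3.measurable.inv

lemma norm_zG {d : ℕ} (ρ : ℝ) (hρ : 0 < ρ) (i0 : Fin d) (p : ℝ × EE d) :
    ‖zG ρ i0 p‖ ≤ (2 * Real.pi + ρ) * (1 + ‖p.2‖) := by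
  have h := norm_zz_le p.2 0
  rw [norm_zero] at h
  have h2 : ‖circleMap 0 (ρ * (1 + ‖p.2‖)) p.1 • e1c i0‖ = ρ * (1 + ‖p.2‖) := by
    rw [norm_smul, norm_e1c, mul_one, norm_circleMap_zero, abs_of_nonneg (by positivity)]
  have h3 := norm_add_le (zz p.2 0) (circleMap 0 (ρ * (1 + ‖p.2‖)) p.1 • e1c i0)
  have := Real.pi_pos
  unfold zG
  nlinarith

lemma G2 {d : ℕ} (hd : 2 ≤ d) (P : MvPolynomial (Fin d) ℂ) (hell : IsElliptic P)
    (hm : 1 ≤ P.totalDegree) (N : ℝ) (hN : 0 ≤ N) : ∃ C : ℝ, 0 < C ∧ ∀ ξ : EE d,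
      Real.exp (-(eval (zz ξ 0) (qq P)).re + N * ‖ξ‖) ≤ C * Real.exp (-‖ξ‖) := by
  obtain ⟨C, hC, h⟩ := B1 hd P hell hm 1 1 0 (N * d) one_pos le_rfl (by positivity)
  refine ⟨C, hC, fun ξ => le_trans ?_ (h 1 le_rfl (by norm_num) ξ 0 (by simp))⟩
  simp only [map_one, norm_one, one_mul, neg_mul]
  refine Real.exp_le_exp.2 ?_
  have h1 := norm_le_re2 ξ
  have h2 : ‖zz ξ 0‖ = 2 * Real.pi * ‖re2 ξ‖ := by
    have : re2 (0 : EE d) = 0 := by funext i; simp [re2]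
    rw [zz, this, add_zero, norm_smul, norm_2pi]
  have h3 : ‖ξ‖ ≤ d * ‖zz ξ 0‖ := by
    rw [h2]
    have := Real.pi_gt_three
    have h5 : 0 ≤ (d : ℝ) * ‖re2 ξ‖ := by positivity
    nlinarith
  have : N * ‖ξ‖ ≤ N * d * ‖zz ξ 0‖ := by
    rw [mul_assoc]; gcongr
  linarith

lemma gg_rep {d : ℕ} (hd : 2 ≤ d) (P : MvPolynomial (Fin d) ℂ) (hell : IsElliptic P)
    (hm : 1 ≤ P.totalDegree) (ρ c : ℝ) (hρ : 0 < ρ) (hc : 0 < c) (i0 : Fin d)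
    (hlow : ∀ (ξ : EE d) (w : ℂ), ‖w‖ = ρ * (1 + ‖ξ‖) → c ≤ ‖eval (zz ξ 0 + w • e1c i0) P‖)
    (R : ℝ) (hR : 0 ≤ R) :
    ∃ Cs, RepOn (mu1 d (2 * Real.pi)) {x | ‖x‖ ≤ R} (gg P ρ i0) 1 Cs := by
  have hpi := Real.pi_pos
  set N := (2 * Real.pi + ρ) with hN
  obtain ⟨C2, hC2, hG2⟩ := G2 hd P hell hm ((2 + d * R) * N) (by positivity)
  choose C hC hs using fun s : MvPolynomial (Fin d) ℂ => absorb_poly s 1 one_pos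
  set D : MvPolynomial (Fin d) ℂ → ℝ := fun s => c⁻¹ * C s * Real.exp ((2 + d * R) * N) * C2
  refine ⟨fun s => ∫ p, D s * Real.exp (-(1 * ‖p.2‖)) ∂(mu1 d (2 * Real.pi)), fun x0 hx0 => ?_⟩
  have hle : ∀ s p, GN (aG P ρ i0) (zG ρ i0) 1 s x0 p ≤ D s * Real.exp (-(1 * ‖p.2‖)) := by
    intro s p
    have e1 : ‖aG P ρ i0 p‖ ≤ c⁻¹ * Real.exp (-(eval (zz p.2 0) (qq P)).re) := by
      rw [aG, norm_mul, Complex.norm_exp, Complex.neg_re, norm_inv, mul_comm]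
      gcongr
      refine hlow p.2 _ ?_
      rw [norm_circleMap_zero, abs_of_nonneg (by positivity)]
    have e2 := hs s (zG ρ i0 p)
    have e3 := norm_zG ρ hρ i0 p
    have e4 : (dotp (zG ρ i0 p) x0).re ≤ ‖zG ρ i0 p‖ * (d * R) := by
      refine (Complex.re_le_norm _).trans ((norm_dotp_le _ _).trans ?_)
      gcongr
      exact hx0
    rw [GN]
    have e5 : Real.exp (1 * ‖zG ρ i0 p‖) * Real.exp ((dotp (zG ρ i0 p) x0).re + 1 * ‖zG ρ i0 p‖) ≤
        Real.exp ((2 + d * R) * N) * Real.exp ((2 + d * R) * N * ‖p.2‖) := by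
      rw [← Real.exp_add, ← Real.exp_add]
      refine Real.exp_le_exp.2 ?_
      have : (2 + d * R) * ‖zG ρ i0 p‖ ≤ (2 + d * R) * (N * (1 + ‖p.2‖)) := by gcongr
      linarith
    have e6 := hG2 p.2
    rw [Real.exp_add] at e6
    have hCs := hC s
    calc _ ≤ (c⁻¹ * Real.exp (-(eval (zz p.2 0) (qq P)).re)) * (C s * Real.exp (1 * ‖zG ρ i0 p‖)) *
          Real.exp ((dotp (zG ρ i0 p) x0).re + 1 * ‖zG ρ i0 p‖) := by
          refine mul_le_mul_of_nonneg_right ?_ (Real.exp_pos _).le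
          exact mul_le_mul e1 e2 (norm_nonneg _) (by positivity)
      _ = c⁻¹ * C s * Real.exp (-(eval (zz p.2 0) (qq P)).re) * (Real.exp (1 * ‖zG ρ i0 p‖) *
          Real.exp ((dotp (zG ρ i0 p) x0).re + 1 * ‖zG ρ i0 p‖)) := by ring
      _ ≤ c⁻¹ * C s * Real.exp (-(eval (zz p.2 0) (qq P)).re) * (Real.exp ((2 + d * R) * N) *
          Real.exp ((2 + d * R) * N * ‖p.2‖)) := mul_le_mul_of_nonneg_left e5 (by positivity)
      _ = c⁻¹ * C s * Real.exp ((2 + d * R) * N) * (Real.exp (-(eval (zz p.2 0) (qq P)).re) *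
          Real.exp ((2 + d * R) * N * ‖p.2‖)) := by ring
      _ ≤ c⁻¹ * C s * Real.exp ((2 + d * R) * N) * (C2 * Real.exp (-‖p.2‖)) :=
          mul_le_mul_of_nonneg_left e6 (by positivity)
      _ = _ := by simp only [D, one_mul]; ring
  have hmz := (cont_zG ρ i0).aestronglyMeasurable (μ := mu1 d (2 * Real.pi))
  have hma := (meas_aG P ρ i0).aestronglyMeasurable (μ := mu1 d (2 * Real.pi))
  have hmG : ∀ s, AEStronglyMeasurable (GN (aG P ρ i0) (zG ρ i0) 1 s x0) (mu1 d (2 * Real.pi)) := by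
    intro s
    unfold GN
    have h1 := hma.norm
    have h2 := ((MvPolynomial.continuous_eval s).comp_aestronglyMeasurable hmz).norm
    have h3 := (continuous_dotp x0).comp_aestronglyMeasurable hmz
    have h4 := Complex.continuous_re.comp_aestronglyMeasurable h3
    have h5 := hmz.norm.const_mul (1 : ℝ)
    exact (h1.mul h2).mul (Real.continuous_exp.comp_aestronglyMeasurable (h4.add h5))
  have hGi : ∀ s, Integrable (GN (aG P ρ i0) (zG ρ i0) 1 s x0) (mu1 d (2 * Real.pi)) := by
    intro s
    refine ((mu1_int (2 * Real.pi) 1 one_pos).const_mul (D s)).mono' (hmG s) ?_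
    refine Filter.Eventually.of_forall fun p => ?_
    rw [Real.norm_of_nonneg (by unfold GN; positivity)]
    exact hle s p
  exact ⟨aG P ρ i0, zG ρ i0, hma, hmz, fun s => ⟨hGi s,
    integral_mono (hGi s) ((mu1_int (2 * Real.pi) 1 one_pos).const_mul _) (hle s)⟩, fun s v hv => rfl⟩

lemma gg_P {d : ℕ} (hd : 2 ≤ d) (P : MvPolynomial (Fin d) ℂ) (hell : IsElliptic P)
    (hm : 1 ≤ P.totalDegree) (ρ c : ℝ) (hρ : 0 < ρ) (hc : 0 < c) (i0 : Fin d)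
    (hlow : ∀ (ξ : EE d) (w : ℂ), ‖w‖ = ρ * (1 + ‖ξ‖) → c ≤ ‖eval (zz ξ 0 + w • e1c i0) P‖)
    (s : MvPolynomial (Fin d) ℂ) (x : EE d) :
    gg P ρ i0 (s * P) x = (2 * Real.pi : ℝ) * hk P 1 s x := by
  obtain ⟨Cs, hrep⟩ := gg_rep hd P hell hm ρ c hρ hc i0 hlow ‖x‖ (norm_nonneg _)
  have hpi := Real.pi_pos
  have hmz := (cont_zG ρ i0).aestronglyMeasurable (μ := mu1 d (2 * Real.pi))
  have hma := (meas_aG P ρ i0).aestronglyMeasurable (μ := mu1 d (2 * Real.pi))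
  have e1 : ∀ p : ℝ × EE d, aG P ρ i0 p * eval (zG ρ i0 p) (s * P) * Complex.exp (dotp (zG ρ i0 p) x) =
      Complex.exp (-eval (zz p.2 0) (qq P)) * (eval (zG ρ i0 p) s * Complex.exp (dotp (zG ρ i0 p) x)) := by
    intro p
    have h0 : eval (zG ρ i0 p) P ≠ 0 := by
      have := hlow p.2 (circleMap 0 (ρ * (1 + ‖p.2‖)) p.1)
        (by rw [norm_circleMap_zero, abs_of_nonneg (by positivity)])
      exact norm_pos_iff.1 (hc.trans_le this)
    rw [aG, eval_mul]
    field_simp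
  have hintg : Integrable (fun p : ℝ × EE d => Complex.exp (-eval (zz p.2 0) (qq P)) *
      (eval (zG ρ i0 p) s * Complex.exp (dotp (zG ρ i0 p) x))) (mu1 d (2 * Real.pi)) := by
    obtain ⟨a, z, ha, hz, hG, hJ⟩ := hrep x (by simp)
    obtain ⟨C2, hC2, hG2⟩ := G2 hd P hell hm ((1 + d * ‖x‖) * (2 * Real.pi + ρ)) (by positivity)
    obtain ⟨C, hC, hs⟩ := absorb_poly s 1 one_pos
    refine ((mu1_int (2 * Real.pi) 1 one_pos).const_mul
      (C * Real.exp ((1 + d * ‖x‖) * (2 * Real.pi + ρ)) * C2)).mono' ?_ ?_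
    · have h1 : Continuous fun p : ℝ × EE d => zz p.2 0 := cont_zz continuous_snd continuous_const
      have h2 : Continuous fun p : ℝ × EE d => Complex.exp (-eval (zz p.2 0) (qq P)) :=
        ((MvPolynomial.continuous_eval (qq P)).comp h1).neg.cexp
      have h3 : Continuous fun p : ℝ × EE d => eval (zG ρ i0 p) s :=
        (MvPolynomial.continuous_eval s).comp (cont_zG ρ i0)
      have h4 : Continuous fun p : ℝ × EE d => dotp (zG ρ i0 p) x :=
        (continuous_dotp x).comp (cont_zG ρ i0)
      exact (h2.mul (h3.mul h4.cexp)).aestronglyMeasurable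
    · refine Filter.Eventually.of_forall fun p => ?_
      rw [norm_mul, norm_mul, Complex.norm_exp, Complex.norm_exp, Complex.neg_re]
      have e2 := hs (zG ρ i0 p)
      have e3 := norm_zG ρ hρ i0 p
      have e4 : (dotp (zG ρ i0 p) x).re ≤ ‖zG ρ i0 p‖ * (d * ‖x‖) :=
        (Complex.re_le_norm _).trans (norm_dotp_le _ _)
      have e6 := hG2 p.2
      rw [Real.exp_add] at e6
      set N := 2 * Real.pi + ρ with hN
      have e5 : Real.exp (1 * ‖zG ρ i0 p‖) * Real.exp (dotp (zG ρ i0 p) x).re ≤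
          Real.exp ((1 + d * ‖x‖) * N) * Real.exp ((1 + d * ‖x‖) * N * ‖p.2‖) := by
        rw [← Real.exp_add, ← Real.exp_add]
        refine Real.exp_le_exp.2 ?_
        have : (1 + d * ‖x‖) * ‖zG ρ i0 p‖ ≤ (1 + d * ‖x‖) * (N * (1 + ‖p.2‖)) := by gcongr
        linarith
      set E := Real.exp (-(eval (zz p.2 0) (qq P)).re)
      calc _ ≤ E * (C * Real.exp (1 * ‖zG ρ i0 p‖) * Real.exp (dotp (zG ρ i0 p) x).re) := by
            gcongr
        _ = E * C * (Real.exp (1 * ‖zG ρ i0 p‖) * Real.exp (dotp (zG ρ i0 p) x).re) := by ring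
        _ ≤ E * C * (Real.exp ((1 + d * ‖x‖) * N) * Real.exp ((1 + d * ‖x‖) * N * ‖p.2‖)) :=
            mul_le_mul_of_nonneg_left e5 (by positivity)
        _ = C * Real.exp ((1 + d * ‖x‖) * N) * (E * Real.exp ((1 + d * ‖x‖) * N * ‖p.2‖)) := by ring
        _ ≤ C * Real.exp ((1 + d * ‖x‖) * N) * (C2 * Real.exp (-‖p.2‖)) :=
            mul_le_mul_of_nonneg_left e6 (by positivity)
        _ = _ := by rw [one_mul]; ring
  have e2 : gg P ρ i0 (s * P) x = ∫ ξ : EE d, ∫ φ in Set.Ioc (0 : ℝ) (2 * Real.pi),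
      Complex.exp (-eval (zz ξ 0) (qq P)) *
      (eval (zG ρ i0 (φ, ξ)) s * Complex.exp (dotp (zG ρ i0 (φ, ξ)) x)) := by
    rw [gg, II]
    simp only [e1]
    exact integral_prod_symm _ hintg
  rw [e2, hk, ← integral_const_mul]
  congr 1
  funext ξ
  rw [integral_const_mul]
  set F : ℂ → ℂ := fun w => eval (zz ξ 0 + w • e1c i0) s * Complex.exp (dotp (zz ξ 0 + w • e1c i0) x)
    with hF
  have hFd : Differentiable ℂ F := by
    intro w
    have h1 := (Db_hasDerivAt (e1c i0) (zz ξ 0) s w).differentiableAt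
    have h2 : DifferentiableAt ℂ (fun w : ℂ => dotp (zz ξ 0 + w • e1c i0) x) w := by
      simp only [dotp_line]; fun_prop
    exact h1.mul h2.cexp
  have h3 : Real.circleAverage F 0 (ρ * (1 + ‖ξ‖)) = F 0 := hFd.diffContOnCl.circleAverage
  rw [Real.circleAverage_def, intervalIntegral.integral_of_le (by positivity), inv_smul_eq_iff₀
    (by positivity)] at h3
  have h4 : ∫ φ in Set.Ioc (0 : ℝ) (2 * Real.pi),
      (eval (zG ρ i0 (φ, ξ)) s * Complex.exp (dotp (zG ρ i0 (φ, ξ)) x)) = (2 * Real.pi) • F 0 := h3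
  rw [h4, AA, Complex.exp_add, hF]
  simp only [zero_smul, add_zero, Complex.real_smul, Complex.ofReal_one, neg_mul, one_mul]
  ring

end EK

namespace EK
open MvPolynomial MeasureTheory

lemma hk_bound {d : ℕ} (hd : 2 ≤ d) (P : MvPolynomial (Fin d) ℂ) (hell : IsElliptic P)
    (hm : 1 ≤ P.totalDegree) (s : MvPolynomial (Fin d) ℂ) (x : EE d) (hx : x ≠ 0) :
    ∃ C δ : ℝ, 0 < C ∧ 0 < δ ∧ ∀ t : ℝ, 0 < t → t ≤ 1 →
      ‖hk P t s x‖ ≤ C * Real.exp (-δ * tau P.totalDegree t) := by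
  obtain ⟨κ, δ, hκ, hκ1, hδ, hB⟩ := B2 hd P hell hm ‖x‖ (norm_pos_iff.2 hx)
  obtain ⟨C, hC, hB⟩ := hB s
  have hI := integrable_exp_norm (d := d) δ hδ
  have hI0 : 0 ≤ ∫ ξ : EE d, Real.exp (-(δ * ‖ξ‖)) := integral_nonneg fun ξ => (Real.exp_pos _).le
  refine ⟨C * (1 + ∫ ξ : EE d, Real.exp (-(δ * ‖ξ‖))), δ, by positivity, hδ, fun t ht ht1 => ?_⟩
  rw [← hk_shift hd P hell hm s t ht (by linarith) (-(κ * tau P.totalDegree t / ‖x‖) • x) x]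
  have h1 : ‖∫ ξ, AA P t s (zz ξ (-(κ * tau P.totalDegree t / ‖x‖) • x)) x‖ ≤
      ∫ ξ : EE d, C * Real.exp (-δ * tau P.totalDegree t) * Real.exp (-(δ * ‖ξ‖)) := by
    refine norm_integral_le_of_norm_le (hI.const_mul _) (Filter.Eventually.of_forall fun ξ => ?_)
    have h2 := hB t (tau P.totalDegree t) ht ht1 (tau_one_le ht ht1) (tau_mul hm ht) ξ x le_rfl _ rfl
    rw [norm_AA]
    refine le_trans ?_ (h2.trans (le_of_eq ?_))
    · refine mul_le_mul_of_nonneg_left (Real.exp_le_exp.2 ?_) (norm_nonneg _)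
      have : 0 ≤ δ * ‖zz ξ (-(κ * tau P.totalDegree t / ‖x‖) • x)‖ := by positivity
      linarith
    · rw [neg_mul δ ‖ξ‖]; ring
  refine h1.trans ?_
  rw [integral_const_mul]
  have := Real.exp_pos (-δ * tau P.totalDegree t)
  nlinarith [mul_pos hC this]

lemma hk_tendsto {d : ℕ} (hd : 2 ≤ d) (P : MvPolynomial (Fin d) ℂ) (hell : IsElliptic P)
    (hm : 1 ≤ P.totalDegree) (s : MvPolynomial (Fin d) ℂ) (x : EE d) (hx : x ≠ 0) :
    Filter.Tendsto (fun t => hk P t s x) (nhdsWithin 0 (Set.Ioi 0)) (nhds 0) := by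
  obtain ⟨C, δ, hC, hδ, h⟩ := hk_bound hd P hell hm s x hx
  set e : ℝ := 1 / ((2 * P.totalDegree - 1 : ℕ) : ℝ) with he
  have he0 : 0 < e := by
    have : 0 < 2 * P.totalDegree - 1 := by omega
    have : (0 : ℝ) < ((2 * P.totalDegree - 1 : ℕ) : ℝ) := by exact_mod_cast this
    positivity
  have ht : Filter.Tendsto (fun t : ℝ => C * (δ⁻¹ * t ^ e)) (nhdsWithin 0 (Set.Ioi 0)) (nhds 0) := by
    have h1 : Filter.Tendsto (fun t : ℝ => t ^ e) (nhdsWithin 0 (Set.Ioi 0)) (nhds 0) := by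
      have := (Real.continuousAt_rpow_const 0 e (Or.inr he0.le)).tendsto
      rw [Real.zero_rpow he0.ne'] at this
      exact this.mono_left nhdsWithin_le_nhds
    have := (h1.const_mul δ⁻¹).const_mul C
    simpa using this
  refine squeeze_zero_norm' ?_ ht
  filter_upwards [Ioc_mem_nhdsGT (zero_lt_one' ℝ)] with t ht
  refine (h t ht.1 ht.2).trans ?_
  gcongr
  have e1 : tau P.totalDegree t = (t ^ e)⁻¹ := by rw [tau, Real.rpow_neg ht.1.le]
  have hp : 0 < t ^ e := Real.rpow_pos_of_pos ht.1 e
  rw [e1, neg_mul, Real.exp_neg]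
  rw [← inv_inv (t ^ e), ← mul_inv, inv_inv (t ^ e)]
  gcongr
  have := Real.add_one_le_exp (δ * (t ^ e)⁻¹)
  linarith

lemma uu_P {d : ℕ} (hd : 2 ≤ d) (P : MvPolynomial (Fin d) ℂ) (hell : IsElliptic P)
    (hm : 1 ≤ P.totalDegree) (s : MvPolynomial (Fin d) ℂ) (x : EE d) (hx : x ≠ 0) :
    uu P (s * P) x = - hk P 1 s x := by
  have e : PB P * (s * P) = s * qq P := by rw [qq]; ring
  rw [uu, e]
  have hcont : ContinuousOn (fun t => hk P t (s * qq P) x) (Set.Ioc 0 1) := fun t ht =>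
    (hk_hasDerivAt hd P hell hm (s * qq P) t ht.1 (by linarith [ht.2]) x).continuousAt.continuousWithinAt
  obtain ⟨C, δ, hC, hδ, h⟩ := hk_bound hd P hell hm (s * qq P) x hx
  have hintg : IntegrableOn (fun t => hk P t (s * qq P) x) (Set.Ioc 0 1) := by
    have hc1 : IntegrableOn (fun _ : ℝ => C) (Set.Ioc (0 : ℝ) 1) := by simp
    refine Integrable.mono' hc1 (hcont.aestronglyMeasurable measurableSet_Ioc) ?_
    filter_upwards [ae_restrict_mem measurableSet_Ioc] with t ht
    refine (h t ht.1 ht.2).trans ?_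
    have := tau_one_le (m := P.totalDegree) ht.1 ht.2
    have h3 : Real.exp (-δ * tau P.totalDegree t) ≤ 1 := by
      rw [Real.exp_le_one_iff]; nlinarith
    nlinarith
  have h1 := intervalIntegral.integral_eq_sub_of_hasDerivAt_of_tendsto (zero_lt_one' ℝ)
    (f := fun t => hk P t s x) (f' := fun t => - hk P t (s * qq P) x)
    (fun t ht => hk_hasDerivAt hd P hell hm s t ht.1 (by linarith [ht.2]) x)
    ((intervalIntegrable_iff_integrableOn_Ioc_of_le zero_le_one).2 hintg.neg)
    (hk_tendsto hd P hell hm s x hx)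
    ((hk_hasDerivAt hd P hell hm s 1 one_pos (by norm_num) x).continuousAt.tendsto.mono_left
      nhdsWithin_le_nhds)
  rw [intervalIntegral.integral_of_le zero_le_one, integral_neg, sub_zero] at h1
  rw [← h1, neg_neg]

lemma AnEst.mono {d : ℕ} {S S' : Set (EE d)} {J : MvPolynomial (Fin d) ℂ → EE d → ℂ} {δ : ℝ}
    {Cs} (h : AnEst S J δ Cs) (hS : S' ⊆ S) : AnEst S' J δ Cs := fun s x hx => h s x (hS hx)

/-- Summary of the properties of the special jet. -/
structure Good {d : ℕ} (P : MvPolynomial (Fin d) ℂ) (g : MvPolynomial (Fin d) ℂ → EE d → ℂ) : Prop where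
  jet : IsJet {0}ᶜ (fun s x => uu P s x + g s x)
  ker : ∀ s, ∀ x ∈ ({0}ᶜ : Set (EE d)), uu P (s * P) x + g (s * P) x = 0
  est : ∀ r R : ℝ, 0 < r → 0 ≤ R → ∃ δ > 0, ∃ Cs,
    AnEst {x | r ≤ ‖x‖ ∧ ‖x‖ ≤ R} (fun s x => uu P s x + g s x) δ Cs
  uest : ∀ r : ℝ, 0 < r → ∃ δ > 0, ∃ Cs, AnEst {x | r ≤ ‖x‖} (uu P) δ Cs
  gest : ∀ s, ∃ C : ℝ, ∀ x, ‖x‖ ≤ 1 → ‖g s x‖ ≤ C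

lemma exists_good {d : ℕ} (hd : 2 ≤ d) (P : MvPolynomial (Fin d) ℂ) (hell : IsElliptic P)
    (hm : 1 ≤ P.totalDegree) : ∃ g, Good P g := by
  have i0 : Fin d := ⟨0, by omega⟩
  obtain ⟨ρ, c, hρ, hc, hlow⟩ := G1 hd P hell i0
  have hpi := Real.pi_pos
  have hpic : ((2 * Real.pi : ℝ) : ℂ) ≠ 0 := by
    exact_mod_cast (by positivity : 2 * Real.pi ≠ 0)
  refine ⟨fun s x => ((2 * Real.pi : ℝ) : ℂ)⁻¹ * gg P ρ i0 s x, ⟨fun s x hx => ?_, fun s s' x hx => ?_,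
    fun c s x hx => ?_⟩, ?_, ?_, ?_, ?_⟩
  · obtain ⟨δ, hδ, Cs, h⟩ := uu_rep hd P hell hm ‖x‖ (norm_pos_iff.2 hx)
    obtain ⟨Cs', h'⟩ := gg_rep hd P hell hm ρ c hρ hc i0 hlow ‖x‖ (norm_nonneg _)
    have h1 := h.deriv hδ s x (by simp)
    have h2 := h'.deriv one_pos s x (by simp)
    refine (h1.add (h2.const_mul ((2 * Real.pi : ℝ) : ℂ)⁻¹)).congr_fderiv ?_
    rw [Finset.smul_sum, ← Finset.sum_add_distrib]
    refine Finset.sum_congr rfl fun i _ => ?_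
    ext v
    simp only [add_apply, smul_apply, smul_eq_mul]
    ring
  · obtain ⟨δ, hδ, Cs, h⟩ := uu_rep hd P hell hm ‖x‖ (norm_pos_iff.2 hx)
    obtain ⟨Cs', h'⟩ := gg_rep hd P hell hm ρ c hρ hc i0 hlow ‖x‖ (norm_nonneg _)
    rw [h.add hδ s s' x (by simp), h'.add one_pos s s' x (by simp)]
    ring
  · obtain ⟨δ, hδ, Cs, h⟩ := uu_rep hd P hell hm ‖x‖ (norm_pos_iff.2 hx)
    obtain ⟨Cs', h'⟩ := gg_rep hd P hell hm ρ _ hρ hc i0 hlow ‖x‖ (norm_nonneg _)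
    rw [h.smul hδ c s x (by simp), h'.smul one_pos c s x (by simp)]
    ring
  · intro s x hx
    rw [uu_P hd P hell hm s x hx, gg_P hd P hell hm ρ c hρ hc i0 hlow s x]
    field_simp
    ring
  · intro r R hr hR
    obtain ⟨δ, hδ, Cs, h⟩ := uu_rep hd P hell hm r hr
    obtain ⟨Cs', h'⟩ := gg_rep hd P hell hm ρ c hρ hc i0 hlow R hR
    exact ⟨min δ 1, lt_min hδ one_pos, _, AnEst.add hδ one_pos
      ((h.anEst hδ).mono fun x hx => hx.1) ((h'.anEst one_pos).mono fun x hx => hx.2) _⟩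
  · intro r hr
    obtain ⟨δ, hδ, Cs, h⟩ := uu_rep hd P hell hm r hr
    exact ⟨δ, hδ, Cs, h.anEst hδ⟩
  · intro s
    obtain ⟨Cs', h'⟩ := gg_rep hd P hell hm ρ c hρ hc i0 hlow 1 zero_le_one
    refine ⟨‖((2 * Real.pi : ℝ) : ℂ)⁻¹‖ * Cs' s, fun x hx => ?_⟩
    rw [norm_mul]
    gcongr
    exact (h'.anEst one_pos).bound s x hx

end EK

namespace EK
open MvPolynomial MeasureTheory

def fms (c : ℕ → ℂ) : FormalMultilinearSeries ℝ ℝ ℂ :=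
  fun n => ContinuousMultilinearMap.mkPiRing ℝ (Fin n) (c n)

lemma fms_coeff (c : ℕ → ℂ) (n : ℕ) : (fms c).coeff n = c n := by
  simp [fms, FormalMultilinearSeries.coeff]

lemma fms_apply (c : ℕ → ℂ) (n : ℕ) (τ : ℝ) : (fms c n fun _ => τ) = τ ^ n • c n := by
  simp [fms]

lemma ell_smul {d : ℕ} (τ : ℝ) (v : EE d) : ell (τ • v) = C (τ : ℂ) * ell v := by
  simp only [ell, Finset.mul_sum, PiLp.smul_apply, smul_eq_mul, Complex.ofReal_mul, map_mul, mul_assoc]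

lemma line_analytic {d : ℕ} {J : MvPolynomial (Fin d) ℂ → EE d → ℂ} (x v : EE d)
    (hsm : ∀ c s, J (C c * s) x = c * J s x) {δ : ℝ} (hδ : 0 < δ) (s)
    (h : ∀ v, d * ‖v‖ < δ → HasSum (fun k : ℕ => J (s * ell v ^ k) x / k.factorial) (J s (x + v))) :
    ∀ᶠ τ : ℝ in nhds 0, HasSum (fun k : ℕ => τ ^ k • (J (s * ell v ^ k) x / k.factorial))
      (J s (x + τ • v)) := by
  have hc : Filter.Tendsto (fun τ : ℝ => d * ‖τ • v‖) (nhds 0) (nhds 0) := by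
    have : Continuous fun τ : ℝ => d * ‖τ • v‖ := by fun_prop
    simpa using this.tendsto 0
  filter_upwards [hc.eventually (gt_mem_nhds hδ)] with τ hτ
  have h1 := h (τ • v) hτ
  have e : ∀ k : ℕ, J (s * ell (τ • v) ^ k) x / k.factorial =
      τ ^ k • (J (s * ell v ^ k) x / k.factorial) := by
    intro k
    have : s * ell (τ • v) ^ k = C ((τ : ℂ) ^ k) * (s * ell v ^ k) := by
      rw [ell_smul, mul_pow, C_pow]; ring
    rw [this, hsm, Complex.real_smul, Complex.ofReal_pow]; ring
  simpa only [e] using h1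

lemma line_analyticAt {d : ℕ} {J : MvPolynomial (Fin d) ℂ → EE d → ℂ} (y v : EE d) (τ0 : ℝ)
    (hsm : ∀ c s, J (C c * s) (y + τ0 • v) = c * J s (y + τ0 • v)) {δ : ℝ} (hδ : 0 < δ) (s)
    (h : ∀ v', d * ‖v'‖ < δ → HasSum (fun k : ℕ => J (s * ell v' ^ k) (y + τ0 • v) / k.factorial)
      (J s (y + τ0 • v + v'))) :
    HasFPowerSeriesAt (fun τ : ℝ => J s (y + τ • v))
      (fms fun k => J (s * ell v ^ k) (y + τ0 • v) / k.factorial) τ0 := by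
  rw [hasFPowerSeriesAt_iff]
  filter_upwards [line_analytic (y + τ0 • v) v hsm hδ s h] with τ hτ
  simp only [fms_coeff]
  rw [add_smul, ← add_assoc]
  exact hτ

lemma line_bound {d : ℕ} {J : MvPolynomial (Fin d) ℂ → EE d → ℂ} (y v : EE d) (s)
    (hsm : ∀ τ ∈ Set.Icc (0 : ℝ) 1, ∀ c s, J (C c * s) (y + τ • v) = c * J s (y + τ • v))
    (h : ∀ τ ∈ Set.Icc (0 : ℝ) 1, ∃ δ > 0, ∀ v', d * ‖v'‖ < δ →
      HasSum (fun k : ℕ => J (s * ell v' ^ k) (y + τ • v) / k.factorial) (J s (y + τ • v + v')))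
    (D : ℝ) (hb : ∀ k : ℕ, ‖J (s * ell v ^ k) y / k.factorial‖ ≤ D * (1 / 2) ^ k) :
    ‖J s (y + v)‖ ≤ 2 * D := by
  set c : ℕ → ℂ := fun k => J (s * ell v ^ k) y / k.factorial with hc
  have hr : ((3 / 2 : NNReal) : ENNReal) ≤ (fms c).radius := by
    refine FormalMultilinearSeries.le_radius_of_bound _ D fun n => ?_
    have h1 : ‖fms c n‖ = ‖c n‖ := by simp [fms]
    rw [h1]
    have h2 : (((3 / 2 : NNReal) : ℝ)) ^ n ≤ 2 ^ n := by
      gcongr; push_cast; norm_num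
    have hD : 0 ≤ D := by simpa using (norm_nonneg _).trans (hb 0)
    calc _ ≤ D * (1 / 2) ^ n * 2 ^ n := by gcongr; exact hb n
      _ = D := by rw [mul_assoc, ← mul_pow]; norm_num
  have hp := (fms c).hasFPowerSeriesOnBall (lt_of_lt_of_le (by norm_num) hr)
  have hg : AnalyticOnNhd ℝ (fms c).sum (Set.Icc 0 1) := by
    refine hp.analyticOnNhd.mono fun τ hτ => ?_
    refine Metric.eball_subset_eball hr ?_
    rw [Metric.eball_coe, Metric.mem_ball, Real.dist_eq, sub_zero, abs_of_nonneg hτ.1]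
    have := hτ.2
    push_cast
    linarith
  have hf : AnalyticOnNhd ℝ (fun τ : ℝ => J s (y + τ • v)) (Set.Icc 0 1) := by
    intro τ hτ
    obtain ⟨δ, hδ, h1⟩ := h τ hτ
    exact (line_analyticAt y v τ (hsm τ hτ) hδ s h1).analyticAt
  have h0 : (0 : ℝ) ∈ Set.Icc (0 : ℝ) 1 := by simp
  have heq : (fun τ : ℝ => J s (y + τ • v)) =ᶠ[nhds 0] (fms c).sum := by
    obtain ⟨δ, hδ, h1⟩ := h 0 h0
    have := line_analyticAt y v 0 (hsm 0 h0) hδ s h1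
    simp only [zero_smul, add_zero] at this
    have h3 := this.eventually_hasSum
    have h4 := hp.hasFPowerSeriesAt.eventually_hasSum
    filter_upwards [h3, h4] with τ a b
    have := a.unique b
    simpa using this
  have := hf.eqOn_of_preconnected_of_eventuallyEq hg isPreconnected_Icc h0 heq
    (by simp : (1 : ℝ) ∈ Set.Icc (0 : ℝ) 1)
  simp only [one_smul] at this
  rw [this, FormalMultilinearSeries.sum]
  have hs : HasSum (fun k : ℕ => D * (1 / 2) ^ k) (2 * D) := by
    have := hasSum_geometric_two.mul_left D
    rwa [mul_comm D 2] at this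
  refine tsum_of_norm_bounded hs fun k => ?_
  rw [fms_apply]
  rw [one_pow, one_smul]
  exact hb k

lemma uu_bdd {d : ℕ} (hd : 2 ≤ d) (P : MvPolynomial (Fin d) ℂ)
    {g : MvPolynomial (Fin d) ℂ → EE d → ℂ} (hg : Good P g) (s : MvPolynomial (Fin d) ℂ)
    (r R : ℝ) (hr : 0 < r) (hR : 0 ≤ R) :
    ∃ δ > 0, ∀ y : EE d, 0 < ‖y‖ → ‖y‖ < δ → ∀ γ : ℝ, 0 ≤ γ →
      (∀ s' : MvPolynomial (Fin d) ℂ, ∀ M : ℝ, (∀ x, r ≤ ‖x‖ → ‖x‖ ≤ R → ‖uu P s' x + g s' x‖ ≤ M) →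
        ‖uu P s' y + g s' y‖ ≤ γ * M) →
      ∃ M : ℝ, ∀ᵐ x, ‖uu P s x‖ ≤ M := by
  obtain ⟨δ0, hδ0, Cs, hA⟩ := hg.est r R hr hR
  set δ := min 1 (δ0 / (4 * (d + 1))) with hδd
  have hδ : 0 < δ := lt_min one_pos (by positivity)
  refine ⟨δ, hδ, fun y hy hyδ γ hγ hyp => ?_⟩
  have hy0 : y ≠ 0 := norm_pos_iff.1 hy
  obtain ⟨δ1, hδ1, Cs1, hu⟩ := hg.uest δ hδ
  obtain ⟨Cg, hCg⟩ := hg.gest s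
  refine ⟨max (Cs1 s) (2 * (γ * |Cs s|) + Cg), ?_⟩
  have hnull : volume ((Submodule.span ℝ {y} : Submodule ℝ (EE d)) : Set (EE d)) = 0 := by
    refine Measure.addHaar_submodule volume _ fun h => ?_
    have h1 : Module.finrank ℝ (Submodule.span ℝ {y}) ≤ 1 := by
      rw [finrank_span_singleton hy0]
    rw [h, finrank_top, finrank_euclideanSpace_fin] at h1
    omega
  have hae : ∀ᵐ x : EE d, x ∉ (Submodule.span ℝ {y} : Submodule ℝ (EE d)) :=
    measure_eq_zero_iff_ae_notMem.1 hnull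
  filter_upwards [hae] with x hx
  by_cases hxδ : δ ≤ ‖x‖
  · exact (hu.bound s x hxδ).trans (le_max_left _ _)
  refine le_trans ?_ (le_max_right _ _)
  push Not at hxδ
  have hne : ∀ τ : ℝ, y + τ • (x - y) ≠ 0 := by
    intro τ h
    by_cases h0 : τ = 0
    · simp [h0, hy0] at h
    · apply hx
      rw [Submodule.mem_span_singleton]
      refine ⟨τ⁻¹ * (τ - 1), ?_⟩
      have h2 : τ • x = (τ - 1) • y := by
        rw [sub_smul, one_smul]
        rw [smul_sub] at h
        have h3 : y + (τ • x - τ • y) - (y - τ • y) = 0 - (y - τ • y) := by rw [h]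
        have h4 : y + (τ • x - τ • y) - (y - τ • y) = τ • x := by abel
        rw [h4] at h3
        rw [h3]; abel
      rw [mul_smul, ← h2, smul_smul, inv_mul_cancel₀ h0, one_smul]
  have hW : ‖uu P s x + g s x‖ ≤ 2 * (γ * |Cs s|) := by
    have := line_bound (J := fun s x => uu P s x + g s x) y (x - y) s
      (fun τ _ c s => hg.jet.smul c s _ (hne τ)) (fun τ _ => ?_) (γ * |Cs s|) (fun k => ?_)
    · simpa using this
    · obtain ⟨δ2, hδ2, Cs2, h2⟩ := hg.est ‖y + τ • (x - y)‖ ‖y + τ • (x - y)‖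
        (norm_pos_iff.2 (hne τ)) (norm_nonneg _)
      exact ⟨δ2, hδ2, (h2 s _ ⟨le_rfl, le_rfl⟩).1⟩
    · have hq : d * ‖x - y‖ / δ0 ≤ 1 / 2 := by
        have h3 : ‖x - y‖ ≤ 2 * δ := (norm_sub_le _ _).trans (by linarith)
        have h4 : δ ≤ δ0 / (4 * (d + 1)) := min_le_right _ _
        rw [le_div_iff₀ (by positivity)] at h4
        rw [div_le_iff₀ hδ0]
        have : (d : ℝ) * ‖x - y‖ ≤ d * (2 * δ) := by gcongr
        nlinarith
      have h2 := hyp (s * ell (x - y) ^ k) (k.factorial * ((1 / 2) ^ k * |Cs s|)) (fun z hz1 hz2 => by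
        have h5 := (hA s z ⟨hz1, hz2⟩).2 (x - y) k
        rw [norm_div, Complex.norm_natCast, div_le_iff₀ (by positivity)] at h5
        refine h5.trans ?_
        rw [mul_comm]
        refine mul_le_mul_of_nonneg_left ?_ (by positivity)
        refine mul_le_mul ?_ (le_abs_self _) (hA.nonneg s z ⟨hz1, hz2⟩) (by positivity)
        exact pow_le_pow_left₀ (by positivity) hq k)
      rw [norm_div, Complex.norm_natCast, div_le_iff₀ (by positivity)]
      refine h2.trans (le_of_eq ?_)
      ring
  have hx1 : ‖x‖ ≤ 1 := hxδ.le.trans (min_le_left _ _)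
  have h5 := norm_sub_le (uu P s x + g s x) (g s x)
  rw [add_sub_cancel_right] at h5
  have := hCg x hx1
  linarith

end EK

namespace EK
open MvPolynomial MeasureTheory

lemma totalDegree_PB {d : ℕ} (P : MvPolynomial (Fin d) ℂ) : (PB P).totalDegree ≤ P.totalDegree := by
  rw [PB, aeval_def, eval₂_eq']
  refine totalDegree_finsetSum_le fun α hα => ?_
  have hα' : α ∈ P.support := support_map_subset _ _ hα
  have h1 : (∑ i, α i) ≤ P.totalDegree := by
    have := le_totalDegree hα'
    rwa [Finsupp.sum_fintype _ _ (by simp)] at this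
  refine (totalDegree_mul _ _).trans ?_
  have h2 : (algebraMap ℂ (MvPolynomial (Fin d) ℂ) (coeff α (map (starRingEnd ℂ) P))).totalDegree = 0 :=
    totalDegree_C _
  rw [h2, zero_add]
  refine (totalDegree_finsetProd _ _).trans (le_trans (Finset.sum_le_sum fun i _ => ?_) h1)
  refine (totalDegree_pow _ _).trans ?_
  have h3 : (-X i : MvPolynomial (Fin d) ℂ).totalDegree = 1 := by rw [totalDegree_neg, totalDegree_X]
  rw [h3, mul_one]

lemma int_exp_scale {d : ℕ} (a : ℝ) (ha : 0 < a) :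
    ∫ ξ : EE d, Real.exp (-(a * ‖ξ‖)) = a⁻¹ ^ d * ∫ ξ : EE d, Real.exp (-‖ξ‖) := by
  have h := Measure.integral_comp_smul (volume : Measure (EE d)) (fun ξ => Real.exp (-‖ξ‖)) a
  rw [finrank_euclideanSpace_fin] at h
  simp only [norm_smul, Real.norm_of_nonneg ha.le] at h
  rw [h, abs_of_nonneg (by positivity), smul_eq_mul, inv_pow]

def rho (m : ℕ) (t : ℝ) : ℝ := t ^ (1 / (2 * m : ℝ))

lemma hk_est {d : ℕ} (hd : 2 ≤ d) (P : MvPolynomial (Fin d) ℂ) (hell : IsElliptic P)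
    (hm : 1 ≤ P.totalDegree) (s : MvPolynomial (Fin d) ℂ) (n : ℕ) (hs : s.totalDegree ≤ n) :
    ∃ C : ℝ, 0 < C ∧ ∀ t : ℝ, 0 < t → t ≤ 1 → ∀ x : EE d, ‖hk P t s x‖ ≤
      C * ((rho P.totalDegree t)⁻¹ ^ (n + d) * Real.exp (-((rho P.totalDegree t)⁻¹ * ‖x‖))) := by
  obtain ⟨C, hC, hB⟩ := B3 hd P hell hm s n hs
  set I := ∫ ξ : EE d, Real.exp (-‖ξ‖) with hI
  have hI0 : 0 ≤ I := integral_nonneg fun ξ => (Real.exp_pos _).le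
  refine ⟨C * (1 + I), by positivity, fun t ht ht1 x => ?_⟩
  set ρ := rho P.totalDegree t with hρ
  have hmr : (0 : ℝ) < 2 * P.totalDegree := by
    have : (1 : ℝ) ≤ P.totalDegree := by exact_mod_cast hm
    linarith
  have hρ0 : 0 < ρ := Real.rpow_pos_of_pos ht _
  have hρ1 : ρ ≤ 1 := Real.rpow_le_one ht.le ht1 (by positivity)
  have hρt : ρ ^ (2 * P.totalDegree) = t := by
    rw [hρ, rho, ← Real.rpow_natCast, ← Real.rpow_mul ht.le]
    push_cast
    rw [one_div, inv_mul_cancel₀ hmr.ne', Real.rpow_one]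
  rw [← hk_shift hd P hell hm s t ht (by linarith) (-(ρ⁻¹ / ‖x‖) • x) x]
  have h1 : ‖∫ ξ, AA P t s (zz ξ (-(ρ⁻¹ / ‖x‖) • x)) x‖ ≤
      ∫ ξ : EE d, C * ρ⁻¹ ^ n * Real.exp (-(ρ⁻¹ * ‖x‖)) * Real.exp (-(ρ * ‖ξ‖)) := by
    refine norm_integral_le_of_norm_le ((integrable_exp_norm ρ hρ0).const_mul _)
      (Filter.Eventually.of_forall fun ξ => ?_)
    rw [norm_AA]
    refine (hB t ρ ht hρ0 hρ1 hρt ξ x _ rfl).trans (le_of_eq ?_)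
    ring
  refine h1.trans ?_
  rw [integral_const_mul, int_exp_scale ρ hρ0, ← hI, pow_add]
  have h2 : 0 < C * ρ⁻¹ ^ n * Real.exp (-(ρ⁻¹ * ‖x‖)) * ρ⁻¹ ^ d := by positivity
  nlinarith

lemma hk_meas {d : ℕ} (P s : MvPolynomial (Fin d) ℂ) :
    StronglyMeasurable fun p : ℝ × EE d => hk P p.1 s p.2 := by
  unfold hk
  have h : Continuous fun p : (ℝ × EE d) × EE d => AA P p.1.1 s (zz p.2 0) p.1.2 :=
    cont_AA P s (by fun_prop) (cont_zz (by fun_prop) continuous_const) (by fun_prop)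
  exact StronglyMeasurable.integral_prod_right (f := fun p : ℝ × EE d => fun ξ : EE d =>
    AA P p.1 s (zz ξ 0) p.2) h.stronglyMeasurable

lemma hk_int {d : ℕ} (hd : 2 ≤ d) (P : MvPolynomial (Fin d) ℂ) (hell : IsElliptic P)
    (hm : 1 ≤ P.totalDegree) (s : MvPolynomial (Fin d) ℂ) (hs : s.totalDegree ≤ 2 * P.totalDegree - 1) :
    Integrable (fun p : ℝ × EE d => hk P p.1 s p.2) (mu1 d 1) := by
  obtain ⟨C, hC, h⟩ := hk_est hd P hell hm s _ hs
  set n := 2 * P.totalDegree - 1 with hn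
  have hmr : (0 : ℝ) < 2 * P.totalDegree := by
    have : (1 : ℝ) ≤ P.totalDegree := by exact_mod_cast hm
    linarith
  have hmeas : Measurable (rho P.totalDegree) := by unfold rho; fun_prop
  have hD : Integrable (fun p : ℝ × EE d => ((rho P.totalDegree p.1)⁻¹ ^ (n + d) *
      Real.exp (-((rho P.totalDegree p.1)⁻¹ * ‖p.2‖)))) (mu1 d 1) := by
    have hms : Measurable (fun p : ℝ × EE d => ((rho P.totalDegree p.1)⁻¹ ^ (n + d) *
      Real.exp (-((rho P.totalDegree p.1)⁻¹ * ‖p.2‖)))) := by fun_prop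
    rw [mu1, integrable_prod_iff hms.aestronglyMeasurable]
    constructor
    · filter_upwards [ae_restrict_mem measurableSet_Ioc] with t ht
      have hρ0 : 0 < rho P.totalDegree t := Real.rpow_pos_of_pos ht.1 _
      exact (integrable_exp_norm _ (inv_pos.2 hρ0)).const_mul _
    · have hi : IntegrableOn (fun t : ℝ => t ^ (-(n / (2 * P.totalDegree) : ℝ)) *
          ∫ ξ : EE d, Real.exp (-‖ξ‖)) (Set.Ioc 0 1) := by
        refine Integrable.mul_const ?_ _
        have := intervalIntegral.intervalIntegrable_rpow' (a := 0) (b := 1)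
          (r := (-(n / (2 * P.totalDegree) : ℝ))) (by
            have : (n : ℝ) < 2 * P.totalDegree := by
              have : n < 2 * P.totalDegree := by omega
              exact_mod_cast this
            rw [neg_lt_neg_iff, div_lt_one hmr]
            exact this)
        exact (intervalIntegrable_iff_integrableOn_Ioc_of_le zero_le_one).1 this
      refine hi.congr ?_
      filter_upwards [ae_restrict_mem measurableSet_Ioc] with t ht
      have hρ0 : 0 < rho P.totalDegree t := Real.rpow_pos_of_pos ht.1 _
      have e : ∀ x : EE d, ‖(rho P.totalDegree t)⁻¹ ^ (n + d) *
          Real.exp (-((rho P.totalDegree t)⁻¹ * ‖x‖))‖ = (rho P.totalDegree t)⁻¹ ^ (n + d) *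
          Real.exp (-((rho P.totalDegree t)⁻¹ * ‖x‖)) := fun x =>
        Real.norm_of_nonneg (by positivity)
      simp only [e]
      rw [integral_const_mul, int_exp_scale _ (inv_pos.2 hρ0), inv_inv, ← mul_assoc]
      congr 1
      rw [pow_add, mul_assoc, ← mul_pow, inv_mul_cancel₀ hρ0.ne', one_pow, mul_one, rho,
        ← Real.rpow_neg ht.1.le, ← Real.rpow_natCast, ← Real.rpow_mul ht.1.le]
      congr 1
      ring
  refine (hD.const_mul C).mono' (hk_meas P s).aestronglyMeasurable ?_
  filter_upwards [mu1_ae (d := d) 1] with p hp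
  exact h p.1 hp.1 hp.2 p.2

end EK

namespace EK
open MvPolynomial MeasureTheory

lemma zz_zero {d : ℕ} (ξ : EE d) : zz ξ 0 = (2 * Real.pi * Complex.I : ℂ) • re2 ξ := by
  have : re2 (0 : EE d) = 0 := by funext i; simp [re2]
  rw [zz, this, add_zero]

lemma PB_real {d : ℕ} (P : MvPolynomial (Fin d) ℂ) (ξ : EE d) :
    eval (zz ξ 0) (PB P) = (starRingEnd ℂ) (eval (zz ξ 0) P) := by
  rw [PB_zz, zz_zero]
  have : re2 (0 : EE d) = 0 := by funext i; simp [re2]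
  rw [this, neg_zero, add_zero]

lemma qq_real {d : ℕ} (P : MvPolynomial (Fin d) ℂ) (ξ : EE d) :
    eval (zz ξ 0) (qq P) = ((‖eval (zz ξ 0) P‖ ^ 2 : ℝ) : ℂ) := by
  rw [qq, eval_mul, PB_real, Complex.mul_conj, Complex.normSq_eq_norm_sq]

def Eq1 {d : ℕ} (P : MvPolynomial (Fin d) ℂ) (ξ : EE d) : ℂ :=
  ∫ t in Set.Ioc (0 : ℝ) 1, Complex.exp (-(t : ℂ) * eval (zz ξ 0) (qq P))

lemma T1 {d : ℕ} (hd : 2 ≤ d) (P : MvPolynomial (Fin d) ℂ) (hell : IsElliptic P)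
    (hm : 1 ≤ P.totalDegree) (s0 : MvPolynomial (Fin d) ℂ)
    (hs : (PB P * s0).totalDegree ≤ 2 * P.totalDegree - 1) (Φ : EE d → ℂ) (hΦc : Continuous Φ)
    (hΦ : Integrable Φ) (B : ℝ) (hB : ∀ x, ‖Φ x‖ ≤ B) (β : EE d → ℂ) (hβc : Continuous β)
    (hβs : HasCompactSupport β) (hβ : ∀ ξ, ∫ x, Complex.exp (dotp (zz ξ 0) x) * Φ x = β ξ)
    (M : ℝ) (hM : ∀ᵐ x, ‖uu P s0 x‖ ≤ M) :
    ‖∫ ξ, eval (zz ξ 0) (PB P * s0) * β ξ * Eq1 P ξ‖ ≤ M * ∫ x, ‖Φ x‖ := by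
  set s := PB P * s0 with hsd
  have hF := hk_int hd P hell hm s hs
  have hFΦ : Integrable (fun p : ℝ × EE d => hk P p.1 s p.2 * Φ p.2) (mu1 d 1) :=
    hF.mul_bdd (c := B) (hΦc.comp continuous_snd).aestronglyMeasurable
      (Filter.Eventually.of_forall fun p => hB p.2)
  have h1 : ∀ t ∈ Set.Ioc (0 : ℝ) 1, ∫ x, hk P t s x * Φ x =
      ∫ ξ, eval (zz ξ 0) s * β ξ * Complex.exp (-(t : ℂ) * eval (zz ξ 0) (qq P)) := by
    intro t ht
    have hA := AA_integrable hd P hell hm s t ht.1 (by linarith [ht.2]) 0 0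
    have hprod : Integrable (fun p : EE d × EE d => AA P t s (zz p.2 0) p.1 * Φ p.1)
        (volume.prod volume) := by
      refine (hΦ.norm.mul_prod hA.norm).mono' ?_ (Filter.Eventually.of_forall fun p => ?_)
      · have h := cont_AA P s (f := fun _ : EE d × EE d => t) continuous_const
          (cont_zz (f := fun p : EE d × EE d => p.2) (g := fun _ => 0) continuous_snd continuous_const)
          (h := fun p : EE d × EE d => p.1) continuous_fst
        exact (h.mul (hΦc.comp continuous_fst)).aestronglyMeasurable
      · rw [norm_mul, norm_AA, norm_AA, dotp_zz_re, dotp_zz_re, mul_comm]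
        simp
    have e1 : ∀ x, hk P t s x * Φ x = ∫ ξ, AA P t s (zz ξ 0) x * Φ x := fun x => by
      rw [hk, integral_mul_const]
    simp only [e1]
    rw [integral_integral_swap hprod]
    congr 1
    funext ξ
    rw [← hβ, ← integral_const_mul, ← integral_mul_const]
    congr 1
    funext x
    rw [AA, Complex.exp_add]; ring
  have h2 : ∫ x, uu P s0 x * Φ x = ∫ ξ, eval (zz ξ 0) s * β ξ * Eq1 P ξ := by
    have e1 : ∀ x, uu P s0 x * Φ x = ∫ t in Set.Ioc (0 : ℝ) 1, hk P t s x * Φ x := fun x => by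
      rw [uu, integral_mul_const]
    simp only [e1]
    rw [← integral_integral_swap hFΦ, setIntegral_congr_fun measurableSet_Ioc h1]
    have hc1 : Continuous fun ξ : EE d => zz ξ 0 := cont_zz continuous_id continuous_const
    have hc2 : Continuous fun ξ : EE d => eval (zz ξ 0) s * β ξ :=
      ((MvPolynomial.continuous_eval s).comp hc1).mul hβc
    have hi : Integrable fun ξ : EE d => eval (zz ξ 0) s * β ξ :=
      hc2.integrable_of_hasCompactSupport hβs.mul_left
    have hc3 : Continuous fun ξ : EE d => eval (zz ξ 0) (qq P) :=
      (MvPolynomial.continuous_eval (qq P)).comp hc1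
    have hi2 : Integrable (fun p : ℝ × EE d => eval (zz p.2 0) s * β p.2 *
        Complex.exp (-(p.1 : ℂ) * eval (zz p.2 0) (qq P)))
        ((volume.restrict (Set.Ioc (0 : ℝ) 1)).prod volume) := by
      have h3 := hi.comp_snd (volume.restrict (Set.Ioc (0 : ℝ) 1))
      refine h3.norm.mono' ?_ ?_
      · have h4 : Continuous fun p : ℝ × EE d => eval (zz p.2 0) s * β p.2 := hc2.comp continuous_snd
        have h5 : Continuous fun p : ℝ × EE d => eval (zz p.2 0) (qq P) := hc3.comp continuous_snd
        have h6 : Continuous fun p : ℝ × EE d => -(p.1 : ℂ) := by fun_prop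
        exact (h4.mul (h6.mul h5).cexp).aestronglyMeasurable
      · filter_upwards [mu1_ae (d := d) 1] with p hp
        rw [norm_mul]
        refine mul_le_of_le_one_right (norm_nonneg _) ?_
        rw [Complex.norm_exp, Real.exp_le_one_iff, qq_real, ← Complex.ofReal_neg, ← Complex.ofReal_mul,
          Complex.ofReal_re]
        have := hp.1
        have : 0 ≤ p.1 * ‖eval (zz p.2 0) P‖ ^ 2 := by positivity
        linarith
    rw [integral_integral_swap hi2]
    congr 1
    funext ξ
    rw [integral_const_mul, Eq1]
  rw [← h2, ← integral_const_mul]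
  refine norm_integral_le_of_norm_le (hΦ.norm.const_mul M) ?_
  filter_upwards [hM] with x hx
  rw [norm_mul]
  gcongr

lemma Eq1_mul {d : ℕ} (P : MvPolynomial (Fin d) ℂ) (ξ : EE d) :
    Eq1 P ξ * ((‖eval (zz ξ 0) P‖ ^ 2 : ℝ) : ℂ) =
      ((1 - Real.exp (-‖eval (zz ξ 0) P‖ ^ 2) : ℝ) : ℂ) := by
  rw [Eq1, qq_real]
  set a := ‖eval (zz ξ 0) P‖ ^ 2 with ha
  have e : ∀ t : ℝ, Complex.exp (-(t : ℂ) * (a : ℂ)) = ((Real.exp (-t * a) : ℝ) : ℂ) := by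
    intro t; push_cast; rfl
  simp only [e]
  rw [integral_complex_ofReal, ← Complex.ofReal_mul]
  congr 1
  rw [← intervalIntegral.integral_of_le zero_le_one]
  have h := intervalIntegral.integral_eq_sub_of_hasDerivAt (a := 0) (b := 1)
    (f := fun t : ℝ => - Real.exp (-t * a)) (f' := fun t => Real.exp (-t * a) * a) (fun t _ => ?_)
    (Continuous.intervalIntegrable (by fun_prop) _ _)
  · rw [intervalIntegral.integral_mul_const] at h
    rw [h]
    simp
    ring
  · have h1 : HasDerivAt (fun t : ℝ => -t * a) (-a) t := by
      simpa using ((hasDerivAt_id t).neg.mul_const a)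
    refine (h1.exp.neg).congr_deriv ?_
    ring

end EK

namespace EK
open MvPolynomial MeasureTheory

lemma dotp_inner {d : ℕ} (ξ x : EE d) :
    dotp (zz ξ 0) x = ((2 * Real.pi * inner ℝ x ξ : ℝ) : ℂ) * Complex.I := by
  rw [zz_zero, dotp, PiLp.inner_apply]
  push_cast
  rw [Finset.mul_sum, Finset.sum_mul]
  refine Finset.sum_congr rfl fun i _ => ?_
  simp [re2]
  ring

lemma contDiff_evalzz {d : ℕ} (Q : MvPolynomial (Fin d) ℂ) :
    ContDiff ℝ (⊤ : ℕ∞) (fun η : EE d => eval (zz η 0) Q) := by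
  induction Q using MvPolynomial.induction_on with
  | C a => simpa using contDiff_const
  | add p q hp hq => simpa using hp.add hq
  | mul_X p i hp =>
    simp only [eval_mul, eval_X]
    refine hp.mul ?_
    have : (fun η : EE d => zz η 0 i) = fun η => (2 * Real.pi * Complex.I : ℂ) * cproj i η := by
      funext η; rw [zz_zero]; rfl
    rw [this]
    exact contDiff_const.mul (cproj i).contDiff

lemma exists_Phi {d : ℕ} (b : EE d → ℂ) (hb : ContDiff ℝ (⊤ : ℕ∞) b) (hbs : HasCompactSupport b) :
    ∃ Φ : EE d → ℂ, Continuous Φ ∧ Integrable Φ ∧ (∃ B, ∀ x, ‖Φ x‖ ≤ B) ∧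
      ∀ ξ, ∫ x, Complex.exp (dotp (zz ξ 0) x) * Φ x = b ξ := by
  let S : SchwartzMap (EE d) ℂ := hbs.toSchwartzMap hb
  let F : SchwartzMap (EE d) ℂ := FourierTransform.fourier S
  refine ⟨F, F.continuous, F.integrable, ?_, fun ξ => ?_⟩
  · obtain ⟨B, hB⟩ := F.decay 0 0
    exact ⟨B, fun x => by simpa using hB.2 x⟩
  · have h1 : FourierTransformInv.fourierInv F = S := FourierTransform.fourierInv_fourier_eq S
    have h2 : (FourierTransformInv.fourierInv F) ξ = b ξ := by rw [h1]; rfl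
    rw [← h2, SchwartzMap.fourierInv_coe, Real.fourierInv_eq']
    congr 1
    funext x
    rw [dotp_inner, smul_eq_mul]

lemma zz_smul {d : ℕ} (N : ℝ) (η : EE d) : zz (N • η) 0 = (N : ℂ) • zz η 0 := by
  rw [zz_zero, zz_zero]
  funext i
  simp [re2]; ring

lemma T2 {d : ℕ} (hd : 2 ≤ d) (P : MvPolynomial (Fin d) ℂ) (hell : IsElliptic P)
    (hm : 1 ≤ P.totalDegree) (s0 : MvPolynomial (Fin d) ℂ)
    (hs : (PB P * s0).totalDegree ≤ 2 * P.totalDegree - 1) (Φ : EE d → ℂ) (hΦc : Continuous Φ)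
    (hΦ : Integrable Φ) (B : ℝ) (hB : ∀ x, ‖Φ x‖ ≤ B) (β : EE d → ℂ) (hβc : Continuous β)
    (hβs : HasCompactSupport β) (hβ : ∀ ξ, ∫ x, Complex.exp (dotp (zz ξ 0) x) * Φ x = β ξ)
    (M : ℝ) (hM : ∀ᵐ x, ‖uu P s0 x‖ ≤ M) (N : ℝ) (hN : 0 < N) :
    N ^ d * ‖∫ η, eval (zz (N • η) 0) (PB P * s0) * β η * Eq1 P (N • η)‖ ≤ M * ∫ x, ‖Φ x‖ := by
  have hfr : Module.finrank ℝ (EE d) = d := finrank_euclideanSpace_fin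
  have hNd : (0 : ℝ) < N ^ d := by positivity
  have h := T1 hd P hell hm s0 hs (fun x => ((N ^ d : ℝ) : ℂ) * Φ (N • x))
    (by fun_prop) ((hΦ.comp_smul hN.ne').const_mul _) (N ^ d * B)
    (fun x => by
      rw [norm_mul, Complex.norm_real, Real.norm_of_nonneg hNd.le]
      exact mul_le_mul_of_nonneg_left (hB _) hNd.le)
    (fun ξ => β (N⁻¹ • ξ)) (by fun_prop)
    (hβs.comp_homeomorph (Homeomorph.smulOfNeZero N⁻¹ (inv_ne_zero hN.ne')))
    (fun ξ => by
      rw [← hβ]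
      have := Measure.integral_comp_smul_of_nonneg (volume : Measure (EE d))
        (fun x => Complex.exp (dotp (zz (N⁻¹ • ξ) 0) x) * Φ x) N (hR := hN.le)
      rw [hfr, eq_inv_smul_iff₀ hNd.ne', ← integral_smul] at this
      rw [← this]
      congr 1
      funext x
      rw [dotp_inner, dotp_inner, inner_smul_left, inner_smul_right, Complex.real_smul]
      have : (starRingEnd ℝ) N * (N⁻¹ * inner ℝ x ξ) = inner ℝ x ξ := by
        simp; field_simp
      rw [this]; ring)
    M hM
  have e1 : ∫ x : EE d, ‖((N ^ d : ℝ) : ℂ) * Φ (N • x)‖ = ∫ x, ‖Φ x‖ := by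
    have := Measure.integral_comp_smul_of_nonneg (volume : Measure (EE d))
        (fun x => ‖Φ x‖) N (hR := hN.le)
    rw [hfr, eq_inv_smul_iff₀ hNd.ne', ← integral_smul] at this
    rw [← this]
    congr 1
    funext x
    rw [norm_mul, Complex.norm_real, Real.norm_of_nonneg hNd.le, smul_eq_mul]
  rw [e1] at h
  refine le_trans (le_of_eq ?_) h
  have := Measure.integral_comp_smul_of_nonneg (volume : Measure (EE d))
    (fun ξ => eval (zz ξ 0) (PB P * s0) * β (N⁻¹ • ξ) * Eq1 P ξ) N (hR := hN.le)
  rw [hfr, eq_inv_smul_iff₀ hNd.ne'] at this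
  rw [← this, norm_smul, Real.norm_of_nonneg hNd.le]
  congr 3
  funext x
  rw [inv_smul_smul₀ hN.ne']

lemma cont_Eq1 {d : ℕ} (P : MvPolynomial (Fin d) ℂ) : Continuous (Eq1 P) := by
  have hc1 : Continuous fun ξ : EE d => zz ξ 0 := cont_zz continuous_id continuous_const
  have hc3 : Continuous fun ξ : EE d => eval (zz ξ 0) (qq P) :=
      (MvPolynomial.continuous_eval (qq P)).comp hc1
  unfold Eq1
  refine continuous_of_dominated (bound := fun _ => 1) ?_ ?_ ?_ ?_
  · intro ξ
    have : Continuous fun t : ℝ => Complex.exp (-(t : ℂ) * eval (zz ξ 0) (qq P)) := by fun_prop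
    exact this.aestronglyMeasurable
  · intro ξ
    refine (ae_restrict_mem measurableSet_Ioc).mono fun t ht => ?_
    rw [qq_real, Complex.norm_exp]
    refine Real.exp_le_one_iff.2 ?_
    rw [← Complex.ofReal_neg, ← Complex.ofReal_mul, Complex.ofReal_re]
    have := ht.1.le
    have h2 : 0 ≤ t * ‖eval (zz ξ 0) P‖ ^ 2 := by positivity
    linarith
  · simp
  · refine Filter.Eventually.of_forall fun t => ?_
    fun_prop

lemma cplx_re (T Q E : ℂ) (h1 : ‖Q - T‖ ≤ ‖T‖ / 2) (h2 : 2 ≤ ‖T‖)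
    (hE : E * ((‖Q‖ ^ 2 : ℝ) : ℂ) = ((1 - Real.exp (-‖Q‖ ^ 2) : ℝ) : ℂ)) :
    1 / 9 ≤ (T * (starRingEnd ℂ) Q * E).re := by
  have hQ1 : 1 ≤ ‖Q‖ := by
    have := norm_sub_norm_le T Q
    rw [norm_sub_rev] at this
    linarith
  have hQ2 : ‖Q‖ ≤ 3 / 2 * ‖T‖ := by
    have := norm_sub_norm_le Q T
    linarith
  have hq : 1 ≤ ‖Q‖ ^ 2 := by nlinarith
  have hE2 : E = (((1 - Real.exp (-‖Q‖ ^ 2)) / ‖Q‖ ^ 2 : ℝ) : ℂ) := by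
    rw [Complex.ofReal_div, eq_div_iff, hE]
    exact_mod_cast (by positivity : ‖Q‖ ^ 2 ≠ 0)
  rw [hE2, Complex.re_mul_ofReal]
  have h3 : ‖T‖ ^ 2 / 2 ≤ (T * (starRingEnd ℂ) Q).re := by
    have e : T * (starRingEnd ℂ) Q = ((‖T‖ ^ 2 : ℝ) : ℂ) + T * (starRingEnd ℂ) (Q - T) := by
      rw [map_sub, mul_sub, Complex.mul_conj T, Complex.normSq_eq_norm_sq]; ring
    rw [e, Complex.add_re, Complex.ofReal_re]
    have h4 := Complex.abs_re_le_norm (T * (starRingEnd ℂ) (Q - T))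
    rw [norm_mul, RCLike.norm_conj] at h4
    have h5 : ‖T‖ * ‖Q - T‖ ≤ ‖T‖ * (‖T‖ / 2) := by gcongr
    have := neg_abs_le (T * (starRingEnd ℂ) (Q - T)).re
    nlinarith
  have h6 : Real.exp (-‖Q‖ ^ 2) ≤ 1 / 2 := by
    have : Real.exp (-‖Q‖ ^ 2) ≤ Real.exp (-1) := Real.exp_le_exp.2 (by linarith)
    have h7 := Real.exp_neg_one_lt_d9
    linarith
  rw [mul_div_assoc', le_div_iff₀ (by positivity)]
  have h8 : ‖Q‖ ^ 2 ≤ 9 / 4 * ‖T‖ ^ 2 := by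
    have : ‖Q‖ ^ 2 ≤ (3 / 2 * ‖T‖) ^ 2 := by gcongr
    linarith
  have h9 : ‖T‖ ^ 2 / 2 * (1 / 2) ≤ (T * (starRingEnd ℂ) Q).re * (1 - Real.exp (-‖Q‖ ^ 2)) := by
    refine mul_le_mul h3 (by linarith) (by norm_num) (le_trans (by positivity) h3)
  linarith

lemma pt_bound {d : ℕ} (hd : 2 ≤ d) (P : MvPolynomial (Fin d) ℂ) (hell : IsElliptic P)
    (hm : 1 ≤ P.totalDegree) : ∃ N0 : ℝ, 1 ≤ N0 ∧ ∀ N : ℝ, N0 ≤ N → ∀ η : EE d, 1 / 2 ≤ ‖η‖ →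
      ‖η‖ ≤ 3 / 2 → ‖eval (zz (N • η) 0) P - (N : ℂ) ^ P.totalDegree * eval (zz η 0) (pm P)‖ ≤
        ‖(N : ℂ) ^ P.totalDegree * eval (zz η 0) (pm P)‖ / 2 ∧
      2 ≤ ‖(N : ℂ) ^ P.totalDegree * eval (zz η 0) (pm P)‖ := by
  obtain ⟨C, hC, hdb⟩ := diff_bound P
  obtain ⟨c, hc, hel⟩ := elliptic_lower hd P hell
  obtain ⟨k, hk⟩ : ∃ k, P.totalDegree = k + 1 := ⟨P.totalDegree - 1, by omega⟩
  simp only [hk] at hdb hel ⊢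
  set c1 := c * (1 / 2) ^ (k + 1) with hc1
  have hc1p : 0 < c1 := by positivity
  refine ⟨max 1 (max (2 / c1) (2 * C * 11 ^ k / c1)), le_max_left _ _, fun N hN η h1 h2 => ?_⟩
  have hN1 : 1 ≤ N := (le_max_left _ _).trans hN
  have hN2 : 2 / c1 ≤ N := ((le_max_left _ _).trans (le_max_right _ _)).trans hN
  have hN3 : 2 * C * 11 ^ k / c1 ≤ N := ((le_max_right _ _).trans (le_max_right _ _)).trans hN
  rw [div_le_iff₀ hc1p] at hN2 hN3
  have hN0 : 0 < N := by linarith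
  have hp : c1 ≤ ‖eval (zz η 0) (pm P)‖ := by
    rw [zz_zero, pm_smul, norm_mul, norm_pow, norm_2pi, hk]
    have h3 := hel η
    have h4 : c1 ≤ c * ‖η‖ ^ (k + 1) := by rw [hc1]; gcongr
    have h5 : (1 : ℝ) ≤ (2 * Real.pi) ^ (k + 1) := one_le_pow₀ (by linarith [Real.pi_gt_three])
    nlinarith
  have hT : N ^ (k + 1) * c1 ≤ ‖(N : ℂ) ^ (k + 1) * eval (zz η 0) (pm P)‖ := by
    rw [norm_mul, norm_pow, Complex.norm_real, Real.norm_of_nonneg hN0.le]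
    gcongr
  have hNk : 1 ≤ N ^ k := one_le_pow₀ hN1
  constructor
  · have h3 := hdb ((N : ℂ) • zz η 0) 0
    rw [add_zero, pm_smul, hk, ← zz_smul, norm_zero, add_zero, mul_one, pow_succ (_ + 1 : ℝ) k, ← mul_assoc] at h3
    have h4 := le_of_mul_le_mul_right h3 (by positivity)
    refine h4.trans ?_
    have h5 : ‖zz (N • η) 0‖ + 1 ≤ 11 * N := by
      have := norm_zz_le (N • η) 0
      rw [norm_smul, Real.norm_of_nonneg hN0.le, norm_zero, add_zero] at this
      have h6 : N * ‖η‖ ≤ N * (3 / 2) := by gcongr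
      have := Real.pi_lt_d2
      have h7 : 2 * Real.pi * (N * ‖η‖) ≤ 2 * 3.15 * (N * (3 / 2)) := by gcongr
      linarith
    calc C * (‖zz (N • η) 0‖ + 1) ^ k ≤ C * (11 * N) ^ k := by gcongr
      _ = (2 * C * 11 ^ k) * N ^ k / 2 := by rw [mul_pow]; ring
      _ ≤ (N * c1) * N ^ k / 2 := by gcongr
      _ = N ^ (k + 1) * c1 / 2 := by ring
      _ ≤ _ := by gcongr
  · refine le_trans ?_ hT
    calc 2 ≤ 1 * (N * c1) := by linarith
      _ ≤ N ^ k * (N * c1) := by gcongr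
      _ = _ := by ring
end EK

namespace EK
open MvPolynomial MeasureTheory

lemma uu_unbdd {d : ℕ} (hd : 2 ≤ d) (P : MvPolynomial (Fin d) ℂ) (hell : IsElliptic P)
    (hm : 1 ≤ P.totalDegree) : ∃ s0 : MvPolynomial (Fin d) ℂ,
      ¬ ∃ M : ℝ, ∀ᵐ x, ‖uu P s0 x‖ ≤ M := by
  set i0 : Fin d := ⟨0, by omega⟩ with hi0
  obtain ⟨k, hk⟩ : ∃ k, P.totalDegree = k + 1 := ⟨P.totalDegree - 1, by omega⟩
  set s0 : MvPolynomial (Fin d) ℂ := X i0 ^ k with hs0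
  refine ⟨s0, ?_⟩
  rintro ⟨M, hM⟩
  have hs : (PB P * s0).totalDegree ≤ 2 * P.totalDegree - 1 := by
    refine (totalDegree_mul _ _).trans ?_
    have h1 := totalDegree_PB P
    have h2 : s0.totalDegree = k := by rw [hs0, totalDegree_X_pow]
    omega
  let χ : ContDiffBump (EuclideanSpace.single i0 (1 : ℝ) : EE d) := ⟨1 / 4, 1 / 2, by norm_num, by norm_num⟩
  have hχs : ∀ η, χ η ≠ 0 → 1 / 2 ≤ ‖η‖ ∧ ‖η‖ ≤ 3 / 2 := by
    intro η h
    have h1 : η ∈ Function.support χ := h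
    rw [χ.support_eq, Metric.mem_ball, dist_eq_norm] at h1
    have h2 : ‖η - EuclideanSpace.single i0 (1 : ℝ)‖ < 1 / 2 := h1
    have h3 : ‖(EuclideanSpace.single i0 (1 : ℝ) : EE d)‖ = 1 := by simp
    have h4 := norm_sub_norm_le η (EuclideanSpace.single i0 (1 : ℝ))
    have h5 := norm_sub_norm_le (EuclideanSpace.single i0 (1 : ℝ)) η
    rw [norm_sub_rev] at h5
    constructor <;> linarith
  set A : EE d → ℂ := fun η => eval (zz η 0) s0 with hA
  set b : EE d → ℂ := fun η => ((χ η : ℝ) : ℂ) * eval (zz η 0) (PB s0 * pm P) with hb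
  have hχc : ContDiff ℝ (⊤ : ℕ∞) (fun η : EE d => ((χ η : ℝ) : ℂ)) :=
    Complex.ofRealCLM.contDiff.comp χ.contDiff
  have hbc : ContDiff ℝ (⊤ : ℕ∞) b := hχc.mul (contDiff_evalzz _)
  have hχcs : HasCompactSupport (fun η : EE d => ((χ η : ℝ) : ℂ)) :=
    χ.hasCompactSupport.comp_left (g := fun t : ℝ => (t : ℂ)) (by simp)
  have hbs : HasCompactSupport b := hχcs.mul_right
  obtain ⟨Φ, hΦc, hΦi, ⟨B, hB⟩, hΦ⟩ := exists_Phi b hbc hbs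
  obtain ⟨N0, hN0, hpt⟩ := pt_bound hd P hell hm
  have hAc : Continuous A := (contDiff_evalzz s0).continuous
  set I : ℝ := ∫ η, χ η * ‖A η‖ ^ 2 with hI
  have hIc : Continuous fun η => χ η * ‖A η‖ ^ 2 := χ.continuous.mul (hAc.norm.pow 2)
  have hIs : HasCompactSupport fun η => χ η * ‖A η‖ ^ 2 := χ.hasCompactSupport.mul_right
  have hIpos : 0 < I := by
    refine hIc.integral_pos_of_hasCompactSupport_nonneg_nonzero hIs
      (fun η => mul_nonneg χ.nonneg (by positivity)) (x := EuclideanSpace.single i0 (1 : ℝ)) ?_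
    have h1 : χ (EuclideanSpace.single i0 (1 : ℝ)) = 1 :=
      χ.one_of_mem_closedBall (by simp [χ])
    have h2 : A (EuclideanSpace.single i0 (1 : ℝ)) ≠ 0 := by
      simp [hA, hs0, zz_zero, re2, Real.pi_ne_zero]
    rw [h1, one_mul]
    positivity
  have key : ∀ N : ℝ, N0 ≤ N → N * (I / 9) ≤ M * ∫ x, ‖Φ x‖ := by
    intro N hN
    have hN1 : 1 ≤ N := hN0.trans hN
    have hNp : 0 < N := by linarith
    have h1 := T2 hd P hell hm s0 hs Φ hΦc hΦi B hB b hbc.continuous hbs hΦ M hM N hNp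
    set G : EE d → ℂ := fun η => eval (zz (N • η) 0) (PB P * s0) * b η * Eq1 P (N • η) with hG
    have hGc : Continuous G := by
      have e1 : Continuous fun η : EE d => eval (zz (N • η) 0) (PB P * s0) :=
        (contDiff_evalzz (PB P * s0)).continuous.comp (continuous_const_smul N)
      have e2 : Continuous fun η : EE d => Eq1 P (N • η) := (cont_Eq1 P).comp (continuous_const_smul N)
      exact (e1.mul hbc.continuous).mul e2
    have hGs : HasCompactSupport G := (hbs.mul_left).mul_right
    have hGi : Integrable G := hGc.integrable_of_hasCompactSupport hGs
    have hre : ∀ η, χ η * ‖A η‖ ^ 2 / 9 ≤ N * (G η).re := by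
      intro η
      by_cases h0 : χ η = 0
      · have : G η = 0 := by simp [hG, hb, h0]
        rw [this, h0]; simp
      obtain ⟨h2, h3⟩ := hχs η h0
      obtain ⟨h4, h5⟩ := hpt N hN η h2 h3
      have h6 := cplx_re _ _ _ h4 h5 (Eq1_mul P (N • η))
      set T := (N : ℂ) ^ P.totalDegree * eval (zz η 0) (pm P) with hT
      set Q := eval (zz (N • η) 0) P with hQ
      have e : (N : ℂ) * G η = ((χ η * ‖A η‖ ^ 2 : ℝ) : ℂ) * (T * (starRingEnd ℂ) Q * Eq1 P (N • η)) := by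
        have e1 : eval (zz (N • η) 0) s0 = (N : ℂ) ^ k * A η := by
          rw [zz_smul]; simp [hA, hs0, mul_pow]
        have e2 : ((‖A η‖ ^ 2 : ℝ) : ℂ) = A η * (starRingEnd ℂ) (A η) := by
          rw [Complex.mul_conj, Complex.normSq_eq_norm_sq]
        simp only [hG, hb, eval_mul]
        rw [PB_real, PB_real, e1, Complex.ofReal_mul, e2, hT, hk, pow_succ]
        ring
      have e3 : N * (G η).re = ((N : ℂ) * G η).re := by rw [Complex.re_ofReal_mul]
      rw [e3, e, Complex.re_ofReal_mul]
      have h7 : 0 ≤ χ η * ‖A η‖ ^ 2 := mul_nonneg χ.nonneg (by positivity)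
      have := mul_le_mul_of_nonneg_left h6 h7
      linarith
    have h8 : I / 9 ≤ N * ‖∫ η, G η‖ := by
      calc I / 9 = ∫ η, χ η * ‖A η‖ ^ 2 / 9 := by rw [integral_div]
        _ ≤ ∫ η, N * (G η).re := by
          refine integral_mono ((hIc.integrable_of_hasCompactSupport hIs).div_const 9)
            (hGi.re.const_mul N) hre
        _ = N * (∫ η, G η).re := by
          rw [integral_const_mul]
          congr 1
          exact integral_re hGi
        _ ≤ _ := by gcongr; exact Complex.re_le_norm _
    refine le_trans ?_ h1
    calc N * (I / 9) ≤ N * (N * ‖∫ η, G η‖) := by gcongr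
      _ = N ^ 2 * ‖∫ η, G η‖ := by ring
      _ ≤ N ^ d * ‖∫ η, G η‖ := by gcongr
  obtain ⟨N, hN⟩ := exists_nat_gt (max N0 ((M * ∫ x, ‖Φ x‖) / (I / 9)))
  have h1 := key N ((le_max_left _ _).trans hN.le)
  have h2 := (le_max_right _ _).trans_lt hN
  rw [div_lt_iff₀ (by positivity)] at h2
  linarith

/-- Points close to the boundary are not controlled by compact sets. -/
lemma bdry {d : ℕ} (hd : 2 ≤ d) (P : MvPolynomial (Fin d) ℂ) (hell : IsElliptic P)
    (hm : 1 ≤ P.totalDegree) (r R : ℝ) (hr : 0 < r) (hR : 0 ≤ R) :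
    ∃ δ > 0, ∀ U : Set (EE d), IsOpen U → ∀ p ∉ U, ∀ y ∈ U, ‖y - p‖ < δ → ∀ γ : ℝ, 0 ≤ γ →
      ∃ f, MemCP P U f ∧ ∃ M, (∀ x ∈ U, r ≤ ‖x - p‖ → ‖x - p‖ ≤ R → ‖f x‖ ≤ M) ∧ γ * M < ‖f y‖ := by
  obtain ⟨g, hg⟩ := exists_good hd P hell hm
  obtain ⟨s0, hs0⟩ := uu_unbdd hd P hell hm
  obtain ⟨δ, hδ, h⟩ := uu_bdd hd P hg s0 r R hr hR
  refine ⟨δ, hδ, fun U hU p hp y hy hyδ γ hγ => ?_⟩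
  by_contra hcon
  refine hs0 (h (y - p) ?_ hyδ γ hγ fun s' M hM => ?_)
  · rw [norm_pos_iff, sub_ne_zero]
    rintro rfl
    exact hp hy
  · by_contra hlt
    push Not at hlt
    have hsub : ∀ x ∈ U, x - p ∈ ({0}ᶜ : Set (EE d)) := by
      intro x hx h0
      rw [Set.mem_singleton_iff, sub_eq_zero] at h0
      exact hp (h0 ▸ hx)
    have hj := hg.jet.translate p hsub
    exact hcon ⟨_, hj.memCP hU P s' (fun x hx => hg.ker s' _ (hsub x hx)), M,
      fun x _ h1 h2 => hM _ h1 h2, hlt⟩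
end EK

namespace EK
open MvPolynomial MeasureTheory

def LD (q : Polynomial ℂ) (n : ℕ) (c : ℂ) : Prop := q.natDegree ≤ n ∧ q.coeff n = c

lemma LD.mul {p q : Polynomial ℂ} {n k : ℕ} {a b : ℂ} (hp : LD p n a) (hq : LD q k b) :
    LD (p * q) (n + k) (a * b) :=
  ⟨Polynomial.natDegree_mul_le_of_le hp.1 hq.1, by
    rw [Polynomial.coeff_mul_add_eq_of_natDegree_le hp.1 hq.1, hp.2, hq.2]⟩

lemma LD.lin (a b : ℂ) : LD (Polynomial.C a + Polynomial.C b * Polynomial.X) 1 b := by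
  constructor
  · compute_degree
  · simp

lemma LD.one : LD 1 0 1 := by simp [LD]

lemma LD.pow {p : Polynomial ℂ} {n : ℕ} {a : ℂ} (hp : LD p n a) (k : ℕ) :
    LD (p ^ k) (k * n) (a ^ k) := by
  induction k with
  | zero => simpa using LD.one
  | succ k ih => simpa [pow_succ, add_mul] using ih.mul hp

lemma LD.prod {d : ℕ} (a θ : Fin d → ℂ) (α : Fin d →₀ ℕ) (S : Finset (Fin d)) :
    LD (∏ i ∈ S, (Polynomial.C (a i) + Polynomial.C (θ i) * Polynomial.X) ^ α i)
      (∑ i ∈ S, α i) (∏ i ∈ S, θ i ^ α i) := by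
  classical
  induction S using Finset.induction_on with
  | empty => simpa using LD.one
  | insert j S hj ih =>
    simp only [Finset.prod_insert hj, Finset.sum_insert hj]
    have := ((LD.lin (a j) (θ j)).pow (α j)).mul ih
    simpa using this

lemma pm_eval {d : ℕ} (P : MvPolynomial (Fin d) ℂ) (θ : Fin d → ℂ) :
    eval θ (pm P) = ∑ α ∈ P.support, P.coeff α *
      (if α.degree = P.totalDegree then ∏ i, θ i ^ α i else 0) := by
  rw [pm, homogeneousComponent_apply, map_sum, Finset.sum_filter]
  refine Finset.sum_congr rfl fun α _ => ?_
  split_ifs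
  · rw [eval_monomial, ← eval_monomial_prod, eval_monomial, one_mul]
  · simp

lemma lineP {d : ℕ} (P : MvPolynomial (Fin d) ℂ) (a θ : Fin d → ℂ) :
    ∃ q : Polynomial ℂ, (∀ κ, q.eval κ = eval (a + κ • θ) P) ∧ LD q P.totalDegree (eval θ (pm P)) := by
  refine ⟨∑ α ∈ P.support, Polynomial.C (P.coeff α) *
    ∏ i, (Polynomial.C (a i) + Polynomial.C (θ i) * Polynomial.X) ^ α i, fun κ => ?_, ?_, ?_⟩
  · rw [eval_eq_sum_mon, Polynomial.eval_finsetSum]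
    refine Finset.sum_congr rfl fun α _ => ?_
    rw [eval_monomial_prod]
    simp only [Polynomial.eval_mul, Polynomial.eval_C, Polynomial.eval_prod, Polynomial.eval_pow,
      Polynomial.eval_add, Polynomial.eval_X, Pi.add_apply, Pi.smul_apply, smul_eq_mul, mul_comm κ]
  · refine Polynomial.natDegree_sum_le_of_forall_le _ _ fun α hα => ?_
    refine (Polynomial.natDegree_C_mul_le _ _).trans ?_
    refine (LD.prod a θ α Finset.univ).1.trans ?_
    rw [← Finsupp.degree_eq_sum]
    exact degree_le_totalDegree P α hα
  · rw [pm_eval, Polynomial.finsetSum_coeff]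
    refine Finset.sum_congr rfl fun α hα => ?_
    rw [Polynomial.coeff_C_mul]
    have h1 := LD.prod a θ α Finset.univ
    rw [← Finsupp.degree_eq_sum] at h1
    congr 1
    split_ifs with h
    · rw [← h]; exact h1.2
    · refine Polynomial.coeff_eq_zero_of_natDegree_lt (lt_of_le_of_lt h1.1 ?_)
      exact lt_of_le_of_ne (degree_le_totalDegree P α hα) h

lemma small_root (q : Polynomial ℂ) (m : ℕ) (hm : 1 ≤ m) (c : ℂ) (hc : c ≠ 0) (hq : LD q m c) :
    ∃ κ, q.eval κ = 0 ∧ ‖κ‖ ^ m * ‖c‖ ≤ ‖q.eval 0‖ := by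
  have hn : q.natDegree = m :=
    le_antisymm hq.1 (Polynomial.le_natDegree_of_ne_zero (by rw [hq.2]; exact hc))
  have hl : q.leadingCoeff = c := by rw [Polynomial.leadingCoeff, hn, hq.2]
  have hq0 : q ≠ 0 := by
    rintro rfl
    simp at hn; omega
  have hsp := IsAlgClosed.splits q
  have hcard : Multiset.card q.roots = m := by rw [← hn]; exact hsp.natDegree_eq_card_roots.symm
  have hne : q.roots.toFinset.Nonempty := by
    rw [Multiset.toFinset_nonempty]
    intro h
    rw [h] at hcard
    simp at hcard; omega
  obtain ⟨κ, hκ, hmin⟩ := Finset.exists_min_image q.roots.toFinset (fun z => ‖z‖₊) hne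
  rw [Multiset.mem_toFinset, Polynomial.mem_roots hq0] at hκ
  refine ⟨κ, hκ, ?_⟩
  have h1 : q.eval 0 = c * (q.roots.map fun z => -z).prod := by
    conv_lhs => rw [hsp.eq_prod_roots, hl]
    rw [Polynomial.eval_mul, Polynomial.eval_C, Polynomial.eval_multiset_prod, Multiset.map_map]
    congr 2
    refine Multiset.map_congr rfl fun z _ => ?_
    simp
  have h2 : ‖(q.roots.map fun z => -z).prod‖₊ = (q.roots.map fun z => ‖z‖₊).prod := by
    have := map_multiset_prod (nnnormHom : ℂ →*₀ NNReal) (q.roots.map fun z => -z)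
    rw [Multiset.map_map] at this
    simpa using this
  have h3 : ‖κ‖₊ ^ m ≤ (q.roots.map fun z => ‖z‖₊).prod := by
    have := Multiset.pow_card_le_prod (s := q.roots.map fun z => ‖z‖₊) (a := ‖κ‖₊) (fun x hx => by
      obtain ⟨z, hz, rfl⟩ := Multiset.mem_map.1 hx
      exact hmin z (Multiset.mem_toFinset.2 hz))
    rwa [Multiset.card_map, hcard] at this
  rw [← h2] at h3
  have h4 : ‖κ‖ ^ m ≤ ‖(q.roots.map fun z => -z).prod‖ := by exact_mod_cast h3
  rw [h1, norm_mul, mul_comm]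
  gcongr

lemma pm_ne {d : ℕ} (P : MvPolynomial (Fin d) ℂ) (hell : IsElliptic P) (y : EE d) (hy : y ≠ 0) :
    eval (re2 y) (pm P) ≠ 0 := by
  refine hell (fun i => y i) fun h => hy ?_
  ext i
  exact congrFun h i

lemma char_root {d : ℕ} (hd : 2 ≤ d) (P : MvPolynomial (Fin d) ℂ) (hell : IsElliptic P)
    (hm : 1 ≤ P.totalDegree) (y : EE d) (hy : y ≠ 0) :
    ∃ (ν : Fin d → ℂ) (σ : ℝ), 0 < σ ∧ eval ν (pm P) = 0 ∧
      ∀ x, (dotp ν x).re = σ * (inner ℝ y x) := by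
  obtain ⟨i, hi⟩ : ∃ i, y i ≠ 0 := by
    by_contra h
    push Not at h
    exact hy (by ext i; simpa using h i)
  obtain ⟨j, hj⟩ : ∃ j : Fin d, j ≠ i := by
    have : Nontrivial (Fin d) := Fin.nontrivial_iff_two_le.2 hd
    exact exists_ne i
  set ω : EE d := EuclideanSpace.single j 1 with hω
  have hωy : ∀ t : ℝ, ω + t • y ≠ 0 := by
    intro t h
    have h1 : (ω + t • y) i = 0 := by rw [h]; rfl
    have h2 : (ω + t • y) j = 0 := by rw [h]; rfl
    simp [hω, hj.symm] at h1 h2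
    rcases h1 with h1 | h1
    · simp [h1] at h2
    · exact hi h1
  have hne := pm_ne P hell y hy
  have hpm0 : pm P ≠ 0 := fun h => hne (by rw [h, map_zero])
  have htd : (pm P).totalDegree = P.totalDegree := (pm_homog P).totalDegree hpm0
  have hpp : pm (pm P) = pm P := by
    conv_lhs => rw [pm, htd]
    rw [homogeneousComponent_of_mem (pm_homog P), if_pos rfl]
  obtain ⟨q, hq1, hq2⟩ := lineP (pm P) (Complex.I • re2 ω) (re2 y)
  rw [htd, hpp] at hq2
  obtain ⟨τ, hτ, -⟩ := small_root q _ hm _ hne hq2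
  rw [hq1] at hτ
  have hτre : τ.re ≠ 0 := by
    intro h
    have e : Complex.I • re2 ω + τ • re2 y = Complex.I • re2 (ω + τ.im • y) := by
      have : τ = Complex.I * τ.im := by
        apply Complex.ext <;> simp [h]
      funext k
      simp only [Pi.add_apply, Pi.smul_apply, re2, smul_eq_mul, PiLp.add_apply, PiLp.smul_apply]
      rw [this]
      simp
      ring
    rw [e, pm_smul] at hτ
    rcases mul_eq_zero.1 hτ with h1 | h1
    · exact Complex.I_ne_zero (pow_eq_zero_iff (by omega) |>.1 h1)
    · exact pm_ne P hell _ (hωy _) h1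
  have hre : ∀ x, (dotp (Complex.I • re2 ω + τ • re2 y) x).re = τ.re * inner ℝ y x := by
    intro x
    rw [dotp, PiLp.inner_apply, Complex.re_sum, Finset.mul_sum]
    refine Finset.sum_congr rfl fun k _ => ?_
    simp [re2]
    ring
  rcases lt_or_gt_of_ne hτre with h | h
  · refine ⟨(-1 : ℂ) • (Complex.I • re2 ω + τ • re2 y), -τ.re, by linarith, ?_, fun x => ?_⟩
    · rw [pm_smul, hτ, mul_zero]
    · have : dotp ((-1 : ℂ) • (Complex.I • re2 ω + τ • re2 y)) x =
          - dotp (Complex.I • re2 ω + τ • re2 y) x := by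
        simp only [dotp, ← Finset.sum_neg_distrib]
        refine Finset.sum_congr rfl fun k _ => ?_
        simp; ring
      rw [this, Complex.neg_re, hre]; ring
  · exact ⟨_, τ.re, h, hτ, hre⟩

lemma exp_sep {d : ℕ} (hd : 2 ≤ d) (P : MvPolynomial (Fin d) ℂ) (hell : IsElliptic P)
    (hm : 1 ≤ P.totalDegree) (R : ℝ) (hR : 0 ≤ R) (y : EE d) (hy : R < ‖y‖) (γ : ℝ) :
    ∃ f, (∀ U, IsOpen U → MemCP P U f) ∧ ∃ M, (∀ x, ‖x‖ ≤ R → ‖f x‖ ≤ M) ∧ γ * M < ‖f y‖ := by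
  have hyp : 0 < ‖y‖ := by linarith
  have hy0 : y ≠ 0 := norm_pos_iff.1 hyp
  obtain ⟨ν, σ, hσ, hν, hνre⟩ := char_root hd P hell hm y hy0
  obtain ⟨C, hC, hdb⟩ := diff_bound P
  have hne := pm_ne P hell y hy0
  obtain ⟨k, hk⟩ : ∃ k, P.totalDegree = k + 1 := ⟨P.totalDegree - 1, by omega⟩
  set c := ‖eval (re2 y) (pm P)‖ with hc
  have hcp : 0 < c := norm_pos_iff.2 hne
  set gap := ‖y‖ ^ 2 - ‖y‖ * R with hgap
  have hgp : 0 < gap := by nlinarith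
  set D := (σ / 2) ^ (k + 1) * c with hD
  have hDp : 0 < D := by positivity
  set r := max 1 (max (C * (‖ν‖ + 1) ^ k / D + 1) (2 / σ * (|γ| / gap))) with hr
  have hr1 : 1 ≤ r := le_max_left _ _
  have hr2 : C * (‖ν‖ + 1) ^ k / D + 1 ≤ r := (le_max_left _ _).trans (le_max_right _ _)
  have hr3 : 2 / σ * (|γ| / gap) ≤ r := (le_max_right _ _).trans (le_max_right _ _)
  obtain ⟨q, hq1, hq2⟩ := lineP P ((r : ℂ) • ν) (re2 y)
  obtain ⟨κ, hκ, hκ2⟩ := small_root q _ hm _ hne hq2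
  rw [hq1] at hκ
  rw [hq1, zero_smul, add_zero, hk, ← hc] at hκ2
  have hPr : ‖eval ((r : ℂ) • ν) P‖ ≤ C * (r * (‖ν‖ + 1)) ^ k := by
    have h3 := hdb ((r : ℂ) • ν) 0
    rw [add_zero, pm_smul, hν, mul_zero, sub_zero, norm_zero, add_zero, mul_one, hk,
      pow_succ, ← mul_assoc] at h3
    have h4 := le_of_mul_le_mul_right h3 (by positivity)
    refine h4.trans ?_
    have : ‖(r : ℂ) • ν‖ + 1 ≤ r * (‖ν‖ + 1) := by
      rw [norm_smul, Complex.norm_real, Real.norm_of_nonneg (by linarith)]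
      linarith
    gcongr
  have hκs : ‖κ‖ ≤ r * σ / 2 := by
    by_contra h
    push Not at h
    have h1 : (r * σ / 2) ^ (k + 1) * c ≤ C * (r * (‖ν‖ + 1)) ^ k := by
      refine le_trans ?_ (hκ2.trans hPr)
      gcongr
    have h2 : (r * D) * r ^ k ≤ (C * (‖ν‖ + 1) ^ k) * r ^ k := by
      calc (r * D) * r ^ k = (r * σ / 2) ^ (k + 1) * c := by
            rw [hD, show r * σ / 2 = r * (σ / 2) by ring, mul_pow, pow_succ r]; ring
        _ ≤ _ := h1
        _ = _ := by rw [mul_pow]; ring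
    have h3 := le_of_mul_le_mul_right h2 (by positivity)
    rw [← le_div_iff₀ hDp] at h3
    linarith
  set ζ := (r : ℂ) • ν + κ • re2 y with hζ
  set ρ := r * σ + κ.re with hρ
  have hρ1 : r * σ / 2 ≤ ρ := by
    have := neg_abs_le κ.re
    have h2 := Complex.abs_re_le_norm κ
    linarith
  have hρp : 0 < ρ := lt_of_lt_of_le (by positivity) hρ1
  have hre : ∀ x, (dotp ζ x).re = ρ * inner ℝ y x := by
    intro x
    have e : dotp ζ x = r * dotp ν x + κ * ((inner ℝ y x : ℝ) : ℂ) := by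
      simp only [dotp, PiLp.inner_apply, Complex.ofReal_sum, Finset.mul_sum, ← Finset.sum_add_distrib]
      refine Finset.sum_congr rfl fun l _ => ?_
      simp [hζ, re2]
      ring
    rw [e, Complex.add_re, Complex.re_ofReal_mul, hνre, Complex.re_mul_ofReal, hρ]; ring
  have hnf : ∀ x, ‖eval ζ (1 : MvPolynomial (Fin d) ℂ) * Complex.exp (dotp ζ x)‖ =
      Real.exp (ρ * inner ℝ y x) := by
    intro x
    rw [map_one, one_mul, Complex.norm_exp, hre]
  refine ⟨fun x => eval ζ (1 : MvPolynomial (Fin d) ℂ) * Complex.exp (dotp ζ x), fun U hU =>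
    (isJet_exp ζ U).memCP hU P 1 (fun x _ => ?_), Real.exp (ρ * (‖y‖ * R)), fun x hx => ?_, ?_⟩
  · simp only [one_mul]
    rw [hκ, zero_mul]
  · rw [hnf]
    refine Real.exp_le_exp.2 (mul_le_mul_of_nonneg_left ?_ hρp.le)
    exact (real_inner_le_norm _ _).trans (by gcongr)
  · rw [hnf, real_inner_self_eq_norm_sq]
    have e : ρ * ‖y‖ ^ 2 = ρ * gap + ρ * (‖y‖ * R) := by rw [hgap]; ring
    rw [e, Real.exp_add]
    refine mul_lt_mul_of_pos_right ?_ (Real.exp_pos _)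
    have h1 : |γ| ≤ ρ * gap := by
      have h2 : |γ| / gap ≤ r * σ / 2 := by
        have : |γ| / gap = 2 / σ * (|γ| / gap) * σ / 2 := by field_simp
        rw [this]; gcongr
      have := h2.trans hρ1
      rwa [div_le_iff₀ hgp] at this
    have h3 := Real.add_one_le_exp (ρ * gap)
    have := le_abs_self γ
    linarith
end EK

namespace EK
open MvPolynomial MeasureTheory

lemma bsup_le {E : Type*} (K : Set E) (g : E → ℝ) (B : ℝ) (hB : 0 ≤ B) (h : ∀ x ∈ K, g x ≤ B) :
    (⨆ x ∈ K, g x) ≤ B :=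
  Real.iSup_le (fun x => Real.iSup_le (fun hx => h x hx) hB) hB

lemma le_bsup {E : Type*} (K : Set E) (g : E → ℝ) (B : ℝ) (h : ∀ x ∈ K, g x ≤ B)
    (x : E) (hx : x ∈ K) : g x ≤ ⨆ x ∈ K, g x := by
  have h1 : (⨆ (_ : x ∈ K), g x) = g x := ciSup_pos hx
  rw [← h1]
  refine le_ciSup (f := fun x => ⨆ (_ : x ∈ K), g x) ?_ x
  refine ⟨max B 0, ?_⟩
  rintro _ ⟨z, rfl⟩
  exact Real.iSup_le (fun hz => (h z hz).trans (le_max_left _ _)) (le_max_right _ _)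

lemma bsup_nonneg {E : Type*} (K : Set E) (g : E → ℝ) (h : ∀ x, 0 ≤ g x) : 0 ≤ ⨆ x ∈ K, g x :=
  Real.iSup_nonneg fun x => Real.iSup_nonneg fun _ => h x

lemma cpt_bdd {E : Type*} [TopologicalSpace E] {X K : Set E} (hK : IsCompact K) (hKX : K ⊆ X)
    (g : E → ℂ) (hg : ContinuousOn g X) : ∃ B, ∀ x ∈ K, ‖g x‖ ≤ B :=
  hK.exists_bound_of_continuousOn (hg.mono hKX)

lemma one_le_deg {d : ℕ} (hd : 2 ≤ d) (P : MvPolynomial (Fin d) ℂ) (hell : IsElliptic P)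
    (hP0 : eval (fun _ => (0 : ℂ)) P = 0) : 1 ≤ P.totalDegree := by
  by_contra h
  have h0 : P.totalDegree = 0 := by omega
  rw [totalDegree_eq_zero_iff_eq_C] at h0
  rw [h0, eval_C] at hP0
  rw [hP0, C_0] at h0
  have hy : (EuclideanSpace.single (⟨0, by omega⟩ : Fin d) (1 : ℝ) : EE d) ≠ 0 := by
    rw [← norm_pos_iff]; simp
  exact pm_ne P hell _ hy (by rw [h0]; simp [pm])

lemma forward {d : ℕ} (P : MvPolynomial (Fin d) ℂ)
    (hP0 : eval (fun _ => (0 : ℂ)) P = 0) (X : Set (EE d)) (hX : IsOpen X) :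
    ∃ f : EE d → ℂ, MemCP P X f ∧ ∀ x, f x = 1 := by
  refine ⟨_, (isJet_exp (fun _ => 0) X).memCP hX P 1 (fun x _ => ?_), fun x => ?_⟩
  · simp only [one_mul]
    rw [hP0, zero_mul]
  · simp [dotp]

lemma cont_op {d : ℕ} {X : Set (EE d)} {w : EE d → ℂ} (hw : ContinuousOn w X) {ψ : EE d → EE d}
    (hψ : ContinuousOn ψ X) (hψX : Set.MapsTo ψ X X) (m : ℕ) {f : EE d → ℂ} (hf : ContinuousOn f X) :
    ContinuousOn (fun x => (∏ j ∈ Finset.range m, w (ψ^[j] x)) * f (ψ^[m] x)) X := by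
  refine ContinuousOn.mul (continuousOn_finsetProd _ fun j _ => ?_) ?_
  · exact hw.comp (hψ.iterate hψX j) (hψX.iterate j)
  · exact hf.comp (hψ.iterate hψX m) (hψX.iterate m)

/-- Points controlled by a compact set lie in a fixed compact subset. -/
lemma control {d : ℕ} (hd : 2 ≤ d) (P : MvPolynomial (Fin d) ℂ) (hell : IsElliptic P)
    (hm : 1 ≤ P.totalDegree) (X : Set (EE d)) (hX : IsOpen X) (L : Set (EE d)) (hL : IsCompact L)
    (hLX : L ⊆ X) : ∃ L' : Set (EE d), IsCompact L' ∧ L' ⊆ X ∧ ∀ y ∈ X, ∀ γ : ℝ, 0 ≤ γ →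
      (∀ f, MemCP P X f → ∀ M : ℝ, (∀ x ∈ L, ‖f x‖ ≤ M) → ‖f y‖ ≤ γ * M) → y ∈ L' := by
  obtain ⟨R0, hR0⟩ := hL.isBounded.exists_norm_le
  set R := max R0 0 with hRd
  have hR : 0 ≤ R := le_max_right _ _
  have hRL : ∀ x ∈ L, ‖x‖ ≤ R := fun x hx => (hR0 x hx).trans (le_max_left _ _)
  obtain ⟨r, hr, hrL⟩ := hL.exists_thickening_subset_open hX hLX
  have hrp : ∀ x ∈ L, ∀ p ∉ X, r ≤ ‖x - p‖ := by
    intro x hx p hp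
    by_contra h
    push Not at h
    refine hp (hrL (Metric.mem_thickening_iff.2 ⟨x, hx, ?_⟩))
    rwa [dist_comm, dist_eq_norm]
  obtain ⟨δ, hδ, hb⟩ := bdry hd P hell hm r (2 * R + 1) hr (by linarith)
  set δ' := min δ 1 with hδ'
  have hδp : 0 < δ' := lt_min hδ one_pos
  refine ⟨Metric.closedBall 0 R ∩ {x | ∀ p ∉ X, δ' ≤ dist x p}, ?_, ?_, ?_⟩
  · refine (isCompact_closedBall _ _).inter_right ?_
    simp only [Set.ofPred_forall]
    exact isClosed_iInter fun p => isClosed_iInter fun _ => isClosed_le continuous_const (by fun_prop)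
  · rintro x ⟨-, hx⟩
    by_contra h
    have := hx x h
    rw [dist_self] at this
    linarith
  · intro y hy γ hγ hyp
    have hyR : ‖y‖ ≤ R := by
      by_contra h
      push Not at h
      obtain ⟨f, hf, M, hM, hlt⟩ := exp_sep hd P hell hm R hR y h γ
      have := hyp f (hf X hX) M (fun x hx => hM x (hRL x hx))
      linarith
    refine ⟨by simpa using hyR, fun p hp => ?_⟩
    by_contra h
    push Not at h
    rw [dist_eq_norm] at h
    obtain ⟨f, hf, M, hM, hlt⟩ := hb X hX p hp y hy (h.trans_le (min_le_left _ _)) γ hγ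
    have := hyp f hf M (fun x hx => hM x (hLX hx) (hrp x hx p hp) ?_)
    · linarith
    · have h1 := h.trans_le (min_le_right _ _)
      have h2 := norm_sub_le x p
      have h3 := norm_sub_norm_le p y
      rw [norm_sub_rev] at h3
      have := hRL x hx
      linarith

end EK

/-- For an elliptic `P` with `P(0) = 0` in `d ≥ 2` variables, a weight
`w` not vanishing identically on any connected component of `X`, and a locally injective
continuous symbol `ψ`, the operator `C_{w,ψ}` is power bounded on `C_P^∞(X)` iff it is
topologizable and the orbit `{C_{w,ψ}^m(w) : m ∈ ℕ}` is bounded in `C(X)`. -/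
theorem power_bounded_characterization_elliptic_kernel
    {d : ℕ} (hd : 2 ≤ d) (P : MvPolynomial (Fin d) ℂ) (hell : IsElliptic P)
    (hP0 : MvPolynomial.eval (fun _ => (0 : ℂ)) P = 0)
    (X : Set (EuclideanSpace ℝ (Fin d))) (hX : IsOpen X)
    (w : EuclideanSpace ℝ (Fin d) → ℂ) (hw : ContinuousOn w X)
    (hwcomp : ∀ x ∈ X, ∃ y ∈ connectedComponentIn X x, w y ≠ 0)
    (ψ : EuclideanSpace ℝ (Fin d) → EuclideanSpace ℝ (Fin d))
    (hψ : ContinuousOn ψ X) (hψX : Set.MapsTo ψ X X)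
    (hloc : ∀ x ∈ X, ∃ U : Set (EuclideanSpace ℝ (Fin d)),
      IsOpen U ∧ x ∈ U ∧ U ⊆ X ∧ Set.InjOn ψ U)
    (hinv : ∀ f, MemCP P X f → MemCP P X (fun x => w x * f (ψ x))) :
    -- power bounded
    (∀ K : Set (EuclideanSpace ℝ (Fin d)), IsCompact K → K ⊆ X →
      ∃ L : Set (EuclideanSpace ℝ (Fin d)), IsCompact L ∧ L ⊆ X ∧ ∃ C : ℝ, 0 < C ∧
        ∀ m : ℕ, 1 ≤ m → ∀ f, MemCP P X f →
          (⨆ x ∈ K, ‖(∏ j ∈ Finset.range m, w (ψ^[j] x)) * f (ψ^[m] x)‖) ≤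
            C * ⨆ y ∈ L, ‖f y‖) ↔
    -- topologizable and {C_{w,ψ}^m(w)} bounded in C(X)
    ((∀ K : Set (EuclideanSpace ℝ (Fin d)), IsCompact K → K ⊆ X →
      ∃ L : Set (EuclideanSpace ℝ (Fin d)), IsCompact L ∧ L ⊆ X ∧
        ∀ m : ℕ, 1 ≤ m → ∃ γ : ℝ, 0 < γ ∧
          ∀ f, MemCP P X f →
            (⨆ x ∈ K, ‖(∏ j ∈ Finset.range m, w (ψ^[j] x)) * f (ψ^[m] x)‖) ≤
              γ * ⨆ y ∈ L, ‖f y‖) ∧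
     (∀ K : Set (EuclideanSpace ℝ (Fin d)), IsCompact K → K ⊆ X →
      ∃ M : ℝ, ∀ m : ℕ, 1 ≤ m → ∀ x ∈ K,
        ‖(∏ j ∈ Finset.range m, w (ψ^[j] x)) * w (ψ^[m] x)‖ ≤ M)) := by
  have hm := EK.one_le_deg hd P hell hP0
  constructor
  · intro hpb
    refine ⟨fun K hK hKX => ?_, fun K hK hKX => ?_⟩
    · obtain ⟨L, hL, hLX, C, hC, h⟩ := hpb K hK hKX
      exact ⟨L, hL, hLX, fun m hm1 => ⟨C, hC, h m hm1⟩⟩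
    · obtain ⟨L, hL, hLX, C, hC, h⟩ := hpb K hK hKX
      obtain ⟨f, hf, hf1⟩ := EK.forward P hP0 X hX
      refine ⟨C * 1, fun m hm1 x hx => ?_⟩
      have h1 := h (m + 1) (by omega) f hf
      obtain ⟨B, hB⟩ := EK.cpt_bdd hK hKX _
        (EK.cont_op hw hψ hψX (m + 1) hf.1.continuousOn)
      have h2 := EK.le_bsup K _ B hB x hx
      have h3 : (⨆ y ∈ L, ‖f y‖) ≤ 1 :=
        EK.bsup_le L _ 1 zero_le_one fun y _ => by rw [hf1, norm_one]
      have h4 := (h2.trans h1).trans (mul_le_mul_of_nonneg_left h3 hC.le)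
      rw [hf1, mul_one, Finset.prod_range_succ] at h4
      exact h4
  · rintro ⟨htop, horb⟩ K hK hKX
    obtain ⟨L, hL, hLX, htop⟩ := htop K hK hKX
    obtain ⟨M1, hM1⟩ := horb K hK hKX
    obtain ⟨M2, hM2⟩ := EK.cpt_bdd hK hKX w hw
    obtain ⟨L', hL', hL'X, hctl⟩ := EK.control hd P hell hm X hX (L ∪ K) (hL.union hK)
      (Set.union_subset hLX hKX)
    have hA : ∀ m : ℕ, 1 ≤ m → ∀ x ∈ K,
        ‖∏ j ∈ Finset.range m, w (ψ^[j] x)‖ ≤ max 1 (max M1 M2) := by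
      intro m hm1 x hx
      obtain ⟨k, rfl⟩ : ∃ k, m = k + 1 := ⟨m - 1, by omega⟩
      rcases Nat.eq_zero_or_pos k with rfl | hk
      · have := hM2 x hx
        simp only [zero_add, Finset.range_one, Finset.prod_singleton, Function.iterate_zero, id]
        exact this.trans ((le_max_right _ _).trans (le_max_right _ _))
      · rw [Finset.prod_range_succ]
        exact (hM1 k hk x hx).trans ((le_max_left _ _).trans (le_max_right _ _))
    refine ⟨L', hL', hL'X, max 1 (max M1 M2), lt_of_lt_of_le one_pos (le_max_left _ _),
      fun m hm1 f hf => ?_⟩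
    have hC0 : (0 : ℝ) ≤ max 1 (max M1 M2) := zero_le_one.trans (le_max_left _ _)
    have hS0 : 0 ≤ ⨆ y ∈ L', ‖f y‖ := EK.bsup_nonneg _ _ fun y => norm_nonneg _
    refine EK.bsup_le K _ _ (mul_nonneg hC0 hS0) fun x hx => ?_
    rw [norm_mul]
    by_cases h0 : (∏ j ∈ Finset.range m, w (ψ^[j] x)) = 0
    · rw [h0, norm_zero, zero_mul]
      exact mul_nonneg hC0 hS0
    have hAp : 0 < ‖∏ j ∈ Finset.range m, w (ψ^[j] x)‖ := norm_pos_iff.2 h0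
    obtain ⟨γ, hγ, hγ2⟩ := htop m hm1
    have hyL : ψ^[m] x ∈ L' := by
      refine hctl _ (hψX.iterate m (hKX hx))
        (γ / ‖∏ j ∈ Finset.range m, w (ψ^[j] x)‖) (by positivity) fun g hg M hM => ?_
      obtain ⟨B, hB⟩ := EK.cpt_bdd hK hKX _ (EK.cont_op hw hψ hψX m hg.1.continuousOn)
      have h2 := EK.le_bsup K _ B hB x hx
      have hM0 : 0 ≤ M := (norm_nonneg _).trans (hM x (Or.inr hx))
      have h3 : (⨆ y ∈ L, ‖g y‖) ≤ M := EK.bsup_le L _ M hM0 fun y hy => hM y (Or.inl hy)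
      have h4 := (h2.trans (hγ2 g hg)).trans (mul_le_mul_of_nonneg_left h3 hγ.le)
      rw [norm_mul] at h4
      rw [div_mul_eq_mul_div, le_div_iff₀ hAp, mul_comm]
      exact h4
    obtain ⟨B, hB⟩ := EK.cpt_bdd hL' hL'X _ hf.1.continuousOn
    exact mul_le_mul (hA m hm1 x hx) (EK.le_bsup L' (fun y => ‖f y‖) B hB _ hyL)
      (norm_nonneg _) hC0

end
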